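/- Let G = ⟨S|R⟩ be a C'(1/9) group whose Morse boundary is σ-compact, i.e. there is a sequence (M_n) of Morse gauges such that every Morse geodesic ray in Cay(G,S) based at the identity is M_n-Morse for some n. Then for every Morse gauge M and every constant Q ≥ 1 there exist a scale L, a constant Q' ≥ 1 and a Morse gauge M'' such that every path in Cay(G,S) which is L-locally an M-Morse Q-quasi-geodesic is globally an M''-Morse Q'-quasi-geodesic. -/

import Mathlib

open Metric Set Filter

namespace MorseLTG

/-- A Morse gauge: a non-decreasing continuous function `[1, ∞) → [0, ∞)`. -/
def IsMorseGauge (M : ℝ → ℝ) : Prop :=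
  MonotoneOn M (Set.Ici 1) ∧ ContinuousOn M (Set.Ici 1) ∧ ∀ t : ℝ, 1 ≤ t → 0 ≤ M t

section Space

variable {X : Type*} [MetricSpace X]

/-- `γ` is a `Q`-quasi-geodesic on the set `I ⊆ ℝ`. -/
def QGeoOn (Q : ℝ) (I : Set ℝ) (γ : ℝ → X) : Prop :=
  ContinuousOn γ I ∧ ∀ s ∈ I, ∀ t ∈ I,
    |t - s| / Q - Q ≤ dist (γ s) (γ t) ∧ dist (γ s) (γ t) ≤ Q * |t - s| + Q

/-- `γ` is `M`-Morse on `I`: every `Q`-quasi-geodesic with endpoints on `γ|_I`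
stays in the closed `M Q`-neighbourhood of the corresponding subsegment of `γ`. -/
def MorseOn (M : ℝ → ℝ) (I : Set ℝ) (γ : ℝ → X) : Prop :=
  ∀ Q : ℝ, 1 ≤ Q → ∀ s ∈ I, ∀ t ∈ I, s ≤ t →
    ∀ (lam : ℝ → X) (a b : ℝ), a ≤ b → QGeoOn Q (Set.Icc a b) lam →
      lam a = γ s → lam b = γ t →
      ∀ u ∈ Set.Icc a b, ∃ v ∈ Set.Icc s t, dist (lam u) (γ v) ≤ M Q

/-- `γ` is a geodesic on `I` (an isometric embedding). -/
def GeodesicOn (I : Set ℝ) (γ : ℝ → X) : Prop :=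
  ∀ s ∈ I, ∀ t ∈ I, dist (γ s) (γ t) = |t - s|

/-- A geodesic ray based at `x₀`. -/
def GeodesicRayFrom (x₀ : X) (γ : ℝ → X) : Prop :=
  γ 0 = x₀ ∧ GeodesicOn (Set.Ici 0) γ

/-- A Morse geodesic ray (based anywhere). -/
def IsMorseGeodesicRay (γ : ℝ → X) : Prop :=
  GeodesicOn (Set.Ici 0) γ ∧ ∃ M : ℝ → ℝ, IsMorseGauge M ∧ MorseOn M (Set.Ici 0) γ

/-- `p` is `L`-locally an `M`-Morse `Q`-quasi-geodesic on `I`. -/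
def LocMorseQGeoOn (Q : ℝ) (M : ℝ → ℝ) (L : ℝ) (I : Set ℝ) (p : ℝ → X) : Prop :=
  ∀ s ∈ I, ∀ t ∈ I, s ≤ t → t - s ≤ L →
    QGeoOn Q (Set.Icc s t) p ∧ MorseOn M (Set.Icc s t) p

/-- `p` is `L`-locally `M`-Morse on `I`. -/
def LocMorseOn (M : ℝ → ℝ) (L : ℝ) (I : Set ℝ) (p : ℝ → X) : Prop :=
  ∀ s ∈ I, ∀ t ∈ I, s ≤ t → t - s ≤ L → MorseOn M (Set.Icc s t) p

/-- The Morse local-to-global property for a geodesic metric space. -/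
def MLTG (X : Type*) [MetricSpace X] : Prop :=
  ∀ Q : ℝ, 1 ≤ Q → ∀ M : ℝ → ℝ, IsMorseGauge M →
    ∃ (L Q' : ℝ) (M' : ℝ → ℝ), 0 < L ∧ 1 ≤ Q' ∧ IsMorseGauge M' ∧
      ∀ I : Set ℝ, I.OrdConnected → ∀ p : ℝ → X,
        LocMorseQGeoOn Q M L I p → QGeoOn Q' I p ∧ MorseOn M' I p

/-- `X` is a geodesic metric space. -/
def GeodesicSpace (X : Type*) [MetricSpace X] : Prop :=
  ∀ x y : X, ∃ γ : ℝ → X, γ 0 = x ∧ γ (dist x y) = y ∧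
    GeodesicOn (Set.Icc 0 (dist x y)) γ

/-- Gromov hyperbolicity via thin geodesic triangles. -/
def GromovHyperbolic (X : Type*) [MetricSpace X] : Prop :=
  ∃ δ : ℝ, 0 ≤ δ ∧
    ∀ (γ₁ γ₂ γ₃ : ℝ → X) (a₁ b₁ a₂ b₂ a₃ b₃ : ℝ),
      GeodesicOn (Set.Icc a₁ b₁) γ₁ → GeodesicOn (Set.Icc a₂ b₂) γ₂ →
        GeodesicOn (Set.Icc a₃ b₃) γ₃ →
      γ₁ b₁ = γ₂ a₂ → γ₂ b₂ = γ₃ a₃ → γ₃ b₃ = γ₁ a₁ →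
      ∀ s ∈ Set.Icc a₁ b₁,
        ∃ p ∈ γ₂ '' Set.Icc a₂ b₂ ∪ γ₃ '' Set.Icc a₃ b₃, dist (γ₁ s) p ≤ δ

/-- The set of closest-point projections of `x` to `A`. -/
def projSet (A : Set X) (x : X) : Set X :=
  {y ∈ A | ∀ z ∈ A, dist x y ≤ dist x z}

/-- A subset `A` is `C`-contracting. -/
def ContractingSet (C : ℝ) (A : Set X) : Prop :=
  ∀ x : X, Metric.diam (⋃ y ∈ Metric.ball x (Metric.infDist x A), projSet A y) ≤ C

/-- `γ` is a `C`-contracting geodesic on `I`. -/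
def ContractingOn (C : ℝ) (I : Set ℝ) (γ : ℝ → X) : Prop :=
  GeodesicOn I γ ∧ ContractingSet C (γ '' I)

/-- The Morse boundary of `X` (with basepoint `x₀`) is σ-compact. -/
def SigmaCompactMorseBoundary (x₀ : X) : Prop :=
  ∃ Ms : ℕ → ℝ → ℝ, (∀ n, IsMorseGauge (Ms n)) ∧
    ∀ γ : ℝ → X, GeodesicRayFrom x₀ γ → ∀ M : ℝ → ℝ, IsMorseGauge M →
      MorseOn M (Set.Ici 0) γ → ∃ n, MorseOn (Ms n) (Set.Ici 0) γ

/-- `Ms` is a strong exhaustion of the Morse boundary of `X` based at `x₀`. -/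
def IsStrongExhaustion (x₀ : X) (Ms : ℕ → ℝ → ℝ) : Prop :=
  (∀ n, IsMorseGauge (Ms n)) ∧
  (∀ γ : ℝ → X, GeodesicRayFrom x₀ γ → ∀ M : ℝ → ℝ, IsMorseGauge M →
    MorseOn M (Set.Ici 0) γ → ∃ n, MorseOn (Ms n) (Set.Ici 0) γ) ∧
  (∀ M : ℝ → ℝ, IsMorseGauge M → ∃ n, ∀ γ : ℝ → X, GeodesicRayFrom x₀ γ →
    MorseOn M (Set.Ici 0) γ → MorseOn (Ms n) (Set.Ici 0) γ)

/-- The Morse boundary of `X` (with basepoint `x₀`) is strongly σ-compact. -/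
def StronglySigmaCompactMorseBoundary (x₀ : X) : Prop :=
  ∃ Ms : ℕ → ℝ → ℝ, IsStrongExhaustion x₀ Ms

end Space

section Action

variable {G : Type*} [Group G] {X : Type*} [MetricSpace X]

/-- `φ` is an action of `G` on `X` by isometries. -/
def IsIsometricAction (φ : G → X → X) : Prop :=
  (∀ x : X, φ 1 x = x) ∧ (∀ g h : G, ∀ x : X, φ (g * h) x = φ g (φ h x)) ∧
    ∀ g : G, Isometry (φ g)

/-- `φ` is a geometric (proper and cocompact, isometric) action of `G` on `X`. -/
def IsGeometricAction (φ : G → X → X) : Prop :=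
  IsIsometricAction φ ∧
  (∀ (x : X) (r : ℝ), {g : G | dist x (φ g x) ≤ r}.Finite) ∧
  (∃ (x₀ : X) (r : ℝ), ∀ y : X, ∃ g : G, dist y (φ g x₀) ≤ r)

end Action

/-- `G` has contraction: it acts geometrically on some geodesic metric space
containing a strongly contracting geodesic ray. -/
def HasContraction (G : Type*) [Group G] : Prop :=
  ∃ (X : Type) (m : MetricSpace X), ∃ φ : G → X → X,
    letI := m
    IsGeometricAction φ ∧ GeodesicSpace X ∧
      ∃ (γ : ℝ → X) (C : ℝ), 0 ≤ C ∧ GeodesicOn (Set.Ici 0) γ ∧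
        ContractingSet C (γ '' Set.Ici 0)

section Horo

variable {X : Type*} [MetricSpace X]

/-- The horofunction associated to a geodesic ray `γ` based at `x₀`
(for geodesic rays, the infimum below equals the limit of
`t ↦ d(z, γ t) - d(x₀, γ t)` as `t → ∞`, since this function is non-increasing
and bounded below). -/
noncomputable def horofn (x₀ : X) (γ : ℝ → X) (z : X) : ℝ :=
  sInf ((fun t => dist z (γ t) - dist x₀ (γ t)) '' Set.Ici 0)

/-- The horofunction map `y ↦ ρ_y = d(·, y) - d(x₀, y)`. -/
noncomputable def horomap (x₀ y : X) : ContinuousMap X ℝ :=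
  ⟨fun z => dist z y - dist x₀ y, by fun_prop⟩

end Horo

section HoroAction

variable {G : Type*} [Group G] {X : Type*} [MetricSpace X]

/-- The `G`-action on the horofunction compactification:
`(g · f)(z) = f (g⁻¹ z) - f (g⁻¹ x₀)`. -/
noncomputable def horoAction (φ : G → X → X) (hc : ∀ g : G, Continuous (φ g)) (x₀ : X)
    (g : G) (f : ContinuousMap X ℝ) : ContinuousMap X ℝ :=
  ⟨fun z => f (φ g⁻¹ z) - f (φ g⁻¹ x₀), (f.continuous.comp (hc g⁻¹)).sub continuous_const⟩

end HoroAction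

section Words

variable {S : Type*}

/-- A word over the symmetrised alphabet `S ∪ S⁻¹`. -/
abbrev Word (S : Type*) := List (S × Bool)

/-- The formal inverse of a word. -/
def wordInv (w : Word S) : Word S := (w.map fun a => (a.1, !a.2)).reverse

/-- A word is reduced if it has no adjacent cancelling pair. -/
def ReducedWord (w : Word S) : Prop := w.Chain' fun a b => a.1 = b.1 → a.2 = b.2

/-- A word is cyclically reduced if all its cyclic shifts are reduced. -/
def CyclicallyReduced (w : Word S) : Prop := ∀ k : ℕ, ReducedWord (w.rotate k)

/-- The closure of `R ∪ R⁻¹` under cyclic shifts. -/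
def symmClosure (R : Set (Word S)) : Set (Word S) :=
  {w | ∃ r ∈ R, ∃ k : ℕ, w = r.rotate k ∨ w = (wordInv r).rotate k}

/-- A piece: a (non-trivial) common prefix of two distinct elements of `R̄`. -/
def IsPiece (R : Set (Word S)) (p : Word S) : Prop :=
  p ≠ [] ∧ ∃ r₁ ∈ symmClosure R, ∃ r₂ ∈ symmClosure R, r₁ ≠ r₂ ∧ p <+: r₁ ∧ p <+: r₂

/-- The `C'(lam)` small-cancellation condition. -/
def SmallCancellation (R : Set (Word S)) (lam : ℝ) : Prop :=
  (∀ r ∈ R, CyclicallyReduced r) ∧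
  ∀ r ∈ symmClosure R, ∀ p : Word S, IsPiece R p → p <:+: r →
    (p.length : ℝ) < lam * r.length

/-- A viable function. -/
def Viable (f : ℕ → ℝ) : Prop :=
  Monotone f ∧ (∀ n, 6 ≤ f n) ∧ Filter.Tendsto f Filter.atTop Filter.atTop

/-- The pair `(x, R)` satisfies the `C'(1/f)` small-cancellation condition. -/
def PairSmallCancellation (f : ℕ → ℝ) (x : Word S) (R : Set (Word S)) : Prop :=
  ∀ r ∈ symmClosure R, ∀ p : Word S, p ≠ [] → p <:+: x → p <:+: r →
    (p.length : ℝ) < (r.length : ℝ) / f r.length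

/-- The increasing partial small-cancellation condition. -/
def IPSC (R : Set (Word S)) : Prop :=
  ∀ ns : ℕ → ℕ, (∀ i, 0 < ns i) →
    ∃ f : ℕ → ℝ, Viable f ∧
      ∀ K : ℕ, ∃ i : ℕ, K ≤ i ∧ ∃ r ∈ symmClosure R, ∃ x y : Word S,
        r = x ++ y ∧ (ns i : ℝ) ≤ r.length ∧ (r.length : ℝ) / i ≤ x.length ∧
        PairSmallCancellation f x R

end Words

section Cayley

variable {G : Type*} [Group G] {S : Type*}

/-- The element of `G` spelled by a word over `S ∪ S⁻¹`. -/
def evalWord (σ : S → G) (w : Word S) : G :=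
  (w.map fun a => if a.2 then σ a.1 else (σ a.1)⁻¹).prod

/-- The word metric on `G` with respect to the generating map `σ`. -/
noncomputable def wordDist (σ : S → G) (g h : G) : ℕ :=
  sInf {n : ℕ | ∃ w : Word S, w.length = n ∧ g * evalWord σ w = h}

/-- A (discrete) edge path in the Cayley graph: consecutive points are adjacent. -/
def DIsPath (σ : S → G) (I : Set ℤ) (p : ℤ → G) : Prop :=
  ∀ n : ℤ, n ∈ I → n + 1 ∈ I → wordDist σ (p n) (p (n + 1)) ≤ 1

/-- A discrete `Q`-quasi-geodesic in the Cayley graph. -/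
def DQGeoOn (σ : S → G) (Q : ℝ) (I : Set ℤ) (p : ℤ → G) : Prop :=
  DIsPath σ I p ∧ ∀ m ∈ I, ∀ n ∈ I,
    |(n : ℝ) - (m : ℝ)| / Q - Q ≤ (wordDist σ (p m) (p n) : ℝ) ∧
      (wordDist σ (p m) (p n) : ℝ) ≤ Q * |(n : ℝ) - (m : ℝ)| + Q

/-- A discrete geodesic in the Cayley graph. -/
def DGeodesicOn (σ : S → G) (I : Set ℤ) (p : ℤ → G) : Prop :=
  ∀ m ∈ I, ∀ n ∈ I, (wordDist σ (p m) (p n) : ℤ) = |n - m|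

/-- `p` is `M`-Morse on `I` in the Cayley graph. -/
def DMorseOn (σ : S → G) (M : ℝ → ℝ) (I : Set ℤ) (p : ℤ → G) : Prop :=
  ∀ Q : ℝ, 1 ≤ Q → ∀ s ∈ I, ∀ t ∈ I, s ≤ t →
    ∀ (q : ℤ → G) (a b : ℤ), a ≤ b → DQGeoOn σ Q (Set.Icc a b) q →
      q a = p s → q b = p t →
      ∀ n ∈ Set.Icc a b, ∃ m ∈ Set.Icc s t, (wordDist σ (q n) (p m) : ℝ) ≤ M Q

/-- A geodesic ray in the Cayley graph based at the identity. -/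
def DGeodesicRay (σ : S → G) (p : ℤ → G) : Prop :=
  p 0 = 1 ∧ DGeodesicOn σ (Set.Ici 0) p

/-- `p` is `L`-locally an `M`-Morse `Q`-quasi-geodesic. -/
def DLocMorseQGeoOn (σ : S → G) (Q : ℝ) (M : ℝ → ℝ) (L : ℝ) (I : Set ℤ) (p : ℤ → G) : Prop :=
  ∀ s ∈ I, ∀ t ∈ I, s ≤ t → ((t - s : ℤ) : ℝ) ≤ L →
    DQGeoOn σ Q (Set.Icc s t) p ∧ DMorseOn σ M (Set.Icc s t) p

/-- `p` is `L`-locally `M`-Morse. -/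
def DLocMorseOn (σ : S → G) (M : ℝ → ℝ) (L : ℝ) (I : Set ℤ) (p : ℤ → G) : Prop :=
  ∀ s ∈ I, ∀ t ∈ I, s ≤ t → ((t - s : ℤ) : ℝ) ≤ L → DMorseOn σ M (Set.Icc s t) p

/-- The Morse local-to-global property for the Cayley graph of `(G, σ)`. -/
def CayMLTG (σ : S → G) : Prop :=
  ∀ Q : ℝ, 1 ≤ Q → ∀ M : ℝ → ℝ, IsMorseGauge M →
    ∃ (L Q' : ℝ) (M' : ℝ → ℝ), 0 < L ∧ 1 ≤ Q' ∧ IsMorseGauge M' ∧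
      ∀ I : Set ℤ, I.OrdConnected → ∀ p : ℤ → G,
        DLocMorseQGeoOn σ Q M L I p → DQGeoOn σ Q' I p ∧ DMorseOn σ M' I p

/-- The geodesic Morse local-to-global property for the Cayley graph. -/
def CayGeodesicMLTG (σ : S → G) : Prop :=
  ∀ M : ℝ → ℝ, IsMorseGauge M →
    ∃ (L : ℝ) (M' : ℝ → ℝ), 0 < L ∧ IsMorseGauge M' ∧
      ∀ I : Set ℤ, I.OrdConnected → ∀ p : ℤ → G, DGeodesicOn σ I p →
        DLocMorseOn σ M L I p → DMorseOn σ M' I p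

/-- σ-compactness of the Morse boundary of the Cayley graph. -/
def CaySigmaCompact (σ : S → G) : Prop :=
  ∃ Ms : ℕ → ℝ → ℝ, (∀ n, IsMorseGauge (Ms n)) ∧
    ∀ p : ℤ → G, DGeodesicRay σ p → ∀ M : ℝ → ℝ, IsMorseGauge M →
      DMorseOn σ M (Set.Ici 0) p → ∃ n, DMorseOn σ (Ms n) (Set.Ici 0) p

/-- Strong σ-compactness of the Morse boundary of the Cayley graph. -/
def CayStronglySigmaCompact (σ : S → G) : Prop :=
  ∃ Ms : ℕ → ℝ → ℝ, (∀ n, IsMorseGauge (Ms n)) ∧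
    (∀ p : ℤ → G, DGeodesicRay σ p → ∀ M : ℝ → ℝ, IsMorseGauge M →
      DMorseOn σ M (Set.Ici 0) p → ∃ n, DMorseOn σ (Ms n) (Set.Ici 0) p) ∧
    (∀ M : ℝ → ℝ, IsMorseGauge M → ∃ n, ∀ p : ℤ → G, DGeodesicRay σ p →
      DMorseOn σ M (Set.Ici 0) p → DMorseOn σ (Ms n) (Set.Ici 0) p)

/-- The edge path starting at `g` labelled by the word `w`. -/
def pathOfWord (σ : S → G) (g : G) (w : Word S) : ℤ → G :=
  fun n => g * evalWord σ (w.take n.toNat)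

end Cayley

/-- The canonical generating map of a presented group `⟨S | R⟩`. -/
def presGen {S : Type*} (R : Set (Word S)) : S → PresentedGroup (FreeGroup.mk '' R) :=
  fun s => PresentedGroup.of s

end MorseLTG

namespace MorseLTG

section P1
variable {S : Type*}

/-- letter inverse -/
def li (a : S × Bool) : S × Bool := (a.1, !a.2)

@[simp] theorem li_li (a : S × Bool) : li (li a) = a := by simp [li]

@[simp] theorem winv_nil : wordInv ([] : Word S) = [] := rfl
@[simp] theorem winv_cons (a : S × Bool) (w : Word S) :
    wordInv (a :: w) = wordInv w ++ [li a] := by simp [wordInv, li]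
@[simp] theorem winv_append (u v : Word S) :
    wordInv (u ++ v) = wordInv v ++ wordInv u := by simp [wordInv]
@[simp] theorem winv_length (u : Word S) : (wordInv u).length = u.length := by simp [wordInv]
@[simp] theorem winv_winv (u : Word S) : wordInv (wordInv u) = u := by
  induction u with
  | nil => rfl
  | cons a u ih => simp [ih]

theorem winv_eq_iff {u v : Word S} : wordInv u = v ↔ u = wordInv v := by
  constructor
  · rintro rfl; simp
  · rintro rfl; simp

@[simp] theorem winv_eq_nil {u : Word S} : wordInv u = [] ↔ u = [] := by
  rw [winv_eq_iff]; simp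

/-- symmetrised small cancellation data -/
structure SC (C : Set (Word S)) : Prop where
  ne : ∀ r ∈ C, r ≠ []
  rot : ∀ x y : Word S, x ++ y ∈ C → y ++ x ∈ C
  inv : ∀ r ∈ C, wordInv r ∈ C
  red : ∀ r ∈ C, ReducedWord r
  pc : ∀ r₁ ∈ C, ∀ r₂ ∈ C, r₁ ≠ r₂ → ∀ p : Word S, p ≠ [] → p <+: r₁ → p <+: r₂ →
    9 * p.length + 1 ≤ r₁.length

inductive D (C : Set (Word S)) : ℕ → Word S → Prop
  | nil (N : ℕ) : D C N []
  | tree {N M : ℕ} (a : S × Bool) {u v : Word S} : D C N u → D C M v →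
      D C (N + M) (a :: (u ++ li a :: v))
  | cell {N : ℕ} (a : S × Bool) {r' U : Word S} : (a :: r') ∈ C → D C N (wordInv r' ++ U) →
      D C (N + 1) (a :: U)

variable {C : Set (Word S)}

theorem D.mono {N M : ℕ} {u : Word S} (h : D C N u) (hM : N ≤ M) : D C M u := by
  induction h generalizing M with
  | nil N => exact D.nil M
  | @tree N M' a u v hu hv ihu ihv =>
    have := D.tree a hu (ihv (M := M - N) (by omega))
    rwa [show N + (M - N) = M by omega] at this
  | @cell N a r' U hr h ih =>
    have := D.cell a hr (ih (M := M - 1) (by omega))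
    rwa [show M - 1 + 1 = M by omega] at this

theorem D.app {N M : ℕ} {u v : Word S} (h : D C N u) (h' : D C M v) : D C (N + M) (u ++ v) := by
  induction h with
  | nil N => exact h'.mono (by omega)
  | @tree N M' a u w hu hv ihu ihv =>
    have := D.tree a hu ihv
    rw [← add_assoc] at this
    simpa using this
  | @cell N a r' U hr h ih =>
    have := D.cell a hr (N := N + M) (U := U ++ v) (by simpa using ih)
    rw [show N + M + 1 = N + 1 + M by omega] at this
    simpa using this

theorem split2 {α : Type*} {u v X Y : List α} {c : α} (h : u ++ c :: v = X ++ Y) :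
    (∃ X2, X = u ++ c :: X2 ∧ v = X2 ++ Y) ∨ (∃ Y1, Y = Y1 ++ c :: v ∧ u = X ++ Y1) := by
  rcases List.append_eq_append_iff.1 h with ⟨t, rfl, ht⟩ | ⟨t, rfl, ht⟩
  · rcases t with _ | ⟨d, t⟩
    · right; exact ⟨[], by simpa using ht.symm, by simp⟩
    · simp only [List.cons_append, List.cons.injEq] at ht
      obtain ⟨rfl, ht⟩ := ht
      left; exact ⟨t, rfl, ht⟩
  · right; exact ⟨t, ht, rfl⟩

theorem D.ins {N M : ℕ} {W X Y Z : Word S} (h : D C N W) (hW : W = X ++ Y) (h' : D C M Z) :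
    D C (N + M) (X ++ Z ++ Y) := by
  induction h generalizing X Y with
  | nil N =>
    have : X = [] ∧ Y = [] := by simpa using hW.symm
    obtain ⟨rfl, rfl⟩ := this
    simpa using h'.mono (by omega)
  | @tree N1 N2 a u w hu hw ihu ihw =>
    rcases X with _ | ⟨b, X⟩
    · simp only [List.nil_append] at hW ⊢
      subst hW
      rw [add_comm]
      exact h'.app (D.tree a hu hw)
    · simp only [List.cons_append, List.cons.injEq] at hW
      obtain ⟨rfl, hW⟩ := hW
      rcases split2 hW with ⟨X2, rfl, hv⟩ | ⟨Y1, rfl, hu'⟩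
      · have := D.tree a hu (ihw hv)
        rw [← add_assoc] at this
        simpa using this
      · have := D.tree a (ihu hu') hw
        rw [show N1 + M + N2 = N1 + N2 + M by omega] at this
        simpa using this
  | @cell N a r' U hr h ih =>
    rcases X with _ | ⟨b, X⟩
    · simp only [List.nil_append] at hW ⊢
      subst hW
      rw [add_comm]
      exact h'.app (D.cell a hr h)
    · simp only [List.cons_append, List.cons.injEq] at hW
      obtain ⟨rfl, hW⟩ := hW
      have := D.cell a hr (N := N + M) (U := X ++ Z ++ Y)
        (by simpa using ih (X := wordInv r' ++ X) (Y := Y) (by simp [hW]))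
      rw [show N + M + 1 = N + 1 + M by omega] at this
      simpa using this

theorem rep_of_rot (hC : SC C) (N : ℕ)
    (hrot : ∀ M ≤ N, ∀ X Y, D C M (X ++ Y) → D C M (Y ++ X)) {a : S × Bool} {r' : Word S}
    (har : a :: r' ∈ C) {M : ℕ} {W : Word S} (h : D C M W) (hM : M ≤ N) {X Y : Word S}
    (hW : W = X ++ (wordInv r' ++ Y)) : D C (M + 1) (X ++ a :: Y) := by
  induction h generalizing X Y with
  | nil M =>
    simp only [List.nil_eq, List.append_eq_nil_iff, winv_eq_nil] at hW
    obtain ⟨rfl, rfl, rfl⟩ := hW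
    simpa using D.cell a har (U := []) (by simpa using D.nil M)
  | @tree N1 N2 b u v hu hv ihu ihv =>
    rcases X with _ | ⟨b', X⟩
    · exact D.cell a har (by simpa [hW] using D.tree b hu hv)
    · simp only [List.cons_append, List.cons.injEq] at hW
      obtain ⟨rfl, hW⟩ := hW
      rcases split2 hW with ⟨X2, rfl, hv'⟩ | ⟨Y1, hY1, rfl⟩
      · have := D.tree b hu (ihv (by omega) hv')
        rw [← add_assoc] at this
        simpa using this
      · rcases split2 hY1.symm with ⟨q, hq, rfl⟩ | ⟨Y2, rfl, rfl⟩
        · rw [winv_eq_iff] at hq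
          subst hq
          have h1 : (b :: wordInv Y1) ++ (a :: wordInv q) ∈ C :=
            hC.rot _ _ (by simpa using har)
          have h2 := D.tree (li a) (hrot _ (by omega) _ _ hu) (D.nil (C := C) 0)
          have h3 := D.cell b (U := X ++ a :: Y) h1 (by simpa using hv.ins rfl h2)
          exact h3.mono (by omega)
        · have := D.tree b (ihu (by omega) rfl) hv
          rw [show N1 + 1 + N2 = N1 + N2 + 1 by omega] at this
          simpa using this
  | @cell M b r'' U hr h ih =>
    rcases X with _ | ⟨b', X⟩
    · exact D.cell a har (by simpa [hW] using D.cell b hr h)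
    · simp only [List.cons_append, List.cons.injEq] at hW
      obtain ⟨rfl, hW⟩ := hW
      exact D.cell b hr (by
        simpa using ih (by omega) (X := wordInv r'' ++ X) (Y := Y) (by simp [hW]))

theorem D.rot (hC : SC C) : ∀ (N : ℕ) (X Y : Word S), D C N (X ++ Y) → D C N (Y ++ X) := by
  intro N
  induction N using Nat.strong_induction_on with
  | _ N IH =>
  have one : ∀ a Y, D C N (a :: Y) → D C N (Y ++ [a]) := by
    intro a Y h
    generalize hW : a :: Y = W at h
    cases h with
    | nil => simp at hW
    | @tree N1 N2 b u v hu hv =>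
      simp only [List.cons.injEq] at hW
      obtain ⟨rfl, rfl⟩ := hW
      have := hu.app (D.tree (li a) hv (D.nil 0))
      simpa using this
    | @cell N b r' U hr h =>
      simp only [List.cons.injEq] at hW
      obtain ⟨rfl, rfl⟩ := hW
      have h1 := IH N (by omega) _ _ h
      have := rep_of_rot hC N (fun M hM => IH M (by omega)) hr h1 le_rfl (X := Y) (Y := [])
        (by simp)
      exact this
  intro X
  induction X with
  | nil => intro Y h; simpa using h
  | cons a X ih =>
    intro Y h
    have := ih (Y ++ [a]) (by simpa using one a _ h)
    simpa using this

theorem D.rep (hC : SC C) {a : S × Bool} {r' : Word S}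
    (har : a :: r' ∈ C) {M : ℕ} {X Y : Word S} (h : D C M (X ++ (wordInv r' ++ Y))) :
    D C (M + 1) (X ++ a :: Y) :=
  rep_of_rot hC M (fun M _ => D.rot hC M) har h le_rfl rfl

/-- splitting condition -/
def Sp (C : Set (Word S)) (k : ℕ) (B : Word S) : Prop :=
  ∀ p d q Y' N1 N2, B = p ++ li d :: q → D C N1 (Y' ++ p) → D C N2 q →
    D C (N1 + N2 + k) (d :: Y')

theorem Sp.use {k : ℕ} {B : Word S} (hS : Sp C k B) {N : ℕ} {W Y : Word S} (h : D C N W)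
    (hW : W = Y ++ B) : D C (N + k) Y := by
  induction h generalizing Y with
  | nil N =>
    have : Y = [] ∧ B = [] := by simpa using hW.symm
    rw [this.1]; exact D.nil _
  | @tree N1 N2 c u v hu hv ihu ihv =>
    rcases Y with _ | ⟨c', Y⟩
    · exact D.nil _
    · simp only [List.cons_append, List.cons.injEq] at hW
      obtain ⟨rfl, hW⟩ := hW
      rcases split2 hW with ⟨X2, rfl, hv'⟩ | ⟨Y1, hY1, rfl⟩
      · have := D.tree c hu (ihv hv')
        rwa [← add_assoc] at this
      · exact hS _ _ _ _ _ _ hY1 hu hv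
  | @cell N c r' U hr h ih =>
    rcases Y with _ | ⟨c', Y⟩
    · exact D.nil _
    · simp only [List.cons_append, List.cons.injEq] at hW
      obtain ⟨rfl, hW⟩ := hW
      have := D.cell c hr (ih (Y := wordInv r' ++ Y) (by simp [hW]))
      rwa [show N + k + 1 = N + 1 + k by omega] at this

theorem D.cancel (hC : SC C) {N : ℕ} {b : S × Bool} {Y : Word S} (h : D C N (b :: li b :: Y)) :
    D C N Y := by
  generalize hW : b :: li b :: Y = W at h
  cases h with
  | nil => simp at hW
  | @tree N1 N2 b' u v hu hv =>
    simp only [List.cons.injEq] at hW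
    obtain ⟨rfl, hW⟩ := hW
    rcases u with _ | ⟨c, u⟩
    · simp only [List.nil_append, List.cons.injEq, true_and] at hW
      subst hW
      exact hv.mono (by omega)
    · simp only [List.cons_append, List.cons.injEq] at hW
      obtain ⟨rfl, rfl⟩ := hW
      have := (D.rot hC _ [li b] u hu).app hv
      simpa using this
  | @cell N b' r' U hr h =>
    simp only [List.cons.injEq] at hW
    obtain ⟨rfl, rfl⟩ := hW
    have h1 := D.rot hC _ _ _ h
    simp only [List.cons_append] at h1
    generalize hW : li b :: (Y ++ wordInv r') = W at h1
    cases h1 with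
    | nil => simp at hW
    | @tree N1 N2 b' u v hu hv =>
      simp only [List.cons.injEq] at hW
      obtain ⟨rfl, hW⟩ := hW
      rw [li_li] at hW
      rcases split2 hW.symm with ⟨X2, rfl, rfl⟩ | ⟨p, hp, rfl⟩
      · have := hu.app (D.cell b hr (D.rot hC _ _ _ hv))
        rwa [← add_assoc] at this
      · have hS : Sp C (N2 + 1) p := by
          intro p1 d q1 Y' M1 M2 hpe hp1 hq1
          rw [winv_eq_iff] at hp
          subst hp hpe
          have h2 : (d :: wordInv p1) ++ (b :: (wordInv v ++ li b :: wordInv q1)) ∈ C :=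
            hC.rot _ _ (by simpa using hr)
          have h3 := hq1.app (D.tree b hv (D.rot hC _ _ _ hp1))
          have h4 := D.cell d (U := Y') h2 (by simpa using h3)
          exact h4.mono (by omega)
        have := hS.use hu rfl
        exact this.mono (by omega)
    | @cell N b' ρ' U hρ h =>
      simp only [List.cons.injEq] at hW
      obtain ⟨rfl, rfl⟩ := hW
      have h1 := D.rot hC _ _ _ h
      have hS : Sp C 2 (wordInv r' ++ wordInv ρ') := by
        intro p d q Y' M1 M2 hpe hp hq
        rcases split2 hpe.symm with ⟨X2, hX2, rfl⟩ | ⟨p2, hp2, rfl⟩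
        · rw [winv_eq_iff] at hX2
          subst hX2
          have h2 : (d :: wordInv p) ++ (b :: wordInv X2) ∈ C := hC.rot _ _ (by simpa using hr)
          have h3 := (D.rep hC hρ (X := X2) (Y := []) (by simpa using hq)).app
            (D.rot hC _ _ _ hp)
          exact (D.cell d (U := Y') h2 (by simpa using h3)).mono (by omega)
        · rw [winv_eq_iff] at hp2
          subst hp2
          have h2 : (d :: wordInv p2) ++ (li b :: wordInv q) ∈ C := hC.rot _ _ (by simpa using hρ)
          have h3 := D.cell b hr (U := p2 ++ Y') (by
            simpa using D.rot hC _ Y' _ hp)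
          exact (D.cell d (U := Y') h2 (by simpa using hq.app h3)).mono (by omega)
      exact (hS.use h1 (by simp)).mono (by omega)

theorem D.cancel' (hC : SC C) {N : ℕ} {b : S × Bool} {X Y : Word S}
    (h : D C N (X ++ b :: li b :: Y)) : D C N (X ++ Y) :=
  D.rot hC _ _ _ (D.cancel hC (Y := Y ++ X) (D.rot hC _ _ _ h))

theorem D.red (hC : SC C) {N : ℕ} {u v : Word S} (h : D C N u) (hr : FreeGroup.Red u v) :
    D C N v := by
  induction hr with
  | refl => exact h
  | tail _ hs ih =>
    cases hs with
    | not => exact D.cancel' hC ih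

/-- products of at most `N` conjugates of relators -/
inductive Ar (C : Set (Word S)) : ℕ → FreeGroup S → Prop
  | one (N : ℕ) : Ar C N 1
  | mulc {N : ℕ} (g : FreeGroup S) {r : Word S} {x : FreeGroup S} : r ∈ C → Ar C N x →
      Ar C (N + 1) (g * FreeGroup.mk r * g⁻¹ * x)

theorem Ar.mono {N M : ℕ} {x : FreeGroup S} (h : Ar C N x) (hM : N ≤ M) : Ar C M x := by
  induction h generalizing M with
  | one N => exact Ar.one M
  | @mulc N g r x hr h ih =>
    have := Ar.mulc g hr (ih (M := M - 1) (by omega))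
    rwa [show M - 1 + 1 = M by omega] at this

theorem Ar.mul {N M : ℕ} {x y : FreeGroup S} (h : Ar C N x) (h' : Ar C M y) :
    Ar C (N + M) (x * y) := by
  induction h with
  | one N => simpa using h'.mono (by omega)
  | @mulc N g r x hr h ih =>
    have := Ar.mulc g hr ih
    rw [show N + M + 1 = N + 1 + M by omega] at this
    simpa [mul_assoc] using this

theorem Ar.conj {N : ℕ} {x : FreeGroup S} (h : Ar C N x) (g : FreeGroup S) :
    Ar C N (g * x * g⁻¹) := by
  induction h with
  | one N => simpa using Ar.one N
  | @mulc N k r x hr h ih =>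
    have := Ar.mulc (g * k) hr ih
    simpa [mul_assoc] using this

theorem Ar.rel {r : Word S} (hr : r ∈ C) (g : FreeGroup S) :
    Ar C 1 (g * FreeGroup.mk r * g⁻¹) := by
  simpa using Ar.mulc g hr (Ar.one 0)

theorem mk_winv (w : Word S) : FreeGroup.mk (wordInv w) = (FreeGroup.mk w)⁻¹ := by
  rw [FreeGroup.inv_mk]; rfl

theorem Ar.rel' (hC : SC C) {r : Word S} (hr : r ∈ C) (g : FreeGroup S) :
    Ar C 1 (g * (FreeGroup.mk r)⁻¹ * g⁻¹) := by
  rw [← mk_winv]; exact Ar.rel (hC.inv r hr) g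

theorem Ar.rotate {N : ℕ} {x y : FreeGroup S} (h : Ar C N (x * y)) : Ar C N (y * x) := by
  have := h.conj y
  simpa [mul_assoc] using this

theorem mk_cons (a : S × Bool) (w : Word S) :
    FreeGroup.mk (a :: w) = FreeGroup.mk [a] * FreeGroup.mk w := by
  rw [FreeGroup.mul_mk]; rfl

theorem mk_append (u w : Word S) :
    FreeGroup.mk (u ++ w) = FreeGroup.mk u * FreeGroup.mk w := by
  rw [FreeGroup.mul_mk]

theorem mk_li (a : S × Bool) : FreeGroup.mk [li a] = (FreeGroup.mk [a])⁻¹ := by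
  rw [← mk_winv]; simp

theorem D.ar (hC : SC C) {N : ℕ} {u : Word S} (h : D C N u) : Ar C N (FreeGroup.mk u) := by
  induction h with
  | nil N => exact Ar.one N
  | @tree N1 N2 a u v hu hv ihu ihv =>
    have := (ihu.conj (FreeGroup.mk [a])).mul ihv
    rw [mk_cons, mk_append, mk_cons (li a), mk_li]
    simpa [mul_assoc] using this
  | @cell N a r' U hr h ih =>
    rw [mk_append, mk_winv] at ih
    have := (Ar.rel hr 1).mul (ih)
    rw [add_comm]
    rw [mk_cons] at this ⊢
    convert this using 1
    group

theorem D.inv_self (w : Word S) : D C 0 (wordInv w ++ w) := by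
  induction w with
  | nil => exact D.nil 0
  | cons a w ih =>
    have := ih.ins rfl (D.tree (li a) (D.nil (C := C) 0) (D.nil 0))
    simpa using this

theorem D.wrap {N : ℕ} {u : Word S} (h : D C N u) (g : Word S) :
    D C N (g ++ u ++ wordInv g) := by
  induction g with
  | nil => simpa using h
  | cons a g ih =>
    have := D.tree a ih (D.nil 0)
    simpa using this

theorem Ar.d [DecidableEq S] (hC : SC C) {N : ℕ} {x : FreeGroup S} (h : Ar C N x) :
    D C N x.toWord := by
  induction h with
  | one N => simpa using D.nil N
  | @mulc N g r x hr h ih =>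
    have h1 : D C 1 r := by
      rcases r with _ | ⟨a, r'⟩
      · exact D.nil _
      · exact D.cell a hr (D.inv_self r')
    have h2 := (h1.wrap g.toWord).app ih
    rw [add_comm]
    refine h2.red hC ?_
    have : g * FreeGroup.mk r * g⁻¹ * x =
        FreeGroup.mk (g.toWord ++ r ++ wordInv g.toWord ++ x.toWord) := by
      simp [mk_append, mk_winv, FreeGroup.mk_toWord, mul_assoc]
    rw [this, FreeGroup.toWord_mk]
    exact FreeGroup.reduce.red

theorem ReducedWord.toWord [DecidableEq S] {u : Word S} (h : ReducedWord u) :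
    (FreeGroup.mk u).toWord = u := by
  rw [FreeGroup.toWord_mk]
  exact FreeGroup.IsReduced.reduce_eq h

/-- peel lemma -/
theorem Ar.peel (hC : SC C) {N : ℕ} {a : S × Bool} {U : Word S} (hu : ReducedWord (a :: U))
    (h : Ar C N (FreeGroup.mk (a :: U))) :
    (∃ U1 U2 N1 N2, U = U1 ++ li a :: U2 ∧ Ar C N1 (FreeGroup.mk U1) ∧
      Ar C N2 (FreeGroup.mk U2) ∧ N1 + N2 ≤ N) ∨
    ∃ r' M, a :: r' ∈ C ∧ N = M + 1 ∧
      Ar C M ((FreeGroup.mk (a :: r'))⁻¹ * FreeGroup.mk (a :: U)) := by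
  classical
  have h1 := h.d hC
  rw [hu.toWord] at h1
  generalize hW : a :: U = W at h1
  cases h1 with
  | nil => simp at hW
  | @tree N1 N2 b u v hu1 hv =>
    simp only [List.cons.injEq] at hW
    obtain ⟨rfl, rfl⟩ := hW
    exact Or.inl ⟨u, v, N1, N2, rfl, hu1.ar hC, hv.ar hC, le_rfl⟩
  | @cell N b r' U hr h =>
    simp only [List.cons.injEq] at hW
    obtain ⟨rfl, rfl⟩ := hW
    refine Or.inr ⟨r', N, hr, rfl, ?_⟩
    have := h.ar hC
    rw [mk_append, mk_winv] at this
    rw [mk_cons, mk_cons a U]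
    convert this using 1
    group

end P1
end MorseLTG

namespace MorseLTG

section P2
variable {S : Type*} {C : Set (Word S)}

theorem ReducedWord.infix {u v : Word S} (h : ReducedWord v) (hi : u <:+: v) : ReducedWord u :=
  List.IsChain.infix h hi
theorem ReducedWord.left {u v : Word S} (h : ReducedWord (u ++ v)) : ReducedWord u :=
  h.infix (List.prefix_append u v).isInfix
theorem ReducedWord.right {u v : Word S} (h : ReducedWord (u ++ v)) : ReducedWord v :=
  h.infix (List.suffix_append u v).isInfix

theorem not_red_cancel {X Y : Word S} {a : S × Bool} : ¬ ReducedWord (X ++ a :: li a :: Y) := by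
  intro h
  have := h.right
  have := (List.isChain_cons_cons.1 this).1 rfl
  simp [li] at this

theorem red_glue {X Y : Word S} (hX : ReducedWord X) (hY : ReducedWord Y)
    (h : ∀ X' a Y', X = X' ++ [a] → Y = li a :: Y' → False) : ReducedWord (X ++ Y) := by
  refine List.IsChain.append hX hY ?_
  intro a ha b hb hab
  by_contra hne
  rw [Option.mem_def, List.getLast?_eq_some_iff] at ha
  rw [Option.mem_def, List.head?_eq_some_iff] at hb
  obtain ⟨X', rfl⟩ := ha
  obtain ⟨Y', rfl⟩ := hb
  refine h X' a Y' rfl ?_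
  obtain ⟨a1, a2⟩ := a
  obtain ⟨b1, b2⟩ := b
  simp only at hab hne
  subst hab
  simp only [li]
  cases a2 <;> cases b2 <;> simp_all

theorem red_inv {X : Word S} (h : ReducedWord X) : ReducedWord (wordInv X) := by
  induction X with
  | nil => exact h
  | cons a X ih =>
    rw [winv_cons]
    refine red_glue (ih (ReducedWord.right (u := [a]) h)) (List.isChain_singleton _) ?_
    intro X' b Y' hb hab
    rw [winv_eq_iff] at hb
    subst hb
    simp only [List.cons.injEq] at hab
    have hab' : a = b := by rw [← li_li a, hab.1, li_li]
    subst hab'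
    simp only [winv_append, winv_cons, winv_nil, List.nil_append, List.singleton_append] at h
    exact not_red_cancel (X := []) h

theorem red_cancel : ∀ (X Y : Word S), ReducedWord X → ReducedWord Y →
    ∃ X' t Y', X = X' ++ t ∧ Y = wordInv t ++ Y' ∧ ReducedWord (X' ++ Y') := by
  intro X
  induction X using List.reverseRecOn with
  | nil => intro Y _ hY; exact ⟨[], [], Y, rfl, rfl, hY⟩
  | append_singleton X a ih =>
    intro Y hX hY
    by_cases h : ∃ Y', Y = li a :: Y'
    · obtain ⟨Y', rfl⟩ := h
      obtain ⟨X', t, Y'', rfl, rfl, h⟩ := ih Y' hX.left (ReducedWord.right (u := [li a]) hY)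
      exact ⟨X', t ++ [a], Y'', by simp, by simp, h⟩
    · refine ⟨X ++ [a], [], Y, by simp, by simp, red_glue hX hY ?_⟩
      intro X' b Y' hb hY'
      obtain ⟨rfl, hb⟩ := List.append_inj' hb rfl
      have hb : a = b := by simpa using hb
      subst hb
      exact h ⟨Y', hY'⟩

/-- flatten arcs -/
def fl {ι : Type} (A : List (Word S × ι)) : Word S := (A.map Prod.fst).flatten

open Classical in
noncomputable def eC {ι : Type} (A : List (Word S × ι)) (k : ι) : ℕ :=
  (A.map fun a => if a.2 = k then 1 else 0).sum
open Classical in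
noncomputable def EC {ι : Type} (A : List (Word S × ι)) (k : ι) : ℕ :=
  (A.map fun a => if a.2 = k then a.1.length else 0).sum

section
variable {ι κ : Type}
@[simp] theorem fl_nil : fl ([] : List (Word S × ι)) = [] := rfl
@[simp] theorem fl_cons (a : Word S × ι) (A) : fl (a :: A) = a.1 ++ fl A := by simp [fl]
@[simp] theorem fl_append (A B : List (Word S × ι)) : fl (A ++ B) = fl A ++ fl B := by simp [fl]
@[simp] theorem eC_nil (k : ι) : eC ([] : List (Word S × ι)) k = 0 := rfl
open Classical in
@[simp] theorem eC_cons (a : Word S × ι) (A) (k) :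
    eC (a :: A) k = (if a.2 = k then 1 else 0) + eC A k := by simp [eC]
@[simp] theorem eC_append (A B : List (Word S × ι)) (k) : eC (A ++ B) k = eC A k + eC B k := by
  simp [eC]
@[simp] theorem EC_nil (k : ι) : EC ([] : List (Word S × ι)) k = 0 := rfl
open Classical in
@[simp] theorem EC_cons (a : Word S × ι) (A) (k) :
    EC (a :: A) k = (if a.2 = k then a.1.length else 0) + EC A k := by simp [EC]
@[simp] theorem EC_append (A B : List (Word S × ι)) (k) : EC (A ++ B) k = EC A k + EC B k := by
  simp [EC]

/-- relabel arcs -/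
def rl (f : ι → κ) (A : List (Word S × ι)) : List (Word S × κ) := A.map fun a => (a.1, f a.2)

@[simp] theorem rl_nil (f : ι → κ) : rl f ([] : List (Word S × ι)) = [] := rfl
@[simp] theorem rl_cons (f : ι → κ) (a : Word S × ι) (A) :
    rl f (a :: A) = (a.1, f a.2) :: rl f A := rfl
@[simp] theorem fl_rl (f : ι → κ) (A : List (Word S × ι)) : fl (rl f A) = fl A := by
  simp [fl, rl, Function.comp_def]
theorem eC_rl (f : ι → κ) (A : List (Word S × ι)) (k : ι) (k' : κ) (hf : ∀ j, f j = k' ↔ j = k) :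
    eC (rl f A) k' = eC A k := by
  induction A with
  | nil => rfl
  | cons a A ih =>
    by_cases h : a.2 = k
    · simp [ih, h, (hf k).2 rfl]
    · have : ¬ f a.2 = k' := fun h' => h ((hf _).1 h')
      simp [ih, h, this]
theorem EC_rl (f : ι → κ) (A : List (Word S × ι)) (k : ι) (k' : κ) (hf : ∀ j, f j = k' ↔ j = k) :
    EC (rl f A) k' = EC A k := by
  induction A with
  | nil => rfl
  | cons a A ih =>
    by_cases h : a.2 = k
    · simp [ih, h, (hf k).2 rfl]
    · have : ¬ f a.2 = k' := fun h' => h ((hf _).1 h')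
      simp [ih, h, this]
theorem eC_rl0 (f : ι → κ) (A : List (Word S × ι)) (k' : κ) (hf : ∀ j, f j ≠ k') :
    eC (rl f A) k' = 0 := by
  induction A with
  | nil => rfl
  | cons a A ih => simp [ih, hf]
theorem EC_rl0 (f : ι → κ) (A : List (Word S × ι)) (k' : κ) (hf : ∀ j, f j ≠ k') :
    EC (rl f A) k' = 0 := by
  induction A with
  | nil => rfl
  | cons a A ih => simp [ih, hf]
theorem rl_split {f : ι → κ} {A : List (Word S × ι)} {B1 B2 w j}
    (h : rl f A = B1 ++ (w, j) :: B2) :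
    ∃ A1 A2 k, A = A1 ++ (w, k) :: A2 ∧ f k = j ∧ fl A1 = fl B1 := by
  induction A generalizing B1 with
  | nil => simp at h
  | cons a A ih =>
    rcases B1 with _ | ⟨b, B1⟩
    · simp only [rl_cons, List.nil_append, List.cons.injEq, Prod.mk.injEq] at h
      exact ⟨[], A, a.2, by simp [← h.1.1], h.1.2, rfl⟩
    · simp only [rl_cons, List.cons_append, List.cons.injEq] at h
      obtain ⟨A1, A2, k, rfl, h1, h2⟩ := ih h.2
      exact ⟨a :: A1, A2, k, rfl, h1, by simp [← h.1, h2]⟩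

theorem sum_eC [Fintype ι] (A : List (Word S × ι)) : ∑ k, eC A k = A.length := by
  induction A with
  | nil => simp
  | cons a A ih =>
    simp only [eC_cons, Finset.sum_add_distrib, ih, List.length_cons]
    rw [Finset.sum_eq_single a.2 (by simp +contextual [eq_comm]) (by simp)]
    simp [add_comm]

/-- covering lemma -/
theorem cover [Fintype ι] (P : ι → ℕ) (s : ℕ) (A : List (Word S × ι)) : ∀ (y U : Word S),
    fl A = y ++ U → (∀ a ∈ A, a.1 ≠ []) →
    (∀ A1 w k A2 c, A = A1 ++ (w, k) :: A2 → c ≠ [] → c <+: w → fl A1 ++ c <+: y →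
      9 * c.length + 1 ≤ P k ∧ 9 * c.length + 1 ≤ s) →
    ∃ (A' : List (Word S × ι)) (d : ι → ℕ), fl A' = U ∧ (∀ a ∈ A', a.1 ≠ []) ∧
      A'.length + ∑ k, d k ≤ A.length + 1 ∧ 9 * y.length + ∑ k, d k ≤ (∑ k, d k) * s ∧
      (y ≠ [] → ∀ w k A2, A = (w, k) :: A2 → 1 ≤ d k) ∧
      (∀ k, eC A' k ≤ eC A k) ∧ (∀ k, d k + 9 * EC A k ≤ d k * P k + 9 * EC A' k) ∧
      (∀ A1' w' k A2', A' = A1' ++ (w', k) :: A2' → ∃ A1 c A2, A = A1 ++ (c ++ w', k) :: A2 ∧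
        fl A1 ++ c = y ++ fl A1') := by
  classical
  induction A with
  | nil =>
    intro y U h _ _
    have h : y = [] ∧ U = [] := by simpa using h.symm
    obtain ⟨rfl, rfl⟩ := h
    exact ⟨[], fun _ => 0, by simp⟩
  | cons a A ih =>
    obtain ⟨w, k⟩ := a
    intro y U h hne hp
    by_cases hy : y = []
    · subst hy
      refine ⟨(w, k) :: A, fun _ => 0, by simpa using h, hne, by simp, by simp, by simp,
        by simp, by simp, ?_⟩
      intro A1 w' k' A2 hA
      exact ⟨A1, [], A2, by simpa using hA, by simp⟩
    · simp only [fl_cons] at h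
      rcases List.append_eq_append_iff.1 h with ⟨y2, rfl, hU⟩ | ⟨w', hw, rfl⟩
      · obtain ⟨A', d, h1, h2, h3, h4, -, h6, h7, h8⟩ := ih y2 U hU
          (fun a ha => hne a (by simp [ha])) (by
            intro A1 w' k' A2 c hA hc hcw hcy
            refine hp ((w, k) :: A1) w' k' A2 c (by simp [hA]) hc hcw ?_
            simpa [List.append_assoc] using hcy)
        have hw := hp [] w k A w rfl (hne (w, k) (by simp)) (List.prefix_refl _) (by simp)
        refine ⟨A', fun j => d j + if j = k then 1 else 0, h1, h2, ?_, ?_, ?_, ?_, ?_, ?_⟩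
        · simp [Finset.sum_add_distrib]; omega
        · simp [Finset.sum_add_distrib, add_mul]; omega
        · intro _ w' k' A2 hA
          simp only [List.cons.injEq, Prod.mk.injEq] at hA
          simp [hA.1.2]
        · intro j
          have := h6 j
          simp; omega
        · intro j
          have := h7 j
          by_cases hj : j = k
          · subst hj; simp [add_mul]; omega
          · have : ¬ k = j := fun h => hj h.symm
            simpa [hj, this]
        · intro A1' w' k' A2' hA
          obtain ⟨A1, c, A2, rfl, h9⟩ := h8 _ _ _ _ hA
          exact ⟨(w, k) :: A1, c, A2, by simp, by simp [h9]⟩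
      · by_cases hw' : w' = []
        · subst hw'
          simp only [List.append_nil] at hw
          subst hw
          have hw := hp [] w k A w rfl (hne (w, k) (by simp)) (List.prefix_refl _) (by simp)
          refine ⟨A, fun j => if j = k then 1 else 0, by simp, fun a ha => hne a (by simp [ha]),
            by simp, by simp; omega, ?_, ?_, ?_, ?_⟩
          · intro _ w' k' A2 hA
            simp only [List.cons.injEq, Prod.mk.injEq] at hA
            simp [hA.1.2]
          · intro j; simp
          · intro j
            by_cases hj : j = k
            · subst hj; simp; omega
            · have : ¬ k = j := fun h => hj h.symm
              simp [hj, this]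
          · intro A1' w' k' A2' hA
            exact ⟨(w, k) :: A1', [], A2', by simp [hA], by simp⟩
        · subst hw
          have hw := hp [] _ k A y rfl hy (List.prefix_append _ _) (by simp)
          refine ⟨(w', k) :: A, fun j => if j = k then 1 else 0, by simp, ?_, by simp,
            by simp; omega, ?_, ?_, ?_, ?_⟩
          · intro a ha
            simp only [List.mem_cons] at ha
            rcases ha with rfl | ha
            · exact hw'
            · exact hne a (by simp [ha])
          · intro _ w' k' A2 hA
            simp only [List.cons.injEq, Prod.mk.injEq] at hA
            simp [hA.1.2]
          · intro j; simp
          · intro j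
            by_cases hj : j = k
            · subst hj; simp; omega
            · have : ¬ k = j := fun h => hj h.symm
              simp [hj, this]
          · intro A1' w'' k' A2' hA
            rcases A1' with _ | ⟨b, A1'⟩
            · simp only [List.nil_append, List.cons.injEq, Prod.mk.injEq] at hA
              obtain ⟨⟨rfl, rfl⟩, rfl⟩ := hA
              exact ⟨[], y, A, rfl, by simp⟩
            · simp only [List.cons_append, List.cons.injEq] at hA
              obtain ⟨rfl, rfl⟩ := hA
              exact ⟨(y ++ w', k) :: A1', [], A2', by simp, by simp⟩
end

end P2
end MorseLTG

namespace MorseLTG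

section P3
variable {S : Type*} {C : Set (Word S)}

def MinAr (C : Set (Word S)) (N : ℕ) (u : Word S) : Prop :=
  Ar C N (FreeGroup.mk u) ∧ ∀ K, Ar C K (FreeGroup.mk u) → N ≤ K

def Indec (C : Set (Word S)) (N : ℕ) (u : Word S) : Prop :=
  ∀ X V Y K1 K2, u = X ++ (V ++ Y) → V ≠ [] → Ar C K1 (FreeGroup.mk V) → Ar C K2 (FreeGroup.mk (X ++ Y)) →
    K1 + K2 ≤ N → X = [] ∧ Y = []

def Dec (C : Set (Word S)) (N : ℕ) (u : Word S) : Prop :=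
  ∃ (ι : Type) (_ : Fintype ι) (P n : ι → ℕ) (A : List (Word S × ι)), fl A = u ∧
    (∀ a ∈ A, a.1 ≠ []) ∧ (∀ k, 0 < P k) ∧
    (∀ A1 w k A2, A = A1 ++ (w, k) :: A2 → ∃ r ∈ C, w <+: r ∧ r.length = P k ∧
      ∃ K', K' + 1 ≤ N ∧ Ar C K' (FreeGroup.mk (fl A1) * (FreeGroup.mk r)⁻¹ * (FreeGroup.mk (fl A1))⁻¹ * FreeGroup.mk u)) ∧
    (∀ k, 9 * P k + n k ≤ n k * P k + 9 * EC A k) ∧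
    (∀ k, eC A k ≤ n k ∨ (eC A k ≤ n k + 1 ∧ ∃ w A2, A = (w, k) :: A2)) ∧
    4 + 2 * A.length + ∑ k, n k ≤ 6 * Fintype.card ι

def GlueOut (C : Set (Word S)) (s : Word S) (K : ℕ) (y U : Word S) : Prop :=
  ∃ (ι : Type) (_ : Fintype ι) (P n : ι → ℕ) (B : List (Word S × Option ι)) (m : ℕ), fl B = U ∧
    (∀ a ∈ B, a.1 ≠ []) ∧ (∀ k, 0 < P k) ∧
    9 * y.length + m ≤ m * s.length + 9 * EC B none ∧ eC B none ≤ m ∧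
    2 * B.length + m + ∑ k, n k ≤ 6 * Fintype.card ι ∧
    (∀ k, eC B (some k) ≤ n k) ∧
    (∀ k, 9 * P k + n k ≤ n k * P k + 9 * EC B (some k)) ∧
    (∀ (B1 : List (Word S × Option ι)) (w : Word S) (k : ι) (B2 : List (Word S × Option ι)), B = B1 ++ (w, some k) :: B2 → ∃ r ∈ C, w <+: r ∧ r.length = P k ∧
      ∃ K', K' + 1 ≤ K ∧
        Ar C K' (FreeGroup.mk (y ++ fl B1) * (FreeGroup.mk r)⁻¹ * (FreeGroup.mk (y ++ fl B1))⁻¹ * FreeGroup.mk (y ++ U))) ∧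
    (∀ (B1 : List (Word S × Option ι)) (w : Word S) (B2 : List (Word S × Option ι)), B = B1 ++ (w, none) :: B2 → ∃ r ∈ C, w <+: r ∧ r.length = s.length ∧
        Ar C K ((FreeGroup.mk s)⁻¹ * (FreeGroup.mk (y ++ fl B1) * (FreeGroup.mk r)⁻¹ * (FreeGroup.mk (y ++ fl B1))⁻¹ * FreeGroup.mk (y ++ U))))

theorem EC_le {ι : Type} {P : ι → ℕ} {A : List (Word S × ι)}
    (h : ∀ w k, (w, k) ∈ A → 3 * w.length ≤ 2 * P k) (k : ι) :
    3 * EC A k ≤ 2 * P k * eC A k := by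
  induction A with
  | nil => simp
  | cons a A ih =>
    have h1 := ih (fun w k hm => h w k (by simp [hm]))
    have h2 := h a.1 a.2 (by simp)
    by_cases hk : a.2 = k
    · subst hk
      simp [mul_add]; omega
    · simpa [hk] using h1

theorem Dec.wg {N : ℕ} {u : Word S} (h : Dec C N u) :
    ∃ X w Y, u = X ++ (w ++ Y) ∧ ∃ r ∈ C, w <+: r ∧ 2 * r.length < 3 * w.length ∧
      ∃ K', K' + 1 ≤ N ∧ Ar C K' (FreeGroup.mk X * (FreeGroup.mk r)⁻¹ * (FreeGroup.mk X)⁻¹ * FreeGroup.mk u) := by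
  classical
  obtain ⟨ι, _, P, n, A, h1, h2, h3, h4, h5, h6, h7⟩ := h
  by_cases hex : ∃ w k, (w, k) ∈ A ∧ 2 * P k < 3 * w.length
  · obtain ⟨w, k, hm, hlt⟩ := hex
    obtain ⟨A1, A2, rfl⟩ := List.append_of_mem hm
    obtain ⟨r, hr, hw, hl, K', hK, hA⟩ := h4 A1 w k A2 rfl
    exact ⟨fl A1, w, fl A2, by simp [← h1], r, hr, hw, by omega, K', hK, hA⟩
  · exfalso
    push Not at hex
    have key : ∀ k, 6 ≤ n k + 2 * eC A k + (if ∃ w A2, A = (w, k) :: A2 then 1 else 0) := by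
      intro k
      have a1 := EC_le hex k
      have a2 := h5 k
      have a3 := h3 k
      have a4 := h6 k
      have a5 : eC A k ≤ n k + (if ∃ w A2, A = (w, k) :: A2 then 1 else 0) := by
        rcases a4 with a4 | ⟨a4, a5⟩
        · omega
        · simpa [a5] using a4
      clear a4
      generalize (if ∃ w A2, A = (w, k) :: A2 then 1 else 0) = δ at *
      generalize eC A k = e at *
      generalize n k = n at *
      generalize P k = P at *
      generalize EC A k = E at *
      by_contra hcon
      rcases e with _ | _ | _ | e
      · have : n ≤ 5 := by omega
        interval_cases n <;> omega
      · have : n ≤ 3 := by omega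
        interval_cases n <;> omega
      · omega
      · omega
    have hs := Finset.sum_le_sum (fun k (_ : k ∈ Finset.univ) => key k)
    rw [Finset.sum_add_distrib, Finset.sum_add_distrib, ← Finset.mul_sum, sum_eC] at hs
    have hδ : ∑ k, (if ∃ w A2, A = (w, k) :: A2 then 1 else 0) ≤ 1 := by
      rcases A with _ | ⟨⟨w, k⟩, A⟩
      · simp
      · rw [Finset.sum_eq_single k]
        · split_ifs <;> simp
        · intro b _ hb
          rw [if_neg]
          rintro ⟨w', A2, h⟩
          simp at h
          exact hb h.1.2.symm
        · simp
    simp only [Finset.sum_const, Finset.card_univ, smul_eq_mul] at hs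
    omega

theorem mirror {y s'' : Word S} :
    FreeGroup.mk y * (FreeGroup.mk (s'' ++ y))⁻¹ * (FreeGroup.mk y)⁻¹ = (FreeGroup.mk (y ++ s''))⁻¹ := by
  simp only [mk_append]; group

theorem ov (hC : SC C) {s ρ y c : Word S} (hs : s ∈ C) (hy : y ++ c <+: s) (hc : c ≠ [])
    (hρ : ρ ∈ C) (hcρ : c <+: ρ) (hm : FreeGroup.mk y * (FreeGroup.mk ρ)⁻¹ * (FreeGroup.mk y)⁻¹ ≠ (FreeGroup.mk s)⁻¹) :
    9 * c.length + 1 ≤ ρ.length ∧ 9 * c.length + 1 ≤ s.length := by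
  obtain ⟨z, rfl⟩ := hy
  have h1 : (c ++ z) ++ y ∈ C := hC.rot y (c ++ z) (by simpa using hs)
  have hne : ρ ≠ (c ++ z) ++ y := by
    rintro rfl
    apply hm
    rw [mirror]; simp
  refine ⟨hC.pc ρ hρ _ h1 hne c hc hcρ ⟨z ++ y, by simp⟩, ?_⟩
  have := hC.pc _ h1 ρ hρ hne.symm c hc ⟨z ++ y, by simp⟩ hcρ
  simp at this ⊢
  omega

theorem Ar.insert {a b : ℕ} {X V Y : FreeGroup S} (h : Ar C a V) (h' : Ar C b (X * Y)) :
    Ar C (a + b) (X * (V * Y)) := by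
  have := (h.conj X).mul h'
  convert this using 1
  group

theorem Ar.insert' {a b : ℕ} {X V Y : Word S} (h : Ar C a (FreeGroup.mk V)) (h' : Ar C b (FreeGroup.mk (X ++ Y))) :
    Ar C (a + b) (FreeGroup.mk (X ++ (V ++ Y))) := by
  rw [mk_append] at h'
  rw [mk_append, mk_append]
  exact h.insert h'

theorem alg1 {a b : ℕ} {X f ρ V Y : FreeGroup S} (h : Ar C a (f * ρ⁻¹ * f⁻¹ * V))
    (h' : Ar C b (X * Y)) :
    Ar C (a + b) ((X * f) * ρ⁻¹ * (X * f)⁻¹ * (X * (V * Y))) := by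
  have := h.insert h'
  convert this using 1
  group

/-- minimal additive infix -/
theorem exists_min_infix {K : ℕ} {Z : Word S} (hZ : Z ≠ []) (hm : MinAr C K Z) :
    ∃ X V Y K1 K2, Z = X ++ (V ++ Y) ∧ V ≠ [] ∧ MinAr C K1 V ∧ MinAr C K2 (X ++ Y) ∧
      K1 + K2 = K ∧ Indec C K1 V := by
  classical
  have hex : ∃ ℓ, ∃ X V Y K1 K2, Z = X ++ (V ++ Y) ∧ V ≠ [] ∧ Ar C K1 (FreeGroup.mk V) ∧
      Ar C K2 (FreeGroup.mk (X ++ Y)) ∧ K1 + K2 ≤ K ∧ V.length = ℓ :=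
    ⟨_, [], Z, [], K, 0, by simp, hZ, hm.1, Ar.one 0, by simp, rfl⟩
  obtain ⟨X, V, Y, K1, K2, hZe, hV, h1, h2, h3, h4⟩ := Nat.find_spec hex
  have hmin : ∀ X' V' Y' K1' K2', Z = X' ++ (V' ++ Y') → V' ≠ [] → Ar C K1' (FreeGroup.mk V') →
      Ar C K2' (FreeGroup.mk (X' ++ Y')) → K1' + K2' ≤ K → V.length ≤ V'.length := by
    intro X' V' Y' K1' K2' a b c d e
    rw [h4]
    exact Nat.find_min' hex ⟨X', V', Y', K1', K2', a, b, c, d, e, rfl⟩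
  clear h4
  subst hZe
  have hK : ∀ a b, Ar C a (FreeGroup.mk V) → Ar C b (FreeGroup.mk (X ++ Y)) → K ≤ a + b := fun a b ha hb =>
    hm.2 _ (ha.insert' hb)
  refine ⟨X, V, Y, K1, K2, rfl, hV, ⟨h1, fun a ha => ?_⟩, ⟨h2, fun a ha => ?_⟩, ?_, ?_⟩
  · have := hK _ _ ha h2; omega
  · have := hK _ _ h1 ha; omega
  · have := hK _ _ h1 h2; omega
  · intro X' V' Y' a b hVe hV' ha hb hab
    have := hmin (X ++ X') V' (Y' ++ Y) a (b + K2) (by simp [hVe]) hV' ha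
      (by simpa using hb.insert' h2) (by omega)
    rw [hVe] at this
    simp only [List.length_append] at this
    constructor <;> apply List.eq_nil_of_length_eq_zero <;> omega

theorem exists_arcT {ι : Type} (t : Word S) : ∃ T : List (Word S × Option ι),
    fl T = t ∧ (∀ a ∈ T, a.1 ≠ []) ∧ T.length ≤ 1 ∧ eC T none ≤ 1 ∧ EC T none = t.length ∧
    (∀ k, eC T (some k) = 0) ∧ (∀ k, EC T (some k) = 0) ∧
    (∀ T1 w j T2, T = T1 ++ (w, j) :: T2 → T1 = [] ∧ w = t ∧ j = none) := by
  by_cases h : t = []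
  · exact ⟨[], by simp [h]⟩
  · refine ⟨[(t, none)], by simp, by simpa using h, by simp, by simp, by simp, by simp, by simp, ?_⟩
    intro T1 w j T2 hT
    rcases T1 with _ | ⟨b, T1⟩
    · simp at hT
      simp [hT]
    · simp at hT

end P3
end MorseLTG

namespace MorseLTG

section P4
variable {S : Type*} {C : Set (Word S)}

theorem glue (hC : SC C) {s : Word S} (hs : s ∈ C) (N : ℕ)
    (ih : ∀ K < N, ∀ V : Word S, V ≠ [] → ReducedWord V → MinAr C K V → Indec C K V → Dec C K V) :
    ∀ (L K : ℕ) (y U : Word S), y.length + U.length ≤ L → K < N → y <+: s →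
      ReducedWord (y ++ U) → MinAr C K (y ++ U) →
      (∀ U1 V U2 K1 K2, U = U1 ++ (V ++ U2) → V ≠ [] → Ar C K1 (FreeGroup.mk V) →
        Ar C K2 (FreeGroup.mk (y ++ U1 ++ U2)) → K1 + K2 ≤ K → False) →
      (∀ K', Ar C K' ((FreeGroup.mk s)⁻¹ * FreeGroup.mk (y ++ U)) → K ≤ K') → GlueOut C s K y U := by
  intro L
  induction L with
  | zero =>
    intro K y U hL _ _ _ _ _ _
    have hy : y = [] := List.eq_nil_of_length_eq_zero (by omega)
    have hU : U = [] := List.eq_nil_of_length_eq_zero (by omega)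
    subst hy hU
    exact ⟨Empty, inferInstance, fun _ => 0, fun _ => 0, [], 0, by simp⟩
  | succ L IH =>
  intro K y U hL hKN hys hred hmin H2 H3
  by_cases hZ : y ++ U = []
  · obtain ⟨rfl, rfl⟩ := List.append_eq_nil_iff.1 hZ
    exact ⟨Empty, inferInstance, fun _ => 0, fun _ => 0, [], 0, by simp⟩
  obtain ⟨X, V, Y, K1, K2, hZe, hV, hm1, hm2, hK, hind⟩ := exists_min_infix hZ hmin
  have hVred : ReducedWord V := hred.infix ⟨X, Y, by simp [hZe]⟩
  have hdec := ih K1 (by omega) V hV hVred hm1 hind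
  -- mirror exclusion
  have hmir : ∀ f : Word S, ∀ ρ K', K' + 1 ≤ K1 → Ar C K' (FreeGroup.mk f * (FreeGroup.mk ρ)⁻¹ * (FreeGroup.mk f)⁻¹ * FreeGroup.mk V) →
      FreeGroup.mk (X ++ f) * (FreeGroup.mk ρ)⁻¹ * (FreeGroup.mk (X ++ f))⁻¹ ≠ (FreeGroup.mk s)⁻¹ := by
    intro f ρ K' hK' hA hcon
    have h1 := alg1 (X := FreeGroup.mk X) (Y := FreeGroup.mk Y) hA (by simpa only [mk_append] using hm2.1)
    have := H3 (K' + K2) (by rw [← hcon, hZe]; simpa only [mk_append] using h1)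
    omega
  rcases List.append_eq_append_iff.1 hZe with ⟨t, rfl, hU⟩ | ⟨y2, rfl, hU⟩
  · exact (H2 t V Y K1 K2 hU hV hm1.1 hm2.1 hK.le).elim
  by_cases hy2 : y2 = []
  · subst hy2
    exact (H2 [] V Y K1 K2 (by simpa using hU.symm) hV hm1.1 (by simpa using hm2.1) hK.le).elim
  rcases List.append_eq_append_iff.1 hU with ⟨t, rfl, hY⟩ | ⟨U1, rfl, rfl⟩
  · -- V inside y
    exfalso
    obtain ⟨f, w, g, rfl, ρ, hρ, hwρ, hlen, K', hK', hA⟩ := hdec.wg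
    have hw : w ≠ [] := by rintro rfl; simp at hlen
    have := ov hC hs (y := X ++ f) (c := w) (List.IsPrefix.trans ⟨g ++ t, by simp⟩ hys) hw hρ hwρ
      (hmir f ρ K' hK' hA)
    omega
  -- straddle
  clear hU
  obtain ⟨ι1, _, P1, n1, A, a1, a2, a3, a4, a5, a6, a7⟩ := hdec
  obtain ⟨A', d, c1, c2, c3, c4, c5, c6, c7, c8⟩ := cover P1 s.length A y2 U1 a1 a2 (by
    intro A1 w k A2 c hA hc hcw hcy
    obtain ⟨ρ, hρ, hwρ, hl, K', hK', hAr⟩ := a4 A1 w k A2 hA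
    rw [← hl]
    refine ov hC hs (y := X ++ fl A1) (c := c) ?_ hc hρ (hcw.trans hwρ) (hmir _ ρ K' hK' hAr)
    refine List.IsPrefix.trans ?_ hys
    rw [List.append_assoc]
    exact (List.prefix_append_right_inj _).2 hcy)
  obtain ⟨y1, t, U2, rfl, rfl, hred2⟩ := red_cancel X Y
    (hred.infix ⟨[], y2 ++ (U1 ++ Y), by simp⟩) (hred.infix ⟨X ++ y2 ++ U1, [], by simp⟩)
  have hmk2 : FreeGroup.mk (y1 ++ t ++ (wordInv t ++ U2)) = FreeGroup.mk (y1 ++ U2) := by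
    simp only [mk_append, mk_winv]; group
  have hy2l : 0 < y2.length := List.length_pos_of_ne_nil hy2
  have hv : ∀ {a b : ℕ} {g : FreeGroup S}, Ar C a g → a + K1 ≤ b →
      Ar C b ((FreeGroup.mk (y1 ++ t) * FreeGroup.mk (y2 ++ U1) * (FreeGroup.mk (y1 ++ t))⁻¹) * g) := by
    intro a b g hg hab
    exact ((hm1.1.conj (FreeGroup.mk (y1 ++ t))).mul hg).mono (by omega)
  have hv' : ∀ {a b : ℕ} {g : FreeGroup S}, Ar C a ((FreeGroup.mk s)⁻¹ * g) → a + K1 ≤ b →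
      Ar C b ((FreeGroup.mk s)⁻¹ * ((FreeGroup.mk (y1 ++ t) * FreeGroup.mk (y2 ++ U1) * (FreeGroup.mk (y1 ++ t))⁻¹) * g)) := by
    intro a b g hg hab
    have := (((hm1.1.conj (FreeGroup.mk (y1 ++ t))).conj (FreeGroup.mk s)⁻¹).mul hg).mono (show _ ≤ b by omega)
    convert this using 1
    group
  have hZ2 : FreeGroup.mk (y1 ++ t ++ y2 ++ (U1 ++ (wordInv t ++ U2))) =
      (FreeGroup.mk (y1 ++ t) * FreeGroup.mk (y2 ++ U1) * (FreeGroup.mk (y1 ++ t))⁻¹) * FreeGroup.mk (y1 ++ U2) := by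
    simp only [mk_append, mk_winv]; group
  obtain ⟨ι2, _, P2, n2, B, m, b1, b2, b3, b4, b5, b6, b7, b8, b9, b10⟩ := IH K2 y1 U2
    (by simp only [List.length_append, winv_length] at hL; omega) (by omega)
    (List.IsPrefix.trans ⟨t ++ y2, by simp⟩ hys) hred2
    ⟨by rw [← hmk2]; exact hm2.1, by rw [← hmk2]; exact hm2.2⟩
    (by
      intro W1 V2 W2 a b hW hV2 ha hb hab
      refine H2 (U1 ++ wordInv t ++ W1) V2 W2 a (b + K1) (by simp [hW]) hV2 ha ?_ (by omega)
      have := hv hb le_rfl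
      convert this using 1
      simp only [mk_append, mk_winv]; group)
    (by
      intro K' hK'
      have := H3 (K' + K1) (by rw [hZ2]; exact hv' hK' le_rfl)
      omega)
  obtain ⟨T, t1, t2, t3, t4, t5, t6, t7, t8⟩ := exists_arcT (ι := ι1 ⊕ ι2) (wordInv t)
  have hdpos : 1 ≤ ∑ k, d k := by
    rcases A with _ | ⟨⟨w, k⟩, A2⟩
    · simp [hy2] at a1
    · exact (c5 hy2 w k A2 rfl).trans (Finset.single_le_sum (f := d) (fun _ _ => Nat.zero_le _)
        (Finset.mem_univ k))
  refine ⟨ι1 ⊕ ι2, inferInstance, Sum.elim P1 P2, Sum.elim (fun k => n1 k + d k) n2,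
    rl (fun k => some (Sum.inl k)) A' ++ (T ++ rl (Option.map Sum.inr) B), ∑ k, d k + m,
    ?_, ?_, ?_, ?_, ?_, ?_, ?_, ?_, ?_, ?_⟩
  · simp [c1, t1, b1]
  · intro a ha
    simp only [List.mem_append, rl, List.mem_map] at ha
    rcases ha with ⟨a, ha, rfl⟩ | ha | ⟨a, ha, rfl⟩
    · exact c2 a ha
    · exact t2 a ha
    · exact b2 a ha
  · rintro (k | k)
    · exact a3 k
    · exact b3 k
  · rw [EC_append, EC_append, EC_rl0 _ _ _ (by simp), EC_rl (k := none) _ _ _ (by simp), t5]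
    simp only [List.length_append, winv_length, add_mul]
    omega
  · rw [eC_append, eC_append, eC_rl0 _ _ _ (by simp), eC_rl (k := none) _ _ _ (by simp)]
    omega
  · simp only [List.length_append, rl, List.length_map, Fintype.sum_sum_type, Sum.elim_inl,
      Sum.elim_inr, Finset.sum_add_distrib, Fintype.card_sum]
    omega
  · rintro (k | k)
    · rw [eC_append, eC_append, eC_rl (k := k) _ _ _ (by simp), t6, eC_rl0 _ _ _ (by simp)]
      simp only [Sum.elim_inl]
      have := c6 k
      rcases a6 k with h | ⟨h, w, A2, hA⟩
      · omega
      · have := c5 hy2 w k A2 hA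
        omega
    · rw [eC_append, eC_append, eC_rl0 _ _ _ (by simp), t6, eC_rl (k := some k) _ _ _ (by simp)]
      simpa using b7 k
  · rintro (k | k)
    · rw [EC_append, EC_append, EC_rl (k := k) _ _ _ (by simp), t7, EC_rl0 _ _ _ (by simp)]
      simp only [Sum.elim_inl, add_mul]
      have := c7 k
      have := a5 k
      omega
    · rw [EC_append, EC_append, EC_rl0 _ _ _ (by simp), t7, EC_rl (k := some k) _ _ _ (by simp)]
      simpa using b8 k
  · intro B1 w k B2 hB
    rcases split2 hB.symm with ⟨X2, hX2, -⟩ | ⟨Y1, hY1, rfl⟩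
    · obtain ⟨A1', A2', j, hA', hj, hfl⟩ := rl_split hX2
      simp only [Option.some.injEq] at hj
      subst hj
      obtain ⟨A1, c, A2, hA, hpos⟩ := c8 _ _ _ _ hA'
      obtain ⟨ρ, hρ, ⟨z, rfl⟩, hl, K', hK', hAr⟩ := a4 _ _ _ _ hA
      refine ⟨(w ++ z) ++ c, hC.rot c (w ++ z) (by simpa using hρ), ⟨z ++ c, by simp⟩, ?_, K' + K2,
        by omega, ?_⟩
      · simp at hl ⊢; omega
      · have h1 := alg1 (X := FreeGroup.mk (y1 ++ t)) (Y := FreeGroup.mk (wordInv t ++ U2)) hAr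
          (by simpa only [mk_append] using hm2.1)
        rw [← hfl, show y1 ++ t ++ y2 ++ fl A1' = y1 ++ t ++ (fl A1 ++ c) by rw [hpos]; simp]
        convert h1 using 1
        simp only [mk_append]
        group
    · rcases split2 hY1.symm with ⟨X2, hX2, -⟩ | ⟨Y2, hY2, rfl⟩
      · have := (t8 _ _ _ _ hX2).2.2
        simp at this
      · obtain ⟨A1', A2', j, hA', hj, hfl⟩ := rl_split hY2
        rcases j with _ | j
        · simp at hj
        simp only [Option.map_some, Option.some.injEq] at hj
        subst hj
        obtain ⟨ρ, hρ, hw, hl, K', hK', hAr⟩ := b9 _ _ _ _ hA'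
        refine ⟨ρ, hρ, hw, hl, K' + K1, by omega, ?_⟩
        have h1 := hv hAr le_rfl
        rw [hZ2]
        convert h1 using 1
        simp only [fl_append, fl_rl, ← hfl, c1, t1, mk_append, mk_winv]
        group
  · intro B1 w B2 hB
    rcases split2 hB.symm with ⟨X2, hX2, -⟩ | ⟨Y1, hY1, rfl⟩
    · obtain ⟨A1', A2', j, hA', hj, hfl⟩ := rl_split hX2
      simp at hj
    · rcases split2 hY1.symm with ⟨X2, hX2, -⟩ | ⟨Y2, hY2, rfl⟩
      · obtain ⟨rfl, rfl, -⟩ := t8 _ _ _ _ hX2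
        obtain ⟨z, hz⟩ := hys
        refine ⟨wordInv t ++ (wordInv y1 ++ wordInv (y2 ++ z)), ?_, ⟨_, rfl⟩, ?_, ?_⟩
        · have := hC.rot (wordInv (y2 ++ z)) (wordInv t ++ wordInv y1) (by
            simpa [← hz] using hC.inv _ hs)
          simpa using this
        · simp [← hz]; omega
        · have h1 := (((hm1.1.conj (FreeGroup.mk (y1 ++ t))).conj (FreeGroup.mk s)⁻¹).mul hm2.1).mono hK.le
          convert h1 using 1
          simp only [fl_append, fl_rl, c1, fl_nil, mk_append, mk_winv, ← hz, List.append_nil]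
          group
      · obtain ⟨A1', A2', j, hA', hj, hfl⟩ := rl_split hY2
        rcases j with _ | j
        swap
        · simp at hj
        obtain ⟨ρ, hρ, hw, hl, hAr⟩ := b10 _ _ _ hA'
        refine ⟨ρ, hρ, hw, hl, ?_⟩
        have h1 := hv' hAr (show K2 + K1 ≤ K by omega)
        rw [hZ2]
        convert h1 using 1
        simp only [fl_append, fl_rl, ← hfl, c1, t1, mk_append, mk_winv]
        group

theorem dec_main (hC : SC C) : ∀ (N : ℕ) (u : Word S), u ≠ [] → ReducedWord u → MinAr C N u →
    Indec C N u → Dec C N u := by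
  intro N
  induction N using Nat.strong_induction_on with
  | _ N IH =>
  intro u hu hred hmin hind
  rcases u with _ | ⟨a, U0⟩
  · simp at hu
  rcases hmin.1.peel hC hred with ⟨U1, U2, N1, N2, rfl, h1, h2, hN⟩ | ⟨r', M, hr, rfl, hM⟩
  · exfalso
    have hU1 : U1 ≠ [] := by
      rintro rfl
      exact not_red_cancel (X := []) hred
    have := hind [a] U1 (li a :: U2) N1 N2 (by simp) hU1 h1 (by
      convert h2 using 1
      simp only [List.singleton_append]
      rw [mk_cons, mk_cons (li a), mk_li]; group) hN
    simp at this
  · obtain ⟨y, t, U, hy, hU, hredZ⟩ := red_cancel (wordInv (a :: r')) (a :: U0)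
      (hC.red _ (hC.inv _ hr)) hred
    have ht : t ≠ [] := by
      rintro rfl
      simp only [List.append_nil] at hy
      simp only [winv_nil, List.nil_append] at hU
      rw [← hy, ← hU] at hredZ
      simp only [winv_cons, List.append_assoc, List.singleton_append] at hredZ
      have := not_red_cancel (X := wordInv r') (a := li a) (Y := U0)
      rw [li_li] at this
      exact this hredZ
    have hs : wordInv (a :: r') ∈ C := hC.inv _ hr
    have hsl : (wordInv (a :: r')).length = (a :: r').length := by simp
    generalize hrr : a :: r' = r at *
    have hZ : FreeGroup.mk (y ++ U) = (FreeGroup.mk r)⁻¹ * FreeGroup.mk (a :: U0) := by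
      rw [hU, ← mk_winv, hy]
      simp only [mk_append, mk_winv]; group
    have hZ' : FreeGroup.mk (a :: U0) = FreeGroup.mk r * FreeGroup.mk (y ++ U) := by rw [hZ]; group
    have hsr : (FreeGroup.mk (wordInv r))⁻¹ = FreeGroup.mk r := by rw [mk_winv]; simp
    have hminZ : MinAr C M (y ++ U) := by
      refine ⟨by rw [hZ]; exact hM, ?_⟩
      intro K hK
      have := hmin.2 (1 + K) (by rw [hZ']; simpa using (Ar.rel hr 1).mul hK)
      omega
    have hrx : FreeGroup.mk r * FreeGroup.mk y = FreeGroup.mk (wordInv t) := by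
      rw [← hsr, hy]; simp only [mk_append, mk_winv]; group
    obtain ⟨ι, _, P, n, B, m, b1, b2, b3, b4, b5, b6, b7, b8, b9, b10⟩ := glue hC hs (M + 1)
      (fun K hK => IH K hK) (y.length + U.length) M y U le_rfl (by omega) ⟨t, hy.symm⟩ hredZ hminZ
      (by
        intro U1 V U2 K1 K2 hUe hV h1 h2 h3
        have := hind (wordInv t ++ U1) V U2 K1 (1 + K2) (by rw [hU, hUe]; simp) hV h1 (by
          have := (Ar.rel hr 1).mul h2
          convert this using 1
          rw [List.append_assoc, mk_append, ← hrx]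
          simp only [mk_append]; group) (by omega)
        simp [ht] at this)
      (by
        intro K' hK'
        rw [hsr, ← hZ'] at hK'
        have := hmin.2 _ hK'
        omega)
    have hpos : ∀ W, FreeGroup.mk (wordInv t ++ W) = FreeGroup.mk r * FreeGroup.mk (y ++ W) := by
      intro W
      rw [mk_append, ← hrx, mk_append]; group
    refine ⟨Option ι, inferInstance, fun k => k.elim r.length P, fun k => k.elim m n,
      (wordInv t, none) :: B, ?_, ?_, ?_, ?_, ?_, ?_, ?_⟩
    · simp [b1, hU]
    · intro b hb
      simp only [List.mem_cons] at hb
      rcases hb with rfl | hb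
      · simpa using ht
      · exact b2 b hb
    · rintro (_ | k)
      · exact List.length_pos_of_ne_nil (hC.ne _ hr)
      · exact b3 k
    · intro B1 w k B2 hB
      rcases B1 with _ | ⟨b, B1⟩
      · simp only [List.nil_append, List.cons.injEq, Prod.mk.injEq] at hB
        obtain ⟨⟨rfl, rfl⟩, rfl⟩ := hB
        refine ⟨r, hr, ?_, rfl, M, le_rfl, ?_⟩
        · rw [winv_eq_iff] at hy
          rw [hy]; simp
        · simpa using hM
      · simp only [List.cons_append, List.cons.injEq] at hB
        obtain ⟨rfl, hB⟩ := hB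
        simp only [fl_cons]
        rcases k with _ | k
        · obtain ⟨ρ, hρ, hw, hl, hAr⟩ := b10 _ _ _ hB
          refine ⟨ρ, hρ, hw, by simpa using hl, M, le_rfl, ?_⟩
          rw [hsr] at hAr
          rw [hpos, hZ']
          convert hAr using 1
          group
        · obtain ⟨ρ, hρ, hw, hl, K', hK', hAr⟩ := b9 _ _ _ _ hB
          refine ⟨ρ, hρ, hw, hl, 1 + K', by omega, ?_⟩
          rw [hpos, hZ']
          convert (Ar.rel hr 1).mul hAr using 1
          group
    · rintro (_ | k)
      · have e1 : (wordInv r).length = y.length + t.length := by rw [hy]; simp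
        simp only [Option.elim, EC_cons, if_true, winv_length] at b4 e1 ⊢
        omega
      · simpa using b8 k
    · rintro (_ | k)
      · right
        refine ⟨?_, _, _, rfl⟩
        simp; omega
      · left
        simpa using b7 k
    · simp only [List.length_cons, Fintype.sum_option, Option.elim, Fintype.card_option]
      omega

/-- weak Greendlinger -/
theorem WG (hC : SC C) {u : Word S} (hu : u ≠ []) (hred : ReducedWord u) {N : ℕ}
    (h : Ar C N (FreeGroup.mk u)) : ∃ X w Y, u = X ++ (w ++ Y) ∧ ∃ r ∈ C, w <+: r ∧
      2 * r.length < 3 * w.length := by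
  classical
  have hex : ∃ N, Ar C N (FreeGroup.mk u) := ⟨N, h⟩
  have hmin : MinAr C (Nat.find hex) u := ⟨Nat.find_spec hex, fun K hK => Nat.find_min' hex hK⟩
  obtain ⟨X, V, Y, K1, K2, rfl, hV, hm1, -, -, hind⟩ := exists_min_infix hu hmin
  obtain ⟨X', w, Y', rfl, r, hr, hw, hl, -⟩ :=
    (dec_main hC K1 V hV (hred.infix ⟨X, Y, by simp⟩) hm1 hind).wg
  exact ⟨X ++ X', w, Y' ++ Y, by simp, r, hr, hw, hl⟩

end P4
end MorseLTG

namespace MorseLTG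

section P5
variable {S : Type*} {C : Set (Word S)} {G : Type*} [Group G] {σ : S → G}

@[simp] theorem ev_nil : evalWord σ [] = 1 := rfl
@[simp] theorem ev_append (u v : Word S) : evalWord σ (u ++ v) = evalWord σ u * evalWord σ v := by
  simp [evalWord]
theorem ev_cons (a : S × Bool) (v : Word S) : evalWord σ (a :: v) = evalWord σ [a] * evalWord σ v := by
  rw [← ev_append]; rfl
theorem ev_li (a : S × Bool) : evalWord σ [li a] = (evalWord σ [a])⁻¹ := by
  obtain ⟨a, b⟩ := a
  cases b <;> simp [evalWord, li]
@[simp] theorem ev_winv (u : Word S) : evalWord σ (wordInv u) = (evalWord σ u)⁻¹ := by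
  induction u with
  | nil => simp
  | cons a u ih => rw [winv_cons, ev_append, ih, ev_li, ev_cons a u]; simp

theorem ev_lift (u : Word S) : evalWord σ u = FreeGroup.lift σ (FreeGroup.mk u) := by
  rw [FreeGroup.lift_mk]
  simp only [evalWord]
  congr 1
  refine List.map_congr_left ?_
  rintro ⟨a, b⟩ _
  cases b <;> rfl

/-- abstract small cancellation presentation -/
structure Pres (σ : S → G) (C : Set (Word S)) : Prop where
  sc : SC C
  rel : ∀ r ∈ C, evalWord σ r = 1
  null : ∀ w, evalWord σ w = 1 → ∃ N, Ar C N (FreeGroup.mk w)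
  gen : ∀ g : G, ∃ w, evalWord σ w = g

theorem Pres.wg (hP : Pres σ C) {u : Word S} (hu : u ≠ []) (hred : ReducedWord u)
    (h : evalWord σ u = 1) : ∃ X w Y, u = X ++ (w ++ Y) ∧ ∃ r ∈ C, w <+: r ∧
      2 * r.length < 3 * w.length := by
  obtain ⟨N, hN⟩ := hP.null u h
  exact WG hP.sc hu hred hN

/-- concrete relator set -/
def relC (R : Set (Word S)) : Set (Word S) := {w | w ∈ symmClosure R ∧ w ≠ []}

theorem symm_rot {R : Set (Word S)} {w : Word S} (h : w ∈ symmClosure R) (j : ℕ) :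
    w.rotate j ∈ symmClosure R := by
  obtain ⟨r, hr, k, rfl | rfl⟩ := h
  · exact ⟨r, hr, k + j, Or.inl (by rw [List.rotate_rotate])⟩
  · exact ⟨r, hr, k + j, Or.inr (by rw [List.rotate_rotate])⟩

theorem winv_rot (w : Word S) (k : ℕ) : ∃ j, wordInv (w.rotate k) = (wordInv w).rotate j := by
  refine ⟨w.length - k % w.length, ?_⟩
  unfold wordInv
  rw [List.map_rotate, List.reverse_rotate]
  simp

theorem symm_inv {R : Set (Word S)} {w : Word S} (h : w ∈ symmClosure R) :
    wordInv w ∈ symmClosure R := by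
  obtain ⟨r, hr, k, rfl | rfl⟩ := h
  · obtain ⟨j, hj⟩ := winv_rot r k
    exact ⟨r, hr, j, Or.inr hj⟩
  · obtain ⟨j, hj⟩ := winv_rot (wordInv r) k
    exact ⟨r, hr, j, Or.inl (by rw [hj, winv_winv])⟩

theorem relC_sc {R : Set (Word S)} (h : SmallCancellation R (1/9)) : SC (relC R) where
  ne := fun r hr => hr.2
  rot := by
    intro x y ⟨h1, h2⟩
    refine ⟨?_, by simpa [and_comm] using h2⟩
    have := symm_rot h1 x.length
    rwa [List.rotate_append_length_eq] at this
  inv := fun r hr => ⟨symm_inv hr.1, by simpa using hr.2⟩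
  red := by
    rintro r ⟨⟨r0, hr0, k, rfl | rfl⟩, -⟩
    · exact h.1 r0 hr0 k
    · obtain ⟨j, hj⟩ := winv_rot (wordInv r0) k
      rw [winv_winv, winv_eq_iff] at hj
      rw [hj]
      exact red_inv (h.1 r0 hr0 j)
  pc := by
    intro r₁ h1 r₂ h2 hne p hp hp1 hp2
    have := h.2 r₁ h1.1 p ⟨hp, r₁, h1.1, r₂, h2.1, hne, hp1, hp2⟩ hp1.isInfix
    have h3 : (9 * p.length : ℝ) < r₁.length := by linarith
    have h4 : 9 * p.length < r₁.length := by exact_mod_cast h3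
    omega

theorem Ar.inv (hC : SC C) {N : ℕ} {x : FreeGroup S} (h : Ar C N x) : Ar C N x⁻¹ := by
  induction h with
  | one N => simpa using Ar.one N
  | @mulc N g r x hr h ih =>
    have := ih.mul (Ar.rel' hC hr g)
    simpa [mul_assoc] using this

theorem pres_null {R : Set (Word S)} (hC : SC (relC R)) (w : Word S)
    (h : evalWord (presGen R) w = 1) : ∃ N, Ar (relC R) N (FreeGroup.mk w) := by
  have h1 : FreeGroup.mk w ∈ Subgroup.normalClosure (FreeGroup.mk '' R) := by
    rw [ev_lift] at h
    have h2 : FreeGroup.lift (presGen R) = PresentedGroup.mk (FreeGroup.mk '' R) := by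
      ext s; simp [presGen]; rfl
    rw [h2] at h
    exact (QuotientGroup.eq_one_iff (FreeGroup.mk w)).1 h
  let K : Subgroup (FreeGroup S) :=
    { carrier := {x | ∃ N, Ar (relC R) N x}
      mul_mem' := fun ⟨a, ha⟩ ⟨b, hb⟩ => ⟨a + b, ha.mul hb⟩
      one_mem' := ⟨0, Ar.one 0⟩
      inv_mem' := fun ⟨a, ha⟩ => ⟨a, ha.inv hC⟩ }
  have hK : K.Normal := ⟨fun n ⟨a, ha⟩ g => ⟨a, ha.conj g⟩⟩
  have h2 : Subgroup.normalClosure (FreeGroup.mk '' R) ≤ K := by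
    apply Subgroup.normalClosure_le_normal
    rintro _ ⟨r, hr, rfl⟩
    by_cases hr0 : r = []
    · subst hr0; exact ⟨0, Ar.one 0⟩
    · exact ⟨1, by simpa using Ar.rel (C := relC R) (r := r) ⟨⟨r, hr, 0, Or.inl (by simp)⟩, hr0⟩ 1⟩
  exact h2 h1

theorem ev_rotate {w : Word S} (h : evalWord σ w = 1) (k : ℕ) : evalWord σ (w.rotate k) = 1 := by
  rw [List.rotate_eq_drop_append_take_mod, ev_append]
  rw [← List.take_append_drop (k % w.length) w, ev_append] at h
  exact mul_eq_one_comm.1 h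

theorem pres_rel {R : Set (Word S)} (r : Word S) (hr : r ∈ relC R) :
    evalWord (presGen R) r = 1 := by
  have h0 : ∀ r ∈ R, evalWord (presGen R) r = 1 := by
    intro r hr
    rw [ev_lift]
    have h2 : FreeGroup.lift (presGen R) = PresentedGroup.mk (FreeGroup.mk '' R) := by
      ext s; simp [presGen]; rfl
    rw [h2]
    exact (QuotientGroup.eq_one_iff (FreeGroup.mk r)).2 (Subgroup.subset_normalClosure ⟨r, hr, rfl⟩)
  obtain ⟨⟨r0, hr0, k, rfl | rfl⟩, -⟩ := hr
  · exact ev_rotate (h0 r0 hr0) k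
  · exact ev_rotate (by simp [h0 r0 hr0]) k

theorem pres_main {R : Set (Word S)} (h : SmallCancellation R (1/9)) :
    Pres (presGen R) (relC R) where
  sc := relC_sc h
  rel := pres_rel
  null := pres_null (relC_sc h)
  gen := by
    intro g
    obtain ⟨x, rfl⟩ := QuotientGroup.mk_surjective g
    obtain ⟨w, rfl⟩ := Quot.exists_rep x
    refine ⟨w, ?_⟩
    rw [ev_lift]
    have h2 : FreeGroup.lift (presGen R) = PresentedGroup.mk (FreeGroup.mk '' R) := by
      ext s; simp [presGen]; rfl
    rw [h2]; rfl

end P5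
end MorseLTG

namespace MorseLTG

section P6
variable {S : Type*} {C : Set (Word S)} {G : Type*} [Group G] {σ : S → G}

theorem nat_max {P : ℕ → Prop} {B : ℕ} (h0 : ∃ n, P n) (hB : ∀ n, P n → n ≤ B) :
    ∃ n, P n ∧ ∀ m, P m → m ≤ n := by
  classical
  obtain ⟨n, hn⟩ := h0
  exact ⟨Nat.findGreatest P B, Nat.findGreatest_spec (hB n hn) hn,
    fun m hm => Nat.le_findGreatest (hB m hm) hm⟩

theorem SC.sub (hC : SC C) {r A e B : Word S} (hr : r ∈ C) (h : r = A ++ (e ++ B)) :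
    ∃ r' ∈ C, e <+: r' ∧ r'.length = r.length := by
  subst h
  exact ⟨_, hC.rot _ _ hr, ⟨B ++ A, by simp⟩, by simp; omega⟩

theorem SC.pos (hC : SC C) {r : Word S} (hr : r ∈ C) : 0 < r.length :=
  List.length_pos_iff.2 (hC.ne _ hr)

theorem red_strip {V w : Word S} (hV : ReducedWord V) (hw : ReducedWord w)
    (h : ¬ ReducedWord (V ++ w)) : ∃ X a Y, V = X ++ [a] ∧ w = li a :: Y := by
  by_contra hc
  exact h (red_glue hV hw fun X' a Y' h1 h2 => hc ⟨X', a, Y', h1, h2⟩)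

theorem last_of_ne {α : Type*} {l : List α} (h : l ≠ []) : ∃ l' a, l = l' ++ [a] := by
  rcases List.eq_nil_or_concat l with h' | ⟨l', a, h'⟩
  · exact absurd h' h
  · exact ⟨l', a, by simp [h']⟩

def HV (C : Set (Word S)) (V : Word S) : Prop :=
  ∀ e, e <:+: V → ∀ r ∈ C, e <+: r → 9 * e.length ≤ 5 * r.length

def HW (C : Set (Word S)) (cc n0 i0 : ℕ) (w : Word S) : Prop :=
  ∀ A e B, w = A ++ (e ++ B) → ∀ r ∈ C, e <+: r →
    9 * ((cc + 1) * e.length) ≤ 5 * (cc * r.length) ∨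
      (3 * e.length ≤ 2 * r.length ∧ i0 < A.length + e.length ∧ r.length ≤ n0)

def Front (C : Set (Word S)) (V f w : Word S) : Prop :=
  f ≠ [] → ReducedWord (V ++ (f ++ w)) ∧ ∃ z, f ++ z ∈ C ∧ 3 * f.length < (f ++ z).length ∧
    (∀ V' a z', V = V' ++ [a] → z = z' ++ [a] → False) ∧
    (∀ b w' z', w = b :: w' → z = b :: z' → False)

theorem HW.low {cc n0 i0 : ℕ} {w : Word S} (h : HW C cc n0 i0 w) {A e B r : Word S}
    (hw : w = A ++ (e ++ B)) (hr : r ∈ C) (he : e <+: r) :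
    9 * e.length ≤ 5 * r.length ∨
      (3 * e.length ≤ 2 * r.length ∧ i0 < A.length + e.length ∧ r.length ≤ n0) := by
  rcases h A e B hw r hr he with h | h
  · left
    have : (cc + 1) * (9 * e.length) ≤ (cc + 1) * (5 * r.length) := by nlinarith
    exact Nat.le_of_mul_le_mul_left this (by omega)
  · right; exact h

theorem HW.drop {cc n0 i0 : ℕ} {U w : Word S} (h : HW C cc n0 i0 (U ++ w)) (hU : U.length ≤ i0) :
    HW C cc n0 (i0 - U.length) w := by
  intro A e B hw r hr he
  rcases h (U ++ A) e B (by simp [hw]) r hr he with h | ⟨h1, h2, h3⟩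
  · exact Or.inl h
  · refine Or.inr ⟨h1, ?_, h3⟩
    simp at h2
    omega

theorem LLaux (hP : Pres σ C) {cc n0 : ℕ} (hcc : 1 ≤ cc) : ∀ (L : ℕ) (V f w : Word S) (i0 : ℕ),
    V.length + w.length ≤ L → ReducedWord V → ReducedWord w → evalWord σ (V ++ (f ++ w)) = 1 →
    Front C V f w → HV C V → HW C cc n0 i0 w → i0 ≤ w.length → i0 ≤ n0 + cc * V.length := by
  have hC := hP.sc
  intro L
  induction L with
  | zero => intro V f w i0 hL; intros; omega
  | succ L ih =>
  intro V f w i0 hL hVr hwr hev hF hV hw hi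
  by_cases hT : ReducedWord (V ++ (f ++ w))
  swap
  · have hf : f = [] := by
      by_contra hf; exact hT (hF hf).1
    subst hf
    obtain ⟨X, a, Y, rfl, rfl⟩ := red_strip hVr hwr hT
    by_cases h1 : i0 = 0
    · omega
    have := ih X [] Y (i0 - 1) (by simp at hL ⊢; omega) hVr.left
      (ReducedWord.right (u := [li a]) hwr)
      (by
        have : evalWord σ ((X ++ [a]) ++ ([] ++ li a :: Y)) = evalWord σ X * (evalWord σ [a] *
          (evalWord σ [li a] * evalWord σ Y)) := by
            rw [show (X ++ [a]) ++ ([] ++ li a :: Y) = X ++ ([a] ++ ([li a] ++ Y)) by simp]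
            simp only [ev_append]
        rw [this, ev_li] at hev
        simpa using hev)
      (fun h => absurd rfl h)
      (fun e he => hV e (he.trans ⟨[], [a], by simp⟩))
      (HW.drop (U := [li a]) hw (by simp; omega)) (by simp at hi; omega)
    simp only [List.length_append, List.length_singleton, Nat.mul_add]
    omega
  by_cases hne : V ++ (f ++ w) = []
  · simp at hne
    simp [hne] at hi ⊢
    omega
  obtain ⟨X, e, Y, hXY, r, hr, her, hbad, hmax⟩ : ∃ X e Y, V ++ (f ++ w) = X ++ (e ++ Y) ∧
      ∃ r ∈ C, e <+: r ∧ 2 * r.length < 3 * e.length ∧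
      ∀ X' e' Y', V ++ (f ++ w) = X' ++ (e' ++ Y') → ∀ r' ∈ C, e' <+: r' →
        2 * r'.length < 3 * e'.length → e'.length ≤ e.length := by
    obtain ⟨n, ⟨X, e, Y, h1, r, hr, h2, h3, rfl⟩, hm⟩ := nat_max (P := fun n => ∃ X e Y,
      V ++ (f ++ w) = X ++ (e ++ Y) ∧ ∃ r ∈ C, e <+: r ∧ 2 * r.length < 3 * e.length ∧
        e.length = n) (B := (V ++ (f ++ w)).length)
      (by
        obtain ⟨X, e, Y, h1, r, hr, h2, h3⟩ := hP.wg hne hT hev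
        exact ⟨_, X, e, Y, h1, r, hr, h2, h3, rfl⟩)
      (by
        rintro n ⟨X, e, Y, h1, r, hr, h2, h3, rfl⟩
        rw [h1]; simp; omega)
    exact ⟨X, e, Y, h1, r, hr, h2, h3, fun X' e' Y' h1' r' hr' h2' h3' =>
      hm _ ⟨X', e', Y', h1', r', hr', h2', h3', rfl⟩⟩
  have hrp := hC.pos hr
  have herlen := her.length_le
  have hsp : (∃ t, X = V ++ t ∧ f ++ w = t ++ (e ++ Y)) ∨
      (∃ e0, e0 ≠ [] ∧ V = X ++ e0 ∧ e ++ Y = e0 ++ (f ++ w)) := by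
    rcases List.append_eq_append_iff.1 hXY with ⟨t, h1, h2⟩ | ⟨e0, h1, h2⟩
    · exact Or.inl ⟨t, h1, h2⟩
    · by_cases h0 : e0 = []
      · subst h0
        exact Or.inl ⟨[], by simp [h1], by simpa using h2.symm⟩
      · exact Or.inr ⟨e0, h0, h1, h2⟩
  rcases hsp with ⟨t, rfl, h2⟩ | ⟨e0, he0, rfl, h2⟩
  · -- X = V ++ t, f ++ w = t ++ e ++ Y
    rcases List.append_eq_append_iff.1 h2 with ⟨A, rfl, h3⟩ | ⟨g, hg, h3⟩
    · -- e in w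
      rcases hw.low h3 hr her with h | h <;> omega
    · -- f = t ++ g , e ++ Y = g ++ w
      by_cases hg0 : g = []
      · subst hg0
        rcases hw.low (A := []) (e := e) (B := Y) (by simpa using h3.symm) hr her with h | h <;> omega
      have hfne : f ≠ [] := by rintro rfl; simp at hg; exact hg0 hg.2
      obtain ⟨-, z, hz, hz3, hzl, hzf⟩ := hF hfne
      have hρ : g ++ (z ++ t) ∈ C := by
        have := hC.rot t (g ++ z) (by simpa [hg] using hz)
        simpa using this
      obtain ⟨y, hy⟩ := her
      have key : g <+: r → r = g ++ (z ++ t) ∨ 9 * g.length + 1 ≤ r.length := by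
        intro hgr
        by_cases hh : r = g ++ (z ++ t)
        · exact Or.inl hh
        · exact Or.inr (hC.pc _ hr _ hρ hh _ hg0 hgr ⟨_, rfl⟩)
      rcases List.append_eq_append_iff.1 h3 with ⟨e2', h4, h5⟩ | ⟨e2, h4, h5⟩
      · -- g = e ++ e2'
        have hee : e ≠ [] := by rintro rfl; simp at hbad
        by_cases hh : r = e ++ (e2' ++ (z ++ t))
        · subst hh; subst hg; subst h4; simp at hz3 hbad; omega
        · have := hC.pc _ hr _ (by simpa [h4] using hρ) hh e hee ⟨y, hy⟩ ⟨_, rfl⟩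
          omega
      · -- e = g ++ e2, w = e2 ++ Y
        subst h4
        rcases key ⟨e2 ++ y, by simp [← hy]⟩ with hh | hh
        · rw [← hy] at hh
          simp at hh
          cases e2 with
          | nil =>
            have := congrArg List.length hy
            have := congrArg List.length hh
            subst hg; simp at *; omega
          | cons b e2 =>
            cases z with
            | nil => simp at hz3; omega
            | cons b' z => 
              simp at hh
              exact (hzf b _ z h5 (by rw [hh.1])).elim
        · obtain ⟨r', hr', he', hl'⟩ := hC.sub (A := g) (e := e2) (B := y) hr (by simp [← hy])
          simp at hbad
          rcases hw.low (A := []) (by simpa using h5) hr' he' with h | h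
          · omega
          · simp at h; omega
  · -- V = X ++ e0, e ++ Y = e0 ++ (f ++ w)
    rcases List.append_eq_append_iff.1 h2 with ⟨y0, h4, h5⟩ | ⟨e1, h4, h5⟩
    · have := hV e ⟨X, y0, by simp [h4]⟩ r hr her
      omega
    subst h4
    obtain ⟨e0', a0, h0⟩ := last_of_ne he0
    obtain ⟨y, hy⟩ := her
    have h9 : 9 * e0.length ≤ 5 * r.length :=
      hV e0 ⟨X, [], by simp⟩ r hr ⟨e1 ++ y, by simp [← hy]⟩
    have hrot : e1 ++ (y ++ e0) ∈ C := by
      have := hC.rot e0 (e1 ++ y) (by simpa [← hy] using hr)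
      simpa using this
    have hlen := congrArg List.length hy
    simp at hlen hbad
    -- e = e0 ++ e1, e1 ++ Y = f ++ w
    have hsp2 : (∃ f2, f = e1 ++ f2) ∨ (∃ e2, e2 ≠ [] ∧ e1 = f ++ e2 ∧ w = e2 ++ Y) := by
      rcases List.append_eq_append_iff.1 h5 with ⟨t, h1, h2⟩ | ⟨t, h1, h2⟩
      · by_cases h0 : t = []
        · subst h0; exact Or.inl ⟨[], by simpa using h1.symm⟩
        · exact Or.inr ⟨t, h0, h1, h2⟩
      · exact Or.inl ⟨t, h1⟩
    rcases hsp2 with ⟨f2, hf2⟩ | ⟨e2, he2, hfe, hwe⟩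
    · by_cases he1 : e1 = []
      · subst he1; simp at hbad; omega
      have hfne : f ≠ [] := by rintro rfl; simp at hf2; exact he1 hf2.1
      obtain ⟨-, z, hz, hz3, hzl, hzf⟩ := hF hfne
      by_cases hh : e1 ++ (y ++ e0) = f ++ z
      · exfalso
        rw [hf2] at hh
        have hzne : z ≠ [] := by rintro rfl; simp at hz3; omega
        obtain ⟨z', b, hz'⟩ := last_of_ne hzne
        have : b = a0 := by
          subst h0; subst hz'
          rw [← List.append_assoc, ← List.append_assoc, ← List.append_assoc] at hh
          exact (List.cons.inj (List.append_inj_right' hh rfl)).1.symm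
        subst this
        exact hzl (X ++ e0') b z' (by simp [h0]) hz'
      · have := hC.pc _ hrot _ hz hh e1 he1 ⟨_, rfl⟩ ⟨f2 ++ z, by simp [hf2]⟩
        simp at this; omega
    · subst hfe
      have h9f : 9 * f.length ≤ r.length := by
        by_cases hfne : f = []
        · subst hfne; simp
        obtain ⟨-, z, hz, hz3, hzl, hzf⟩ := hF hfne
        by_cases hh : (f ++ e2) ++ (y ++ e0) = f ++ z
        · exfalso
          simp at hh
          cases e2 with
          | nil => exact he2 rfl
          | cons b e2 => exact hzf b _ _ hwe hh.symm
        · have := hC.pc _ hrot _ hz hh f hfne ⟨e2 ++ (y ++ e0), by simp⟩ ⟨_, rfl⟩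
          simp at this hlen; omega
      obtain ⟨r', hr', he', hl'⟩ := hC.sub (A := e0 ++ f) (e := e2) (B := y) hr (by simp [← hy])
      rcases hw [] e2 Y (by simpa using hwe) r' hr' he' with h | h
      swap
      · simp at h; omega
      rw [hl'] at h
      have hcmp : e2.length ≤ cc * e0.length := by
        simp at hbad
        nlinarith
      by_cases hi2 : i0 ≤ e2.length
      · simp; nlinarith
      have hr'' := hr
      rw [← hy] at hr''
      have hrec := ih X (wordInv y) Y (i0 - e2.length)
        (by
          have := List.length_pos_iff.2 he0
          have := List.length_pos_iff.2 he2
          simp [hwe] at hL ⊢; omega) hVr.left (by rw [hwe] at hwr; exact hwr.right)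
        (by
          have h1 := hP.rel r hr
          rw [← hy] at h1
          rw [hXY] at hev
          simp only [ev_append, ev_winv] at h1 hev ⊢
          rw [← eq_inv_iff_mul_eq_one] at h1
          rw [h1] at hev; exact hev)
        (by
          intro hyne
          have hyne' : y ≠ [] := by simpa using hyne
          have hyr : ReducedWord y := (hC.red _ hr'').right
          refine ⟨?_, wordInv (e0 ++ (f ++ e2)), ?_, ?_, ?_, ?_⟩
          · rw [← List.append_assoc]
            refine red_glue (red_glue hVr.left (red_inv hyr) ?_) (by rw [hwe] at hwr; exact hwr.right) ?_
            · intro X' a Y' h1 h2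
              rw [winv_eq_iff] at h2
              simp at h2
              have := hmax X' (a :: (e0 ++ (f ++ e2))) Y (by rw [hXY, h1]; simp)
                (a :: ((e0 ++ (f ++ e2)) ++ wordInv Y')) (by
                  have := hC.rot ((e0 ++ (f ++ e2)) ++ wordInv Y') [a] (by simpa [h2] using hr'')
                  simpa using this) ⟨wordInv Y', by simp⟩ (by
                  simp [h2] at hbad hlen ⊢; omega)
              simp at this
            · intro X' a Y' h1 h2
              obtain ⟨y', b, hyb⟩ := last_of_ne hyne
              rw [hyb, ← List.append_assoc] at h1
              have : b = a := (List.cons.inj (List.append_inj_right' h1 rfl)).1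
              subst this
              rw [winv_eq_iff] at hyb
              simp at hyb
              have := hmax X (e0 ++ (f ++ e2) ++ [li b]) Y' (by rw [hXY, h2]; simp)
                _ hr'' ⟨wordInv y', by rw [hyb]; simp⟩ (by
                  simp at hbad hlen ⊢; omega)
              simp at this
          · rw [← winv_append]; exact hC.inv _ hr''
          · simp at hbad hlen ⊢; omega
          · intro V' a z' h1 h2
            rw [winv_eq_iff] at h2
            rw [winv_append] at h2
            simp only [winv_cons, winv_nil, List.nil_append, List.singleton_append] at h2
            apply not_red_cancel (X := V') (a := a) (Y := wordInv z' ++ Y)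
            rw [hXY, h2, h1] at hT
            simpa using hT
          · intro b w' z' h1 h2
            rw [winv_eq_iff, winv_cons] at h2
            apply not_red_cancel (X := X ++ wordInv z') (a := li b) (Y := w')
            rw [hXY, h2, h1] at hT
            simpa using hT)
        (fun e he => hV e (he.trans ⟨[], e0, by simp⟩))
        (HW.drop (U := e2) (by rw [← hwe]; exact hw) (by omega)) (by simp [hwe] at hi ⊢; omega)
      simp only [List.length_append, Nat.mul_add]
      omega

end P6

end MorseLTG

namespace MorseLTG

section P7
variable {S : Type*} {C : Set (Word S)} {G : Type*} [Group G] {σ : S → G}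

theorem wd_le {g h : G} {w : Word S} (hw : g * evalWord σ w = h) : wordDist σ g h ≤ w.length :=
  Nat.sInf_le ⟨w, rfl, hw⟩

theorem Pres.geo (hP : Pres σ C) (g h : G) : ∃ w, w.length = wordDist σ g h ∧ g * evalWord σ w = h := by
  obtain ⟨w, hw⟩ := hP.gen (g⁻¹ * h)
  exact Nat.sInf_mem (s := {n : ℕ | ∃ w : Word S, w.length = n ∧ g * evalWord σ w = h})
    ⟨_, w, rfl, by rw [hw]; simp⟩

@[simp] theorem wd_self (g : G) : wordDist σ g g = 0 := by
  have := wd_le (σ := σ) (g := g) (h := g) (w := []) (by simp)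
  simpa using this

theorem Pres.wd_comm (hP : Pres σ C) (g h : G) : wordDist σ g h = wordDist σ h g := by
  have key : ∀ g h : G, wordDist σ g h ≤ wordDist σ h g := by
    intro g h
    obtain ⟨w, hw, hw2⟩ := hP.geo h g
    rw [← hw, ← winv_length]
    exact wd_le (by rw [ev_winv, ← hw2]; simp)
  exact le_antisymm (key _ _) (key _ _)

theorem Pres.wd_tri (hP : Pres σ C) (g k h : G) : wordDist σ g h ≤ wordDist σ g k + wordDist σ k h := by
  obtain ⟨w, hw, hw2⟩ := hP.geo g k
  obtain ⟨v, hv, hv2⟩ := hP.geo k h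
  rw [← hw, ← hv, ← List.length_append]
  exact wd_le (by rw [ev_append, ← mul_assoc, hw2, hv2])

theorem Pres.wd_left (hP : Pres σ C) (k g h : G) : wordDist σ (k * g) (k * h) = wordDist σ g h := by
  unfold wordDist
  simp only [mul_assoc, mul_right_inj]

theorem Pres.wd_ev (hP : Pres σ C) (g : G) (w : Word S) :
    wordDist σ g (g * evalWord σ w) = wordDist σ 1 (evalWord σ w) := by
  rw [← hP.wd_left g 1]; simp

theorem Pres.wd_zero (hP : Pres σ C) {g h : G} (h0 : wordDist σ g h = 0) : g = h := by
  obtain ⟨w, hw, hw2⟩ := hP.geo g h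
  rw [h0, List.length_eq_zero_iff] at hw
  subst hw; simpa using hw2

/-- geodesic word -/
def GW (σ : S → G) (w : Word S) : Prop := w.length ≤ wordDist σ 1 (evalWord σ w)

theorem GW.le {w w' : Word S} (h : GW σ w) (he : evalWord σ w' = evalWord σ w) : w.length ≤ w'.length :=
  le_trans h (wd_le (by simpa using he))

theorem GW.infix {A e B : Word S} (hP : Pres σ C) (h : GW σ (A ++ (e ++ B))) : GW σ e := by
  unfold GW
  obtain ⟨w', hl, hw'⟩ := hP.geo 1 (evalWord σ e)
  have := h.le (w' := A ++ (w' ++ B)) (by simp at hw' ⊢; rw [hw'])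
  simp at this
  omega

theorem GW.winv {w : Word S} (hP : Pres σ C) (h : GW σ w) : GW σ (wordInv w) := by
  unfold GW at *
  rw [winv_length, ev_winv, hP.wd_comm]
  have := hP.wd_left (evalWord σ w) (evalWord σ w)⁻¹ 1
  simp at this; omega

theorem Pres.gw (hP : Pres σ C) (g h : G) : ∃ w, w.length = wordDist σ g h ∧ g * evalWord σ w = h ∧ GW σ w := by
  obtain ⟨w, h1, h2⟩ := hP.geo g h
  refine ⟨w, h1, h2, ?_⟩
  unfold GW
  rw [← hP.wd_ev g, h2, h1]

theorem GW.half (hP : Pres σ C) {w A e B r : Word S} (h : GW σ w) (hw : w = A ++ (e ++ B)) (hr : r ∈ C)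
    (he : e <+: r) : 2 * e.length ≤ r.length := by
  subst hw
  obtain ⟨y, rfl⟩ := he
  have h1 := hP.rel _ hr
  have := (h.infix hP).le (w' := wordInv y) (by
    rw [ev_append, ← eq_inv_iff_mul_eq_one] at h1; rw [h1]; simp)
  simp at this ⊢; omega

theorem GW.red (hP : Pres σ C) {w : Word S} (h : GW σ w) : ReducedWord w := by
  induction w with
  | nil => exact List.isChain_nil
  | cons a w ih =>
    have hw : GW σ w := GW.infix (A := [a]) (e := w) (B := []) hP (by simpa using h)
    by_contra hc
    obtain ⟨X, b, Y, h1, h2⟩ := red_strip (V := [a]) (w := w) (List.isChain_singleton _) (ih hw) hc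
    have hX : X = [] := by
      have := congrArg List.length h1
      simpa using this
    subst hX
    simp at h1
    subst h1; subst h2
    have := h.le (w' := Y) (by rw [ev_cons a, ev_cons (li a), ev_li]; simp)
    simp at this

theorem HV.of_gw (hP : Pres σ C) {w : Word S} (h : GW σ w) : HV C w := by
  rintro e ⟨A, B, hw⟩ r hr he
  have := h.half (A := A) (B := B) hP (by simp [← hw]) hr he
  omega

theorem LL (hP : Pres σ C) {cc n0 i0 : ℕ} (hcc : 1 ≤ cc) {w : Word S} (hw : ReducedWord w)
    (h : HW C cc n0 i0 w) (hi : i0 ≤ w.length) : i0 ≤ n0 + cc * wordDist σ 1 (evalWord σ w) := by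
  obtain ⟨v, h1, h2, h3⟩ := hP.gw 1 (evalWord σ w)
  have := LLaux hP hcc (n0 := n0) _ (wordInv v) [] w i0 le_rfl (red_inv (h3.red hP)) hw
    (by simp at h2 ⊢; rw [h2]; simp) (fun h => absurd rfl h) (HV.of_gw hP (h3.winv hP)) h hi
  rw [winv_length, h1] at this
  exact this

theorem N1 (hP : Pres σ C) {cc : ℕ} (hcc : 1 ≤ cc) {w : Word S} (hw : ReducedWord w)
    (h : ∀ A e B, w = A ++ (e ++ B) → ∀ r ∈ C, e <+: r → 9 * ((cc + 1) * e.length) ≤ 5 * (cc * r.length)) :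
    w.length ≤ cc * wordDist σ 1 (evalWord σ w) := by
  have := LL hP hcc (n0 := 0) (i0 := w.length) hw (fun A e B hw r hr he => Or.inl (h A e B hw r hr he)) le_rfl
  simpa using this

end P7

end MorseLTG

namespace MorseLTG

section P8
variable {S : Type*} {C : Set (Word S)} {G : Type*} [Group G] {σ : S → G}

/-- all overlaps at most half -/
def Half (C : Set (Word S)) (V : Word S) : Prop :=
  ∀ e, e <:+: V → ∀ r ∈ C, e <+: r → 2 * e.length ≤ r.length

theorem Half.of_gw (hP : Pres σ C) {w : Word S} (h : GW σ w) : Half C w := by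
  rintro e ⟨A, B, hw⟩ r hr he
  exact h.half (A := A) (B := B) hP (by simp [← hw]) hr he

theorem Half.infix {V W : Word S} (h : Half C W) (hi : V <:+: W) : Half C V :=
  fun e he => h e (he.trans hi)

theorem Half.sub (hC : SC C) {V A e B r : Word S} (h : Half C V) (hV : e <:+: V) (hr : r ∈ C)
    (he : r = A ++ (e ++ B)) : 2 * e.length ≤ r.length := by
  obtain ⟨r', hr', he', hl'⟩ := hC.sub hr he
  rw [← hl']; exact h e hV r' hr' he'

/-- position analysis -/
theorem POS (hC : SC C) {V f w X e Y r : Word S} (hF : Front C V f w) (hV : Half C V) (hw : Half C w)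
    (hXY : V ++ (f ++ w) = X ++ (e ++ Y)) (hr : r ∈ C) (her : e <+: r) :
    (3 * e.length ≤ 2 * r.length ∧ (20 * e.length ≤ 11 * r.length ∨ r.length ≤ 20 * f.length)) ∨
    ∃ e0 e2, e0 ≠ [] ∧ e2 ≠ [] ∧ V = X ++ e0 ∧ e = e0 ++ (f ++ e2) ∧ w = e2 ++ Y ∧
      9 * f.length ≤ r.length := by
  have hrp := hC.pos hr
  have herlen := her.length_le
  have hsp : (∃ t, X = V ++ t ∧ f ++ w = t ++ (e ++ Y)) ∨
      (∃ e0, e0 ≠ [] ∧ V = X ++ e0 ∧ e ++ Y = e0 ++ (f ++ w)) := by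
    rcases List.append_eq_append_iff.1 hXY with ⟨t, h1, h2⟩ | ⟨e0, h1, h2⟩
    · exact Or.inl ⟨t, h1, h2⟩
    · by_cases h0 : e0 = []
      · subst h0
        exact Or.inl ⟨[], by simp [h1], by simpa using h2.symm⟩
      · exact Or.inr ⟨e0, h0, h1, h2⟩
  rcases hsp with ⟨t, rfl, h2⟩ | ⟨e0, he0, rfl, h2⟩
  · left
    rcases List.append_eq_append_iff.1 h2 with ⟨A, rfl, h3⟩ | ⟨g, hg, h3⟩
    · have := hw e ⟨A, Y, by simp [h3]⟩ r hr her
      omega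
    · by_cases hg0 : g = []
      · subst hg0
        have := hw e ⟨[], Y, by simpa using h3⟩ r hr her
        omega
      have hfne : f ≠ [] := by rintro rfl; simp at hg; exact hg0 hg.2
      obtain ⟨-, z, hz, hz3, hzl, hzf⟩ := hF hfne
      have hρ : g ++ (z ++ t) ∈ C := by
        have := hC.rot t (g ++ z) (by simpa [hg] using hz)
        simpa using this
      obtain ⟨y, hy⟩ := her
      rcases List.append_eq_append_iff.1 h3 with ⟨e2', h4, h5⟩ | ⟨e2, h4, h5⟩
      · by_cases hee : e = []
        · subst hee; simp
        by_cases hh : r = e ++ (e2' ++ (z ++ t))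
        · subst hh; subst hg; subst h4; simp at hz3 ⊢; omega
        · have := hC.pc _ hr _ (by simpa [h4] using hρ) hh e hee ⟨y, hy⟩ ⟨_, rfl⟩
          omega
      · subst h4
        have key : r ≠ g ++ (z ++ t) ∨ e2 = [] := by
          by_contra hcon
          push Not at hcon
          obtain ⟨hh, he2⟩ := hcon
          rw [← hy] at hh
          simp at hh
          cases e2 with
          | nil => exact he2 rfl
          | cons b e2 =>
            cases z with
            | nil => simp at hz3; omega
            | cons b' z =>
              simp at hh
              exact (hzf b _ z h5 (by rw [hh.1])).elim
        have hgf := congrArg List.length hg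
        simp at hgf
        by_cases hh : r = g ++ (z ++ t)
        · have h0 : e2 = [] := by
            rcases key with h | h
            · exact absurd hh h
            · exact h
          subst h0
          have := congrArg List.length hh
          simp at this hz3 ⊢
          omega
        · have h9 := hC.pc _ hr _ hρ hh g hg0 ⟨e2 ++ y, by simp [← hy]⟩ ⟨_, rfl⟩
          have := hw.sub hC (A := g) (e := e2) (B := y) ⟨[], Y, by simp [h5]⟩ hr (by simp [← hy])
          simp; omega
  · rcases List.append_eq_append_iff.1 h2 with ⟨y0, h4, h5⟩ | ⟨e1, h4, h5⟩
    · have := hV e ⟨X, y0, by simp [h4]⟩ r hr her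
      omega
    subst h4
    obtain ⟨e0', a0, h0⟩ := last_of_ne he0
    obtain ⟨y, hy⟩ := her
    have h9 : 2 * e0.length ≤ r.length :=
      hV e0 ⟨X, [], by simp⟩ r hr ⟨e1 ++ y, by simp [← hy]⟩
    have hrot : e1 ++ (y ++ e0) ∈ C := by
      have := hC.rot e0 (e1 ++ y) (by simpa [← hy] using hr)
      simpa using this
    have hlen := congrArg List.length hy
    simp at hlen
    have hsp2 : (∃ f2, f = e1 ++ f2) ∨ (∃ e2, e2 ≠ [] ∧ e1 = f ++ e2 ∧ w = e2 ++ Y) := by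
      rcases List.append_eq_append_iff.1 h5 with ⟨t, h1, h2⟩ | ⟨t, h1, h2⟩
      · by_cases h0 : t = []
        · subst h0; exact Or.inl ⟨[], by simpa using h1.symm⟩
        · exact Or.inr ⟨t, h0, h1, h2⟩
      · exact Or.inl ⟨t, h1⟩
    rcases hsp2 with ⟨f2, hf2⟩ | ⟨e2, he2, hfe, hwe⟩
    · left
      by_cases he1 : e1 = []
      · subst he1; simp; omega
      have hfne : f ≠ [] := by rintro rfl; simp at hf2; exact he1 hf2.1
      have hfl := congrArg List.length hf2
      obtain ⟨-, z, hz, hz3, hzl, hzf⟩ := hF hfne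
      by_cases hh : e1 ++ (y ++ e0) = f ++ z
      · exfalso
        rw [hf2] at hh
        have hzne : z ≠ [] := by rintro rfl; simp at hz3; omega
        obtain ⟨z', b, hz'⟩ := last_of_ne hzne
        have : b = a0 := by
          subst h0; subst hz'
          rw [← List.append_assoc, ← List.append_assoc, ← List.append_assoc] at hh
          exact (List.cons.inj (List.append_inj_right' hh rfl)).1.symm
        subst this
        exact hzl (X ++ e0') b z' (by simp [h0]) hz'
      · have := hC.pc _ hrot _ hz hh e1 he1 ⟨_, rfl⟩ ⟨f2 ++ z, by simp [hf2]⟩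
        simp at this hfl ⊢; omega
    · right
      subst hfe
      refine ⟨e0, e2, he0, he2, rfl, rfl, hwe, ?_⟩
      by_cases hfne : f = []
      · subst hfne; simp
      obtain ⟨-, z, hz, hz3, hzl, hzf⟩ := hF hfne
      by_cases hh : (f ++ e2) ++ (y ++ e0) = f ++ z
      · exfalso
        simp at hh
        cases e2 with
        | nil => exact he2 rfl
        | cons b e2 => exact hzf b _ _ hwe hh.symm
      · have := hC.pc _ hrot _ hz hh f hfne ⟨e2 ++ (y ++ e0), by simp⟩ ⟨_, rfl⟩
        simp at this hlen; omega

/-- replacing a maximal bad exposure -/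
theorem Front.step (hC : SC C) {X e Y y : Word S} (hee : e ≠ []) (hT : ReducedWord (X ++ (e ++ Y)))
    (hr : e ++ y ∈ C) (hbad : 2 * (e ++ y).length < 3 * e.length)
    (hmax : ∀ X' e' Y', X ++ (e ++ Y) = X' ++ (e' ++ Y') → ∀ r' ∈ C, e' <+: r' →
        2 * r'.length < 3 * e'.length → e'.length ≤ e.length) : Front C X (wordInv y) Y := by
  intro hyne
  have hyne' : y ≠ [] := by simpa using hyne
  have hyr : ReducedWord y := (hC.red _ hr).right
  have hXr : ReducedWord X := hT.left
  have hYr : ReducedWord Y := hT.right.right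
  refine ⟨?_, wordInv e, ?_, ?_, ?_, ?_⟩
  · rw [← List.append_assoc]
    refine red_glue (red_glue hXr (red_inv hyr) ?_) hYr ?_
    · intro X' a Y' h1 h2
      rw [winv_eq_iff] at h2
      simp at h2
      have := hmax X' (a :: e) Y (by simp [h1])
        (a :: (e ++ wordInv Y')) (by
          have := hC.rot (e ++ wordInv Y') [a] (by simpa [h2] using hr)
          simpa using this) ⟨wordInv Y', by simp⟩ (by
          simp [h2] at hbad ⊢; omega)
      simp at this
    · intro X' a Y' h1 h2
      obtain ⟨y', b, hyb⟩ := last_of_ne hyne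
      rw [hyb, ← List.append_assoc] at h1
      have : b = a := (List.cons.inj (List.append_inj_right' h1 rfl)).1
      subst this
      rw [winv_eq_iff] at hyb
      simp at hyb
      have := hmax X (e ++ [li b]) Y' (by rw [h2]; simp)
        _ hr ⟨wordInv y', by rw [hyb]; simp⟩ (by
          simp at hbad ⊢; omega)
      simp at this
  · rw [← winv_append]; exact hC.inv _ hr
  · simp at hbad ⊢; omega
  · intro V' a z' h1 h2
    rw [winv_eq_iff] at h2
    rw [winv_append] at h2
    simp only [winv_cons, winv_nil, List.nil_append, List.singleton_append] at h2
    apply not_red_cancel (X := V') (a := a) (Y := wordInv z' ++ Y)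
    rw [h2, h1] at hT
    simpa using hT
  · intro b w' z' h1 h2
    rw [winv_eq_iff, winv_cons] at h2
    apply not_red_cancel (X := X ++ wordInv z') (a := li b) (Y := w')
    rw [h2, h1] at hT
    simpa using hT

/-- nearest point condition -/
def NP (σ : S → G) (A g : Word S) : Prop :=
  ∀ A1 A2 g1 g2, A = A1 ++ A2 → g = g1 ++ g2 → ∀ u, evalWord σ u = evalWord σ (A2 ++ g1) →
    A2.length ≤ u.length

def Tame (C : Set (Word S)) (K : ℕ → ℕ) (w : Word S) : Prop :=
  ∀ e, e <:+: w → ∀ r ∈ C, e <+: r → ∀ n, 3 ≤ n → r.length ≤ n * e.length → r.length ≤ K n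

theorem CLaux (hP : Pres σ C) {A g : Word S} {K : ℕ → ℕ} (hA : GW σ A) (hg : GW σ g) (hN : NP σ A g)
    (hK : Tame C K g) : ∀ (L : ℕ) (A' f B' h1 h2 : Word S), A'.length + B'.length ≤ L →
    A = A' ++ h1 → g = h2 ++ B' → evalWord σ f = evalWord σ (h1 ++ h2) →
    ReducedWord (A' ++ (f ++ B')) → Front C A' f B' → 3 * f.length ≤ K 20 →
    ∃ A' f B' h1 h2, A = A' ++ h1 ∧ g = h2 ++ B' ∧ evalWord σ f = evalWord σ (h1 ++ h2) ∧
      h1.length ≤ K 20 ∧ h2.length ≤ K 20 ∧ f.length ≤ K 20 ∧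
      ReducedWord (A' ++ (f ++ B')) ∧
      ∀ X e Y, A' ++ (f ++ B') = X ++ (e ++ Y) → ∀ r ∈ C, e <+: r →
        3 * e.length ≤ 2 * r.length ∧ (20 * e.length ≤ 11 * r.length ∨ r.length ≤ 20 * K 20) := by
  have hC := hP.sc
  intro L
  induction L with
  | zero =>
    intro A' f B' h1 h2 hL hA1 hg1 hf hred hF hfK
    have h01 : A' = [] := List.length_eq_zero_iff.1 (by omega)
    have h02 : B' = [] := List.length_eq_zero_iff.1 (by omega)
    have h3 : h1.length ≤ f.length := hN A' h1 h2 B' hA1 hg1 f hf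
    have h4 : h2.length ≤ h1.length + f.length := by
      have : GW σ h2 := GW.infix (A := []) (B := B') hP (by simpa [← hg1] using hg)
      have := this.le (w' := wordInv h1 ++ f) (by simp [hf])
      simpa using this
    refine ⟨A', f, B', h1, h2, hA1, hg1, hf, by omega, by omega, by omega, hred, ?_⟩
    intro X e Y hXY r hr her
    rcases POS hC hF (by subst h01; exact Half.infix (Half.of_gw hP hA) ⟨[], A, by simp⟩)
      (by subst h02; exact Half.infix (Half.of_gw hP hA) ⟨[], A, by simp⟩) hXY hr her with h | h
    · omega
    · obtain ⟨e0, e2, he0, he2, h5, h6, h7, h8⟩ := h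
      subst h01
      simp at h5; exact absurd h5.2 he0
  | succ L ih =>
    intro A' f B' h1 h2 hL hA1 hg1 hf hred hF hfK
    have hAh : Half C A' := Half.infix (Half.of_gw hP hA) ⟨[], h1, by simp [hA1]⟩
    have hBh : Half C B' := Half.infix (Half.of_gw hP hg) ⟨h2, [], by simp [hg1]⟩
    -- main case facts
    have hmain : ∀ X e Y r, A' ++ (f ++ B') = X ++ (e ++ Y) → r ∈ C → e <+: r →
       ((3 * e.length ≤ 2 * r.length) ∧ (20 * e.length ≤ 11 * r.length ∨ r.length ≤ 20 * K 20)) ∨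
       ∃ e0 e2 y, e0 ≠ [] ∧ e2 ≠ [] ∧ A' = X ++ e0 ∧ e = e0 ++ (f ++ e2) ∧ B' = e2 ++ Y ∧
        r = e ++ y ∧ r.length ≤ K 20 ∧ 2 * r.length < 3 * e.length := by
      intro X e Y r hXY hr her
      rcases POS hC hF hAh hBh hXY hr her with h | ⟨e0, e2, he0, he2, h5, h6, h7, h8⟩
      · left; omega
      obtain ⟨y, hy⟩ := her
      have hnp : (e0 ++ h1).length ≤ (wordInv y).length := by
        refine hN X (e0 ++ h1) (h2 ++ e2) Y (by simp [hA1, h5]) (by simp [hg1, h7]) _ ?_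
        have h9 := hP.rel r hr
        rw [← hy, ev_append, ← inv_eq_iff_mul_eq_one, inv_eq_iff_eq_inv] at h9
        rw [ev_winv, ← h9, h6]
        simp only [ev_append, hf, mul_assoc]
      have hlen := congrArg List.length hy
      have hel := congrArg List.length h6
      simp at hnp hlen hel
      have htm : r.length ≤ 20 * e2.length → r.length ≤ K 20 := by
        intro h20
        obtain ⟨r', hr', he', hl'⟩ := hC.sub (A := e0 ++ f) (e := e2) (B := y) hr (by simp [← hy, h6])
        have := hK e2 ⟨h2, Y, by simp [hg1, h7]⟩ r' hr' he' 20 (by norm_num) (by omega)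
        omega
      by_cases hbad : 2 * r.length < 3 * e.length
      · right
        exact ⟨e0, e2, y, he0, he2, h5, h6, h7, hy.symm, htm (by omega), hbad⟩
      · left
        refine ⟨by omega, ?_⟩
        by_cases h20 : 20 * e.length ≤ 11 * r.length
        · exact Or.inl h20
        · right
          by_cases hff : r.length ≤ 20 * f.length
          · omega
          · have := htm (by omega)
            omega
    by_cases hex : ∃ X e Y, A' ++ (f ++ B') = X ++ (e ++ Y) ∧ ∃ r ∈ C, e <+: r ∧
        2 * r.length < 3 * e.length
    · obtain ⟨n, ⟨X, e, Y, hXY, r, hr, her, hbad, rfl⟩, hm⟩ := nat_max (P := fun n => ∃ X e Y,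
        A' ++ (f ++ B') = X ++ (e ++ Y) ∧ ∃ r ∈ C, e <+: r ∧ 2 * r.length < 3 * e.length ∧
          e.length = n) (B := (A' ++ (f ++ B')).length)
        (by
          obtain ⟨X, e, Y, h1, r, hr, h2, h3⟩ := hex
          exact ⟨_, X, e, Y, h1, r, hr, h2, h3, rfl⟩)
        (by
          rintro n ⟨X, e, Y, h1, r, hr, h2, h3, rfl⟩
          rw [h1]; simp; omega)
      rcases hmain X e Y r hXY hr her with h | ⟨e0, e2, y, he0, he2, h5, h6, h7, h8, h9, -⟩
      · omega
      subst h8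
      rw [hXY] at hm hred
      have hF' := Front.step hC (by rw [h6]; simp [he0]) hred hr hbad (fun X' e' Y' h1' r' hr' h2' h3' =>
        hm _ ⟨X', e', Y', h1', r', hr', h2', h3', rfl⟩)
      have hevy : evalWord σ (wordInv y) = evalWord σ e := by
        have h9 := hP.rel _ hr
        rw [ev_append, ← inv_eq_iff_mul_eq_one, inv_eq_iff_eq_inv] at h9
        rw [ev_winv, ← h9]
      have hevf : evalWord σ (wordInv y) = evalWord σ ((e0 ++ h1) ++ (h2 ++ e2)) := by
        rw [hevy, h6]; simp only [ev_append, hf, mul_assoc]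
      have hpos := List.length_pos_iff.2 he0
      refine ih X (wordInv y) Y (e0 ++ h1) (h2 ++ e2) ?_ (by simp [hA1, h5]) (by simp [hg1, h7])
        hevf ?_ hF' ?_
      · rw [h5, h7] at hL; simp at hL; omega
      · by_cases hy : wordInv y = []
        · exfalso
          have := hN X (e0 ++ h1) (h2 ++ e2) Y (by simp [hA1, h5]) (by simp [hg1, h7]) _ hevf
          rw [hy] at this
          simp at this
          exact he0 this.1
        · exact (hF' hy).1
      · simp at hbad h9 ⊢; omega
    · have h3 : h1.length ≤ f.length := hN A' h1 h2 B' hA1 hg1 f hf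
      have h4 : h2.length ≤ h1.length + f.length := by
        have : GW σ h2 := GW.infix (A := []) (B := B') hP (by simpa [← hg1] using hg)
        have := this.le (w' := wordInv h1 ++ f) (by simp [hf])
        simpa using this
      refine ⟨A', f, B', h1, h2, hA1, hg1, hf, by omega, by omega, by omega, hred, ?_⟩
      intro X e Y hXY r hr her
      rcases hmain X e Y r hXY hr her with h | ⟨e0, e2, y, -, -, -, -, -, -, -, hb⟩
      · exact h
      · exact absurd ⟨X, e, Y, hXY, r, hr, her, hb⟩ hex

theorem CL (hP : Pres σ C) {A g : Word S} {K : ℕ → ℕ} (hA : GW σ A) (hg : GW σ g) (hN : NP σ A g)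
    (hK : Tame C K g) : 
    ∃ A' f B' h1 h2, A = A' ++ h1 ∧ g = h2 ++ B' ∧ evalWord σ f = evalWord σ (h1 ++ h2) ∧
      h1.length ≤ K 20 ∧ h2.length ≤ K 20 ∧ f.length ≤ K 20 ∧
      ReducedWord (A' ++ (f ++ B')) ∧
      ∀ X e Y, A' ++ (f ++ B') = X ++ (e ++ Y) → ∀ r ∈ C, e <+: r →
        3 * e.length ≤ 2 * r.length ∧ (20 * e.length ≤ 11 * r.length ∨ r.length ≤ 20 * K 20) := by
  refine CLaux hP hA hg hN hK _ A [] g [] [] le_rfl (by simp) (by simp) (by simp) ?_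
    (fun h => absurd rfl h) (by simp)
  refine red_glue (hA.red hP) (hg.red hP) ?_
  intro X a Y h1 h2
  have := hN X [a] [li a] Y h1 (by simpa using h2) [] (by rw [ev_append, ev_li]; simp)
  simp at this

end P8

end MorseLTG

namespace MorseLTG

section P9
variable {S : Type*} {C : Set (Word S)} {G : Type*} [Group G] {σ : S → G}

theorem SC.inv_pre (hC : SC C) {e r : Word S} (hr : r ∈ C) (he : e <+: r) :
    ∃ r' ∈ C, wordInv e <+: r' ∧ r'.length = r.length := by
  obtain ⟨y, rfl⟩ := he
  have := hC.inv _ hr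
  rw [winv_append] at this
  exact ⟨_, hC.rot _ _ this, ⟨_, rfl⟩, by simp⟩

theorem winv_infix {e w : Word S} (h : e <:+: wordInv w) : wordInv e <:+: w := by
  obtain ⟨A, B, h⟩ := h
  have := congrArg wordInv h
  simp at this
  exact ⟨wordInv B, wordInv A, by simp [← this]⟩

theorem Tame.winv (hC : SC C) {K : ℕ → ℕ} {w : Word S} (h : Tame C K w) : Tame C K (wordInv w) := by
  intro e he r hr her n hn hl
  obtain ⟨r', hr', he', hl'⟩ := hC.inv_pre hr her
  rw [← hl'] at hl ⊢
  exact h _ (winv_infix he) r' hr' he' n hn (by simpa using hl)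

theorem Tame.infix {K : ℕ → ℕ} {w v : Word S} (h : Tame C K w) (hv : v <:+: w) : Tame C K v :=
  fun e he => h e (he.trans hv)

theorem tri {α : Type*} {L g R X e Y : List α} (h : L ++ (g ++ R) = X ++ (e ++ Y)) :
    (∃ Y', L ++ g = X ++ (e ++ Y')) ∨ (∃ X', X = L ++ X' ∧ g ++ R = X' ++ (e ++ Y)) ∨ g <:+: e := by
  rcases List.append_eq_append_iff.1 h with ⟨t, h1, h2⟩ | ⟨t, h1, h2⟩
  · exact Or.inr (Or.inl ⟨t, h1, h2⟩)
  · rw [← List.append_assoc] at h2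
    rcases List.append_eq_append_iff.1 h2 with ⟨u, h3, h4⟩ | ⟨u, h3, h4⟩
    · left
      exact ⟨u, by rw [h1, List.append_assoc, h3]⟩
    · right; right
      exact ⟨t, u, by rw [h3]⟩

theorem red_join {X g Y : Word S} (hg : g ≠ []) (h1 : ReducedWord (X ++ g)) (h2 : ReducedWord (g ++ Y)) :
    ReducedWord (X ++ (g ++ Y)) := by
  refine red_glue h1.left h2 ?_
  intro X' a Y' h3 h4
  cases g with
  | nil => exact hg rfl
  | cons b g =>
    simp at h4
    obtain ⟨rfl, h4⟩ := h4
    subst h3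
    exact not_red_cancel (X := X') (a := a) (Y := g) (by simpa using h1)

theorem CO (hP : Pres σ C) {A g A2 : Word S} {K : ℕ → ℕ} (hA : GW σ A) (hg : GW σ g) (hA2 : GW σ A2)
    (hN : NP σ A g) (hN2 : NP σ (wordInv A2) (wordInv g)) (hK : Tame C K g) {n : ℕ} (hn : 100 ≤ n)
    (hh : 50 * K 20 < A.length) (hd : 200 * wordDist σ 1 (evalWord σ (A ++ (g ++ A2))) ≤ A.length)
    (hh2 : 2 * A2.length ≤ 3 * A.length) :
    n * g.length ≤ n * (2 * K 20 + 1 + K n) + 6 * A.length := by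
  have hC := hP.sc
  by_contra hcon
  push Not at hcon
  have hgl : 2 * K 20 + 1 + K n < g.length := by
    by_contra hc
    push Not at hc
    have := Nat.mul_le_mul_left n hc
    omega
  obtain ⟨A', f, B', h1, h2, hA1, hg1, hf, hl1, hl2, hlf, hred, hov⟩ := CL hP hA hg hN hK
  obtain ⟨A2i, f2, B2i, k1, k2, hAk, hgk, hfk, hlk1, hlk2, hlfk, hredk, hovk⟩ :=
    CL hP (hA2.winv hP) (hg.winv hP) hN2 (hK.winv hC)
  have hA2' : A2 = wordInv k1 ++ wordInv A2i := by
    have := congrArg wordInv hAk; simpa using this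
  have hg2 : g = wordInv B2i ++ wordInv k2 := by
    have := congrArg wordInv hgk; simpa using this
  obtain ⟨g', hB', hBi⟩ : ∃ g', B' = g' ++ wordInv k2 ∧ wordInv B2i = h2 ++ g' := by
    rcases List.append_eq_append_iff.1 (hg1.symm.trans hg2) with ⟨t, h3, h4⟩ | ⟨t, h3, h4⟩
    · exact ⟨t, h4, h3⟩
    · have e1 := congrArg List.length h3
      have e2 := congrArg List.length hg2
      simp at e1 e2; omega
  have hgl' : g.length = h2.length + g'.length + k2.length := by
    have := congrArg List.length hg1
    have := congrArg List.length hB'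
    simp at *; omega
  have hKn : K n < g'.length := by omega
  have hng : 6 * A.length < n * g'.length := by
    have h3 : g.length ≤ 2 * K 20 + g'.length := by omega
    have := Nat.mul_le_mul_left n h3
    have h4 : n * (2 * K 20 + 1 + K n) = n * (2 * K 20) + n * (1 + K n) := by ring
    rw [h4] at hcon
    rw [Nat.mul_add] at this
    omega
  have hg'ne : g' ≠ [] := by rintro rfl; simp at hng
  have hg'inf : g' <:+: g := ⟨h2, wordInv k2, by rw [hg1, hB']; simp⟩
  set R := wordInv f2 ++ wordInv A2i with hR
  have hredL : ReducedWord ((A' ++ f) ++ g') := by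
    rw [hB', ← List.append_assoc, ← List.append_assoc] at hred; exact hred.left
  have hredR : ReducedWord (g' ++ R) := by
    have := red_inv hredk
    rw [winv_append, winv_append, hBi, List.append_assoc, List.append_assoc] at this
    exact this.right
  have hLL := LL hP (cc := 100) (n0 := 20 * K 20) (i0 := A'.length) (w := (A' ++ f) ++ (g' ++ R)) (by norm_num)
    (red_join hg'ne hredL hredR) (by
      intro X e Y hXY r hr her
      rcases tri hXY with ⟨Y', h3⟩ | ⟨X', h3, h4⟩ | h3
      · obtain ⟨h5, h6⟩ := hov X e (Y' ++ wordInv k2) (by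
          rw [hB', ← List.append_assoc, ← List.append_assoc, h3]; simp) r hr her
        rcases h6 with h6 | h6
        · left; omega
        · by_cases h7 : A'.length < X.length + e.length
          · exact Or.inr ⟨h5, h7, h6⟩
          · left
            have : e <:+: A' := by
              have : X ++ e <+: A' := by
                apply List.prefix_of_prefix_length_le (l₃ := (A' ++ f) ++ g')
                · exact ⟨Y', by rw [h3]; simp⟩
                · exact ⟨f ++ g', by simp⟩
                · simp; omega
              obtain ⟨t, ht⟩ := this
              exact ⟨X, t, by rw [← ht]⟩
            have := Half.of_gw hP hA e (this.trans ⟨[], h1, by simp [hA1]⟩) r hr her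
            omega
      · by_cases he0 : e = []
        · subst he0; left; simp
        have hpos := List.length_pos_iff.2 he0
        obtain ⟨r', hr', he', hl'⟩ := hC.inv_pre hr her
        obtain ⟨h5, h6⟩ := hovk (wordInv Y) (wordInv e) (wordInv (h2 ++ X')) (by
          have : wordInv (A2i ++ (f2 ++ B2i)) = wordInv (wordInv Y ++ (wordInv e ++ wordInv (h2 ++ X'))) := by
            simp only [winv_append, winv_winv, hBi, List.append_assoc]
            rw [← h4]
          have := congrArg wordInv this
          simpa using this) r' hr' he'
        rw [hl', winv_length] at h5 h6
        rcases h6 with h6 | h6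
        · left; omega
        · right; subst h3; simp; omega
      · left
        have hle := her.length_le
        have hgle := h3.length_le
        have hr' : n * g'.length < r.length := by
          by_contra hc
          push Not at hc
          obtain ⟨P, Q, hPQ⟩ := h3
          obtain ⟨y, hy⟩ := her
          obtain ⟨r', hr', he', hl'⟩ := hC.sub (A := P) (e := g') (B := Q ++ y) hr (by
            rw [← hy, ← hPQ]; simp)
          have := hK g' hg'inf r' hr' he' n (by omega) (by omega)
          omega
        have hlen := congrArg List.length hXY
        have e1 := congrArg List.length hA1
        have e2 := congrArg List.length hA2'
        have : 100 * g'.length ≤ n * g'.length := Nat.mul_le_mul_right _ hn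
        simp [hR] at hlen e1 e2
        omega) (by simp)
  have hev : evalWord σ ((A' ++ f) ++ (g' ++ R)) = evalWord σ (A ++ (g ++ A2)) := by
    rw [hA1, hg1, hB', hA2', hR]
    simp only [ev_append, ev_winv, hf, hfk]
    group
  rw [hev] at hLL
  have := congrArg List.length hA1
  simp at this
  omega

end P9

end MorseLTG

namespace MorseLTG

section P10
variable {S : Type*} {C : Set (Word S)} {G : Type*} [Group G] {σ : S → G}

def QG (σ : S → G) (A B : ℕ) (I : Set ℤ) (p : ℤ → G) : Prop :=
  DIsPath σ I p ∧ ∀ m ∈ I, ∀ n ∈ I, m ≤ n → n - m ≤ A * (wordDist σ (p m) (p n) : ℤ) + B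

def MO (σ : S → G) (D : ℕ → ℕ) (I : Set ℤ) (p : ℤ → G) : Prop :=
  ∀ N : ℕ, ∀ s ∈ I, ∀ t ∈ I, s ≤ t → ∀ (q : ℤ → G) (a b : ℤ), a ≤ b → QG σ N N (Set.Icc a b) q →
    q a = p s → q b = p t → ∀ n ∈ Set.Icc a b, ∃ m ∈ Set.Icc s t, wordDist σ (q n) (p m) ≤ D N

theorem QG.mono {A B A' B' : ℕ} {I : Set ℤ} {p : ℤ → G} (h : QG σ A B I p) (hA : A ≤ A') (hB : B ≤ B') :
    QG σ A' B' I p := by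
  refine ⟨h.1, fun m hm n hn hmn => ?_⟩
  have h1 := h.2 m hm n hn hmn
  have h2 : (A : ℤ) * (wordDist σ (p m) (p n) : ℤ) ≤ A' * (wordDist σ (p m) (p n) : ℤ) :=
    mul_le_mul_of_nonneg_right (by exact_mod_cast hA) (by positivity)
  have h3 : (B : ℤ) ≤ B' := by exact_mod_cast hB
  linarith

theorem relHalf (hP : Pres σ C) {u v : Word S} (h : u ++ v ∈ C) (h2 : 2 * u.length ≤ (u ++ v).length) :
    u.length ≤ 100 * wordDist σ 1 (evalWord σ u) := by
  have hC := hP.sc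
  refine N1 hP (by norm_num) (hC.red _ h).left ?_
  intro A e B hu r hr her
  by_cases he : e = []
  · subst he; simp
  have hρ : e ++ (B ++ v ++ A) ∈ C := by
    have := hC.rot A (e ++ B ++ v) (by simpa [hu] using h)
    simpa using this
  by_cases hh : r = e ++ (B ++ v ++ A)
  · subst hh; subst hu; simp at h2 ⊢; omega
  · have := hC.pc _ hr _ hρ hh e he her ⟨_, rfl⟩
    omega

theorem relPt (hP : Pres σ C) {r : Word S} (h : r ∈ C) {j k : ℕ} (hjk : j ≤ k) (hk : k ≤ r.length) (g : G) :
    k - j ≤ 100 * wordDist σ (g * evalWord σ (r.take j)) (g * evalWord σ (r.take k)) ∨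
    r.length - (k - j) ≤ 100 * wordDist σ (g * evalWord σ (r.take j)) (g * evalWord σ (r.take k)) := by
  have hC := hP.sc
  obtain ⟨X, u, Y, hX, hu, hr⟩ : ∃ X u Y, r.take j = X ∧ r.take k = X ++ u ∧ r = X ++ (u ++ Y) := by
    refine ⟨_, (r.take k).drop j, r.drop k, rfl, ?_, ?_⟩
    · have := List.take_append_drop j (r.take k)
      rw [List.take_take, min_eq_left hjk] at this
      exact this.symm
    · have := List.take_append_drop j (r.take k)
      rw [List.take_take, min_eq_left hjk] at this
      rw [← List.append_assoc, this, List.take_append_drop]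
  have hj : j = X.length := by rw [← hX]; simp; omega
  have hk' : k = X.length + u.length := by rw [← List.length_append, ← hu]; simp; omega
  rw [hX, hu, ev_append, ← mul_assoc, hP.wd_ev]
  have hlen := congrArg List.length hr
  simp at hlen
  have hrot : u ++ (Y ++ X) ∈ C := by
    have := hC.rot X (u ++ Y) (by rw [← hr]; exact h)
    simpa using this
  by_cases h2 : 2 * u.length ≤ r.length
  · left
    have := relHalf hP hrot (by simp; omega)
    omega
  · right
    have h3 := relHalf hP (hC.rot _ _ hrot) (by simp; omega)
    have h4 := hP.rel _ hrot
    rw [ev_append, ← inv_eq_iff_mul_eq_one] at h4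
    rw [← h4] at h3
    have h5 := hP.wd_left (evalWord σ u) 1 (evalWord σ u)⁻¹
    rw [mul_one, mul_inv_cancel, hP.wd_comm] at h5
    rw [← h5] at h3
    simp at h3
    omega

theorem wd_take (g : G) (w : Word S) (j : ℕ) :
    wordDist σ (g * evalWord σ (w.take j)) (g * evalWord σ (w.take (j+1))) ≤ 1 := by
  by_cases h : j < w.length
  · have : g * evalWord σ (w.take j) * evalWord σ [w[j]] = g * evalWord σ (w.take (j+1)) := by
      rw [List.take_succ_eq_append_getElem h, ev_append, mul_assoc]
    have := wd_le this
    simpa using this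
  · rw [List.take_of_length_le (by omega), List.take_of_length_le (by omega)]
    simp

theorem T3 (hP : Pres σ C) {D : ℕ → ℕ} {I : Set ℤ} {p : ℤ → G} (hM : MO σ D I p) {i : ℤ} {x r : Word S}
    (hI : ∀ j : ℕ, j ≤ x.length → i + j ∈ I)
    (hF : ∀ j : ℕ, j ≤ x.length → p (i + j) = p i * evalWord σ (x.take j))
    (hr : r ∈ C) (hx : x <+: r) {n : ℕ} (hn : 3 ≤ n) (hl : r.length ≤ n * x.length) :
    r.length ≤ 400 * D (100 * n) + 8 := by
  by_cases h2 : r.length ≤ 2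
  · omega
  set m := min x.length (r.length / 2) with hm
  have hmx : m ≤ x.length := min_le_left _ _
  have hm2 : 2 * m ≤ r.length := by omega
  have hmn : r.length ≤ n * m := by
    rcases min_choice x.length (r.length / 2) with h | h
    · rw [hm, h]; exact hl
    · rw [hm, h]
      have : 3 * (r.length / 2) ≤ n * (r.length / 2) := Nat.mul_le_mul_right _ hn
      omega
  have hxt : ∀ j ≤ m, x.take j = r.take j := by
    intro j hj
    obtain ⟨y, rfl⟩ := hx
    rw [List.take_append_of_le_length (by omega)]
  have hpr : ∀ j : ℕ, j ≤ m → p (i + j) = p i * evalWord σ (r.take j) := by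
    intro j hj
    rw [hF j (by omega), hxt j hj]
  have hrl := hx.length_le
  have hnat : ∀ z : ℤ, 0 ≤ z → ((r.length : ℤ) - z).toNat = r.length - z.toNat := by intro z hz; omega
  set q : ℤ → G := fun z => p i * evalWord σ (r.take ((r.length : ℤ) - z).toNat) with hq
  obtain ⟨k, ⟨hk1, hk2⟩, hk⟩ := hM (100 * n) i (by simpa using hI 0 (by omega)) (i + m) (hI m hmx) (by omega)
    q 0 (r.length - m) (by omega) (by
      refine ⟨?_, ?_⟩
      · rintro z ⟨hz1, hz2⟩ ⟨hz3, hz4⟩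
        have h3 := wd_take (σ := σ) (p i) r (r.length - z.toNat - 1)
        rw [hP.wd_comm]
        simp only [hq]
        rw [show ((r.length : ℤ) - z).toNat = r.length - z.toNat - 1 + 1 by omega,
          show ((r.length : ℤ) - (z+1)).toNat = r.length - z.toNat - 1 by omega]
        exact h3
      · rintro z ⟨hz1, hz2⟩ z' ⟨hz3, hz4⟩ hzz
        have h3 := relPt hP hr (j := r.length - z'.toNat) (k := r.length - z.toNat) (by omega) (by omega) (p i)
        rw [hP.wd_comm]
        simp only [hq]
        rw [hnat z hz1, hnat z' hz3]
        set d := wordDist σ (p i * evalWord σ (r.take (r.length - z'.toNat)))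
          (p i * evalWord σ (r.take (r.length - z.toNat)))
        have h4 : (z' - z).toNat ≤ 100 * n * d := by
          rcases h3 with h3 | h3
          · have : 1 * d ≤ n * d := Nat.mul_le_mul_right _ (by omega)
            have h5 : 100 * n * d = 100 * (n * d) := by ring
            omega
          · have h5 : n * m ≤ n * (100 * d) := Nat.mul_le_mul_left _ (by omega)
            have h6 : 100 * n * d = n * (100 * d) := by ring
            omega
        have : (z' - z) = ((z' - z).toNat : ℤ) := by omega
        rw [this]
        have : ((100 * n : ℕ) : ℤ) * d + (100 * n : ℕ) = ((100 * n * d + 100 * n : ℕ) : ℤ) := by push_cast; ring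
        rw [this]
        exact_mod_cast (by omega : (z' - z).toNat ≤ 100 * n * d + 100 * n)) 
    (by
      simp only [hq]
      rw [show ((r.length : ℤ) - 0).toNat = r.length by omega, List.take_length, hP.rel r hr]; simp)
    (by
      simp only [hq]
      rw [show ((r.length : ℤ) - (r.length - m)).toNat = m by omega, hpr m le_rfl])
    (((r.length - m)/2 : ℕ) : ℤ) ⟨by omega, by omega⟩
  obtain ⟨c, rfl⟩ : ∃ c : ℕ, k = i + c := ⟨(k - i).toNat, by omega⟩
  rw [hpr c (by omega)] at hk
  simp only [hq] at hk
  rw [hnat _ (by omega), hP.wd_comm] at hk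
  have := relPt hP hr (j := c) (k := r.length - (((r.length - m)/2 : ℕ) : ℤ).toNat) (by omega) (by omega) (p i)
  omega

end P10

end MorseLTG

namespace MorseLTG

section P11
variable {S : Type*} {C : Set (Word S)} {G : Type*} [Group G] {σ : S → G}

theorem path_le (hP : Pres σ C) {a b : ℤ} {q : ℤ → G} (hq : DIsPath σ (Set.Icc a b) q) {c d : ℤ}
    (hc : a ≤ c) (hcd : c ≤ d) (hd : d ≤ b) : (wordDist σ (q c) (q d) : ℤ) ≤ d - c := by
  obtain ⟨k, rfl⟩ : ∃ k : ℕ, d = c + k := ⟨(d - c).toNat, by omega⟩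
  induction k with
  | zero => simp
  | succ k ih =>
    have h1 := ih (by omega) (by push_cast at hd; omega)
    have h2 := hq (c + k) ⟨by omega, by push_cast at hd; omega⟩ ⟨by omega, by push_cast at hd; omega⟩
    have h3 := hP.wd_tri (q c) (q (c + k)) (q (c + (k + 1 : ℕ)))
    push_cast at h3 ⊢
    rw [← add_assoc] at h3 ⊢
    omega

theorem np_gen (hP : Pres σ C) {x g : G} {w A s : Word S}
    (hA : ∀ j, j ≤ w.length → A.length ≤ wordDist σ x (g * evalWord σ (w.take j)))
    (hs : ∀ g1 g2, s = g1 ++ g2 → ∃ j ≤ w.length, x * evalWord σ A * evalWord σ g1 = g * evalWord σ (w.take j)) :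
    NP σ A s := by
  intro A1 A2 g1 g2 h1 h2 u hu
  obtain ⟨j, hj, h3⟩ := hs g1 g2 h2
  have h4 := hA j hj
  have h5 : wordDist σ x (g * evalWord σ (w.take j)) ≤ (A1 ++ u).length := by
    refine wd_le ?_
    rw [← h3, h1, ev_append, hu]
    simp only [ev_append, mul_assoc]
  rw [h1] at h4
  simp at h4 h5
  omega

/-- contraction, abstract form -/
theorem ct_aux (hP : Pres σ C) {K : ℕ → ℕ} {x y g : G} {w s : Word S} {i j : ℕ} {n : ℕ} (hn : 100 ≤ n)
    (hx : ∀ k, k ≤ w.length → wordDist σ x (g * evalWord σ (w.take i)) ≤ wordDist σ x (g * evalWord σ (w.take k)))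
    (hy : ∀ k, k ≤ w.length → wordDist σ y (g * evalWord σ (w.take j)) ≤ wordDist σ y (g * evalWord σ (w.take k)))
    (hi : i ≤ w.length)
    (hs : GW σ s) (hK : Tame C K s)
    (hij : g * evalWord σ (w.take i) * evalWord σ s = g * evalWord σ (w.take j))
    (h1 : ∀ g1 g2, s = g1 ++ g2 → ∃ k ≤ w.length, g * evalWord σ (w.take i) * evalWord σ g1 = g * evalWord σ (w.take k))
    (h2 : ∀ g1 g2, wordInv s = g1 ++ g2 →
      ∃ k ≤ w.length, g * evalWord σ (w.take j) * evalWord σ g1 = g * evalWord σ (w.take k))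
    (hh : 50 * K 20 < wordDist σ x (g * evalWord σ (w.take i)))
    (hd : 200 * wordDist σ x y ≤ wordDist σ x (g * evalWord σ (w.take i))) :
    n * s.length ≤ n * (2 * K 20 + 1 + K n) + 6 * wordDist σ x (g * evalWord σ (w.take i)) := by
  obtain ⟨A, hA1, hA2, hA3⟩ := hP.gw x (g * evalWord σ (w.take i))
  obtain ⟨B, hB1, hB2, hB3⟩ := hP.gw y (g * evalWord σ (w.take j))
  have hev : x * evalWord σ (A ++ (s ++ wordInv B)) = y := by
    rw [ev_append, ← mul_assoc, hA2, ev_append, ← mul_assoc, hij, ← hB2]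
    simp
  have hyx : wordDist σ y (g * evalWord σ (w.take j)) ≤ wordDist σ x y + wordDist σ x (g * evalWord σ (w.take i)) := by
    refine (hy i hi).trans ?_
    rw [hP.wd_comm x y]
    exact hP.wd_tri _ _ _
  have := CO hP (A := A) (g := s) (A2 := wordInv B) (n := n) hA3 hs (hB3.winv hP)
    (np_gen hP (x := x) (g := g) (w := w) (by intro k hk; rw [hA1]; exact hx k hk) (by rw [hA2]; exact h1))
    (by
      rw [winv_winv]
      exact np_gen hP (x := y) (g := g) (w := w) (by intro k hk; rw [hB1]; exact hy k hk) (by rw [hB2]; exact h2))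
    hK hn (by omega) (by rw [← hP.wd_ev x, hev]; omega) (by simp; omega)
  rw [hA1] at this
  exact this

theorem split_seg (w : Word S) {i j : ℕ} (hij : i ≤ j) (hj : j ≤ w.length) :
    ∃ U s V, w = U ++ (s ++ V) ∧ U.length = i ∧ s.length = j - i ∧ w.take i = U ∧ w.take j = U ++ s := by
  refine ⟨w.take i, (w.take j).drop i, w.drop j, ?_, by simp; omega, by simp; omega, rfl, ?_⟩
  · have := List.take_append_drop i (w.take j)
    rw [List.take_take, min_eq_left hij] at this
    rw [← List.append_assoc, this, List.take_append_drop]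
  · have := List.take_append_drop i (w.take j)
    rw [List.take_take, min_eq_left hij] at this
    exact this.symm

theorem ct (hP : Pres σ C) {K : ℕ → ℕ} {x y g : G} {w : Word S} (hw : GW σ w) (hK : Tame C K w)
    {i j : ℕ} {n : ℕ} (hn : 100 ≤ n)
    (hx : ∀ k, k ≤ w.length → wordDist σ x (g * evalWord σ (w.take i)) ≤ wordDist σ x (g * evalWord σ (w.take k)))
    (hy : ∀ k, k ≤ w.length → wordDist σ y (g * evalWord σ (w.take j)) ≤ wordDist σ y (g * evalWord σ (w.take k)))
    (hi : i ≤ w.length) (hj : j ≤ w.length)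
    (hh : 50 * K 20 < wordDist σ x (g * evalWord σ (w.take i)))
    (hd : 200 * wordDist σ x y ≤ wordDist σ x (g * evalWord σ (w.take i))) :
    (n : ℤ) * |(i : ℤ) - j| ≤ n * (2 * K 20 + 1 + K n) + 6 * wordDist σ x (g * evalWord σ (w.take i)) := by
  have key : ∀ i j : ℕ, i ≤ j → j ≤ w.length → ∃ s, s.length = j - i ∧ GW σ s ∧ Tame C K s ∧
      g * evalWord σ (w.take i) * evalWord σ s = g * evalWord σ (w.take j) ∧
      (∀ g1 g2, s = g1 ++ g2 → ∃ k ≤ w.length, g * evalWord σ (w.take i) * evalWord σ g1 = g * evalWord σ (w.take k)) ∧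
      (∀ g1 g2, wordInv s = g1 ++ g2 →
      ∃ k ≤ w.length, g * evalWord σ (w.take j) * evalWord σ g1 = g * evalWord σ (w.take k)) := by
    intro i j hij hj
    obtain ⟨U, s, V, h1, h2, h3, h4, h5⟩ := split_seg w hij hj
    refine ⟨s, h3, GW.infix hP (h1 ▸ hw), hK.infix ⟨U, V, by simp [h1]⟩, by rw [h4, h5, ev_append, mul_assoc], ?_, ?_⟩
    · intro g1 g2 hg
      refine ⟨(U ++ g1).length, by rw [h1, hg]; simp, ?_⟩
      have : w.take (U ++ g1).length = U ++ g1 := by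
        rw [h1, hg, show U ++ ((g1 ++ g2) ++ V) = (U ++ g1) ++ (g2 ++ V) by simp, List.take_left]
      rw [this, h4, ev_append, mul_assoc]
    · intro g1 g2 hg
      rw [winv_eq_iff, winv_append] at hg
      refine ⟨(U ++ wordInv g2).length, by rw [h1, hg]; simp, ?_⟩
      have : w.take (U ++ wordInv g2).length = U ++ wordInv g2 := by
        rw [h1, hg, show U ++ ((wordInv g2 ++ wordInv g1) ++ V) = (U ++ wordInv g2) ++ (wordInv g1 ++ V) by simp,
          List.take_left]
      rw [this, h5, hg]
      simp [mul_assoc]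
  have fin : ∀ s : Word S, (s.length : ℤ) = |(i : ℤ) - j| →
      n * s.length ≤ n * (2 * K 20 + 1 + K n) + 6 * wordDist σ x (g * evalWord σ (w.take i)) →
      (n : ℤ) * |(i : ℤ) - j| ≤ n * (2 * K 20 + 1 + K n) + 6 * wordDist σ x (g * evalWord σ (w.take i)) := by
    intro s hs h
    rw [← hs]
    exact_mod_cast h
  rcases le_total i j with hij | hij
  · obtain ⟨s, h1, h2, h3, h4, h5, h6⟩ := key i j hij hj
    exact fin s (by rw [h1, abs_sub_comm, abs_of_nonneg (by omega)]; omega) (ct_aux hP hn hx hy hi h2 h3 h4 h5 h6 hh hd)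
  · obtain ⟨s, h1, h2, h3, h4, h5, h6⟩ := key j i hij hi
    exact fin (wordInv s) (by rw [winv_length, h1, abs_of_nonneg (by omega)]; omega)
      (ct_aux hP hn hx hy hi (h2.winv hP) (h3.winv hP.sc) (by rw [← h4]; simp) h6 (by simpa using h5) hh hd)

def bT (K : ℕ → ℕ) (N : ℕ) : ℕ := 2 * K 20 + 1 + K (4800 * (2 * N))
def hT (K : ℕ → ℕ) (N : ℕ) : ℕ := 800 * (2 * N * bT K N) + 800 + 50 * K 20
def dT (K : ℕ → ℕ) (N : ℕ) : ℕ := hT K N + 2 * N * (3 * hT K N + 2 + bT K N)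

theorem chain (hP : Pres σ C) {K : ℕ → ℕ} {g : G} {w : Word S} (hw : GW σ w) (hK : Tame C K w)
    {N : ℕ} (hN : 1 ≤ N) {q : ℤ → G} {a b : ℤ} (hq : DIsPath σ (Set.Icc a b) q) (π : ℤ → ℕ)
    (hπ : ∀ c, π c ≤ w.length)
    (hπ2 : ∀ c k, k ≤ w.length → wordDist σ (q c) (g * evalWord σ (w.take (π c))) ≤
      wordDist σ (q c) (g * evalWord σ (w.take k))) :
    ∀ (L : ℕ) (u v : ℤ), v - u ≤ L → a ≤ u → u ≤ v → v ≤ b →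
      (∀ c, u ≤ c → c < v → hT K N < wordDist σ (q c) (g * evalWord σ (w.take (π c)))) →
      wordDist σ (q v) (g * evalWord σ (w.take (π v))) ≤ hT K N →
      (2 * N : ℤ) * |(π u : ℤ) - π v| ≤ (v - u) + 2 * N * (bT K N + hT K N) := by
  intro L
  induction L with
  | zero =>
    intro u v h1 h2 h3 h4 h5 h6
    have : u = v := by push_cast at h1; omega
    subst this
    simp; positivity
  | succ L ih =>
    intro u v h1 h2 h3 h4 h5 h6
    by_cases huv : u = v
    · subst huv
      simp; positivity
    have hu := h5 u le_rfl (by omega)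
    set h := wordDist σ (q u) (g * evalWord σ (w.take (π u))) with hh
    set st : ℕ := h / 200 with hst
    have hTu : hT K N = 800 * (2 * N * bT K N) + 800 + 50 * K 20 := rfl
    have hn : 100 ≤ 4800 * (2 * N) := by omega
    have hB : bT K N = 2 * K 20 + 1 + K (4800 * (2 * N)) := rfl
    have hct : ∀ v', u ≤ v' → v' ≤ b → 200 * (v' - u) ≤ h →
        4800 * ((2 * N : ℤ) * |(π u : ℤ) - π v'|) ≤ 4800 * (2 * N * bT K N) + 6 * h := by
      intro v' g1 g2 g3
      have h7 := path_le hP hq h2 g1 g2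
      have := ct hP hw hK (g := g) (x := q u) (y := q v') hn (hπ2 u) (hπ2 v') (hπ u) (hπ v')
        (by omega) (by omega)
      rw [← hh] at this
      rw [hB]
      push_cast at this ⊢
      linarith
    by_cases hlast : v - u ≤ st
    · have h7 := hct v h3 h4 (by omega)
      have h8 := path_le hP hq h2 h3 h4
      have h9 : h ≤ 2 * hT K N := by
        have := hπ2 u (π v) (hπ v)
        have h10 := hP.wd_tri (q u) (q v) (g * evalWord σ (w.take (π v)))
        omega
      have h10 : (0:ℤ) ≤ N * hT K N := by positivity
      have h11 : (hT K N : ℤ) ≤ N * hT K N := by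
        have := Nat.mul_le_mul_right (hT K N) hN
        rw [one_mul] at this
        exact_mod_cast this
      have h12 : (h : ℤ) ≤ 2 * hT K N := by exact_mod_cast h9
      rw [mul_add]
      have : (2 * N * (hT K N : ℤ)) = 2 * (N * hT K N) := by ring
      rw [this]
      omega
    · have h7 := hct (u + st) (by omega) (by omega) (by omega)
      have h8 := ih (u + st) v (by push_cast at h1; omega) (by omega) (by omega) h4
        (fun c hc1 hc2 => h5 c (by omega) hc2) h6
      have h9 : |(π u : ℤ) - π v| ≤ |(π u : ℤ) - π (u + st)| + |(π (u + st) : ℤ) - π v| := abs_sub_le _ _ _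
      have h10 : (2 * N : ℤ) * |(π u : ℤ) - π v| ≤ (2 * N : ℤ) * |(π u : ℤ) - π (u + st)| +
          (2 * N : ℤ) * |(π (u + st) : ℤ) - π v| := by
        rw [← mul_add]; exact mul_le_mul_of_nonneg_left h9 (by positivity)
      have h11 : ((hT K N : ℕ) : ℤ) = 800 * (2 * N * bT K N) + 800 + 50 * K 20 := by rw [hTu]; push_cast; ring
      have h12 : ((hT K N : ℕ) : ℤ) < h := by exact_mod_cast hu
      set a1 := (2 * N : ℤ) * |(π u : ℤ) - π (u + st)|
      set a2 := (2 * N : ℤ) * bT K N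
      omega

theorem t2core (hP : Pres σ C) {K : ℕ → ℕ} {g : G} {w : Word S} (hw : GW σ w) (hK : Tame C K w)
    {N : ℕ} (hN : 1 ≤ N) {q : ℤ → G} {a b : ℤ} (hq : QG σ N N (Set.Icc a b) q)
    (hqa : q a = g) (hqb : q b = g * evalWord σ w) (c : ℤ) (hac : a ≤ c) (hcb : c ≤ b) :
    ∃ k ≤ w.length, wordDist σ (q c) (g * evalWord σ (w.take k)) ≤ dT K N := by
  have : ∀ c : ℤ, ∃ i, i ≤ w.length ∧ ∀ k, k ≤ w.length → wordDist σ (q c) (g * evalWord σ (w.take i)) ≤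
      wordDist σ (q c) (g * evalWord σ (w.take k)) := by
    intro c
    obtain ⟨i, hi, h⟩ := Finset.exists_min_image (Finset.range (w.length + 1))
      (fun k => wordDist σ (q c) (g * evalWord σ (w.take k))) ⟨0, by simp⟩
    exact ⟨i, by simp at hi; omega, fun k hk => h k (by simp; omega)⟩
  choose π hπ hπ2 using this
  refine ⟨π c, hπ c, ?_⟩
  set h : ℤ → ℕ := fun c => wordDist σ (q c) (g * evalWord σ (w.take (π c))) with hh
  change h c ≤ _
  by_contra hcon
  have hD : dT K N = hT K N + 2 * N * (3 * hT K N + 2 + bT K N) := rfl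
  have hHc : hT K N < h c := by
    have : 0 ≤ 2 * N * (3 * hT K N + 2 + bT K N) := by positivity
    omega
  have ha : h a = 0 := by
    have := hπ2 a 0 (by omega)
    simp [hqa] at this
    simp only [hh]; rw [hqa]; exact this
  have hb : h b = 0 := by
    have := hπ2 b w.length le_rfl
    simp [hqb] at this
    simp only [hh]; rw [hqb]; exact this
  have hlip : ∀ c d, a ≤ c → c ≤ d → d ≤ b → h c ≤ h d + (d - c) ∧ h d ≤ h c + (d - c) := by
    intro c d h1 h2 h3
    have h4 := path_le hP hq.1 h1 h2 h3
    have h5 := hπ2 c (π d) (hπ d)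
    have h6 := hπ2 d (π c) (hπ c)
    have h7 := hP.wd_tri (q c) (q d) (g * evalWord σ (w.take (π d)))
    have h8 := hP.wd_tri (q d) (q c) (g * evalWord σ (w.take (π c)))
    rw [hP.wd_comm (q d) (q c)] at h8
    simp only [hh]
    omega
  obtain ⟨u, ⟨hu1, hu2, hu3⟩, hu4⟩ := Int.exists_greatest_of_bdd (P := fun z => a ≤ z ∧ z ≤ c ∧ h z ≤ hT K N)
    ⟨c, fun z hz => hz.2.1⟩ ⟨a, le_rfl, hac, by omega⟩
  obtain ⟨v, ⟨hv1, hv2, hv3⟩, hv4⟩ := Int.exists_least_of_bdd (P := fun z => c ≤ z ∧ z ≤ b ∧ h z ≤ hT K N)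
    ⟨c, fun z hz => hz.1⟩ ⟨b, hcb, le_rfl, by omega⟩
  have huc : u ≠ c := by rintro rfl; omega
  have hvc : v ≠ c := by rintro rfl; omega
  have hch := chain hP hw hK hN hq.1 π hπ hπ2 (v - (u+1)).toNat (u+1) v (by omega) (by omega) (by omega) hv2
    (by
      intro z hz1 hz2
      by_contra hz
      push Not at hz
      by_cases hzc : z ≤ c
      · have := hu4 z ⟨by omega, hzc, hz⟩; omega
      · have := hv4 z ⟨by omega, by omega, hz⟩; omega) hv3
  have hqg := hq.2 (u+1) ⟨by omega, by omega⟩ v ⟨by omega, hv2⟩ (by omega)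
  have h1 := hlip u (u+1) hu1 (by omega) (by omega)
  have h2 := hlip c v hac hv1 hv2
  have hseg : ∀ i j : ℕ, i ≤ w.length → j ≤ w.length →
      (wordDist σ (g * evalWord σ (w.take i)) (g * evalWord σ (w.take j)) : ℤ) ≤ |(i : ℤ) - j| := by
    have : ∀ i j : ℕ, i ≤ j → j ≤ w.length →
      (wordDist σ (g * evalWord σ (w.take i)) (g * evalWord σ (w.take j)) : ℤ) ≤ j - i := by
      intro i j hij hj
      obtain ⟨U, s, V, h1, h2, h3, h4, h5⟩ := split_seg w hij hj
      have := wd_le (σ := σ) (g := g * evalWord σ (w.take i)) (h := g * evalWord σ (w.take j)) (w := s)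
        (by rw [h4, h5]; simp [mul_assoc])
      omega
    intro i j hi hj
    rcases le_total i j with hij | hij
    · rw [abs_sub_comm, abs_of_nonneg (by omega)]; exact this i j hij hj
    · rw [abs_of_nonneg (by omega), hP.wd_comm]; exact this j i hij hi
  have h3 : (wordDist σ (q (u+1)) (q v) : ℤ) ≤ h (u+1) + |(π (u+1) : ℤ) - π v| + h v := by
    have t1 := hP.wd_tri (q (u+1)) (g * evalWord σ (w.take (π (u+1)))) (q v)
    have t2 := hP.wd_tri (g * evalWord σ (w.take (π (u+1)))) (g * evalWord σ (w.take (π v))) (q v)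
    have t3 := hseg _ _ (hπ (u+1)) (hπ v)
    rw [hP.wd_comm (g * evalWord σ (w.take (π v))) (q v)] at t2
    simp only [hh]
    omega
  have h4 : (N : ℤ) * (wordDist σ (q (u+1)) (q v) : ℤ) ≤ N * (2 * hT K N + 1 + |(π (u+1) : ℤ) - π v|) :=
    mul_le_mul_of_nonneg_left (by omega) (by positivity)
  have h5 : (v - (u + 1)) ≤ 2 * N * (3 * hT K N + 2 + bT K N) := by
    nlinarith
  have h6 : (dT K N : ℤ) = hT K N + 2 * N * (3 * hT K N + 2 + bT K N) := by rw [hD]; push_cast; ring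
  omega

theorem T2 (hP : Pres σ C) {K : ℕ → ℕ} {g : G} {w : Word S} (hw : GW σ w) (hK : Tame C K w) :
    MO σ (fun N => dT K (N+1)) (Set.Icc 0 (w.length : ℤ)) (pathOfWord σ g w) := by
  rintro N s ⟨hs1, hs2⟩ t ⟨ht1, ht2⟩ hst q a b hab hq hqa hqb c ⟨hc1, hc2⟩
  obtain ⟨U, v, V, h1, h2, h3, h4, h5⟩ := split_seg w (i := s.toNat) (j := t.toNat) (by omega) (by omega)
  have hcore := t2core hP (g := g * evalWord σ U) (w := v) (K := K) (GW.infix hP (h1 ▸ hw)) (hK.infix ⟨U, V, by simp [h1]⟩)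
    (N := N + 1) (by omega) (hq.mono (by omega) (by omega)) (by rw [hqa]; simp [pathOfWord, h4])
    (by rw [hqb]; simp [pathOfWord, h5, mul_assoc]) c hc1 hc2
  obtain ⟨k, hk, hk2⟩ := hcore
  refine ⟨s + k, ⟨by omega, by omega⟩, ?_⟩
  convert hk2 using 2
  simp only [pathOfWord]
  rw [show (s + k).toNat = U.length + k by omega, h1, List.take_length_add_append,
    List.take_append_of_le_length hk, ev_append, mul_assoc]

end P11

end MorseLTG

namespace MorseLTG

section P12
variable {S : Type*} {C : Set (Word S)} {G : Type*} [Group G] {σ : S → G}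

theorem gauge_exists (f : ℕ → ℕ) : ∃ M : ℝ → ℝ, IsMorseGauge M ∧ ∀ t : ℝ, 1 ≤ t → (f ⌊t⌋₊ : ℝ) ≤ M t := by
  let F : ℕ → ℝ → ℝ := fun n t => ∑ k ∈ Finset.range n, (f k : ℝ) * max 0 (t - k + 1)
  let M : ℝ → ℝ := fun t => F (⌊t⌋₊ + 2) t
  have key : ∀ n : ℕ, ∀ t : ℝ, 0 ≤ t → t < n + 1 → M t = F (n + 2) t := by
    intro n t h0 ht
    have h1 : ⌊t⌋₊ + 2 ≤ n + 2 := by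
      have : ⌊t⌋₊ < n + 1 := (Nat.floor_lt h0).2 (by exact_mod_cast ht)
      omega
    apply Finset.sum_subset
    · intro k; simp; omega
    · intro k _ hk
      simp at hk
      have h2 := Nat.lt_floor_add_one t
      have h3 : ((⌊t⌋₊ + 2 : ℕ) : ℝ) ≤ k := by exact_mod_cast hk
      push_cast at h3
      rw [max_eq_left (by linarith), mul_zero]
  have Fc : ∀ n, Continuous (F n) := by intro n; fun_prop
  have Fm : ∀ n, Monotone (F n) := by
    intro n s t hst
    apply Finset.sum_le_sum
    intro k _
    apply mul_le_mul_of_nonneg_left _ (by positivity)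
    exact max_le_max le_rfl (by linarith)
  have F0 : ∀ n t, 0 ≤ F n t := fun n t => Finset.sum_nonneg fun k _ => by positivity
  refine ⟨M, ⟨?_, ?_, ?_⟩, ?_⟩
  · intro s hs t ht hst
    simp only [Set.mem_Ici] at hs ht
    rw [key ⌊t⌋₊ s (by linarith) (lt_of_le_of_lt hst (Nat.lt_floor_add_one t)),
      key ⌊t⌋₊ t (by linarith) (Nat.lt_floor_add_one t)]
    exact Fm _ hst
  · intro t ht
    simp only [Set.mem_Ici] at ht
    have : ContinuousWithinAt (F (⌊t⌋₊ + 2)) (Set.Ici 1) t := (Fc _).continuousWithinAt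
    refine this.congr_of_eventuallyEq ?_ (key _ t (by linarith) (Nat.lt_floor_add_one t))
    have h1 : Set.Iio ((⌊t⌋₊ : ℝ) + 1) ∈ nhds t := Iio_mem_nhds (Nat.lt_floor_add_one t)
    filter_upwards [self_mem_nhdsWithin, mem_nhdsWithin_of_mem_nhds h1] with x hx hx2
    simp only [Set.mem_Ici, Set.mem_Iio] at hx hx2
    exact key _ x (by linarith) hx2
  · intro t _; exact F0 _ _
  · intro t ht
    have h1 : (f ⌊t⌋₊ : ℝ) * max 0 (t - ⌊t⌋₊ + 1) ≤ M t :=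
      Finset.single_le_sum (f := fun k : ℕ => (f k : ℝ) * max 0 (t - k + 1))
        (fun k _ => by positivity) (by simp)
    have h2 : (1:ℝ) ≤ max 0 (t - ⌊t⌋₊ + 1) := le_max_of_le_right (by
      have := Nat.floor_le (show 0 ≤ t by linarith); linarith)
    have : (0:ℝ) ≤ f ⌊t⌋₊ := by positivity
    nlinarith

theorem QG.ofD {Q : ℝ} (hQ : 1 ≤ Q) {I : Set ℤ} {q : ℤ → G} (h : DQGeoOn σ Q I q) :
    QG σ ((⌊Q⌋₊+1)^2) ((⌊Q⌋₊+1)^2) I q := by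
  refine ⟨h.1, fun m hm n hn hmn => ?_⟩
  have h1 := (h.2 m hm n hn).1
  have h2 : (m:ℝ) ≤ n := by exact_mod_cast hmn
  rw [abs_of_nonneg (by linarith), sub_le_iff_le_add, div_le_iff₀ (by linarith)] at h1
  have h3 : Q < ⌊Q⌋₊ + 1 := Nat.lt_floor_add_one Q
  set k : ℝ := (⌊Q⌋₊ : ℝ) + 1
  have h4 : (0:ℝ) ≤ (wordDist σ (q m) (q n) : ℝ) := by positivity
  have h5 : (n:ℝ) - m ≤ k^2 * (wordDist σ (q m) (q n) : ℝ) + k^2 := by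
    have a1 : Q ≤ k^2 := by nlinarith
    have a2 : Q * Q ≤ k^2 := by nlinarith
    have a3 := mul_le_mul_of_nonneg_left a1 h4
    linarith
  have : ((n - m : ℤ) : ℝ) ≤ ((((⌊Q⌋₊+1)^2 : ℕ) : ℤ) * (wordDist σ (q m) (q n) : ℤ) + (((⌊Q⌋₊+1)^2 : ℕ) : ℤ) : ℤ) := by
    push_cast; exact h5
  exact_mod_cast this

theorem QG.toD (hP : Pres σ C) {N : ℕ} (hN : 1 ≤ N) {I : Set ℤ} (hI : I.OrdConnected) {q : ℤ → G}
    (h : QG σ N N I q) : DQGeoOn σ N I q := by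
  have key : ∀ m ∈ I, ∀ n ∈ I, m ≤ n → |(n : ℝ) - (m : ℝ)| / N - N ≤ (wordDist σ (q m) (q n) : ℝ) ∧
      (wordDist σ (q m) (q n) : ℝ) ≤ N * |(n : ℝ) - (m : ℝ)| + N := by
    intro m hm n hn hmn
    have h1 := h.2 m hm n hn hmn
    have h2 : (m:ℝ) ≤ n := by exact_mod_cast hmn
    have hN' : (1:ℝ) ≤ N := by exact_mod_cast hN
    rw [abs_of_nonneg (by linarith), sub_le_iff_le_add, div_le_iff₀ (by linarith)]
    have h3 : ((n - m : ℤ) : ℝ) ≤ ((N * (wordDist σ (q m) (q n) : ℤ) + N : ℤ) : ℝ) := by exact_mod_cast h1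
    have h4 : (wordDist σ (q m) (q n) : ℤ) ≤ n - m :=
      path_le hP (a := m) (b := n) (fun x hx hx' => h.1 x (hI.out hm hn hx) (hI.out hm hn hx')) le_rfl hmn le_rfl
    have h5 : (wordDist σ (q m) (q n) : ℝ) ≤ ((n - m : ℤ) : ℝ) := by exact_mod_cast h4
    push_cast at h3 h5
    constructor <;> nlinarith
  refine ⟨h.1, fun m hm n hn => ?_⟩
  rcases le_total m n with hmn | hmn
  · exact key m hm n hn hmn
  · rw [abs_sub_comm, hP.wd_comm]; exact key n hn m hm hmn

theorem MO.toD {D : ℕ → ℕ} {M : ℝ → ℝ} (hM : ∀ t : ℝ, 1 ≤ t → (D ((⌊t⌋₊+1)^2) : ℝ) ≤ M t) {I : Set ℤ} {p : ℤ → G}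
    (h : MO σ D I p) : DMorseOn σ M I p := by
  intro Q hQ s hs t ht hst q a b hab hq ha hb n hn
  obtain ⟨m, hm, h1⟩ := h _ s hs t ht hst q a b hab (QG.ofD hQ hq) ha hb n hn
  exact ⟨m, hm, le_trans (by exact_mod_cast h1) (hM Q hQ)⟩

theorem MO.ofD (hP : Pres σ C) {M : ℝ → ℝ} (hM : IsMorseGauge M) {I : Set ℤ} {p : ℤ → G}
    (h : DMorseOn σ M I p) : MO σ (fun N => ⌊M (N+1)⌋₊) I p := by
  intro N s hs t ht hst q a b hab hq ha hb n hn
  have := QG.toD hP (N := N+1) (by omega) Set.ordConnected_Icc (hq.mono (Nat.le_succ N) (Nat.le_succ N))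
  push_cast at this
  obtain ⟨m, hm, h1⟩ := h (N+1) (by simp) s hs t ht hst q a b hab this ha hb n hn
  refine ⟨m, hm, Nat.le_floor h1⟩

theorem MO.sub {D : ℕ → ℕ} {I J : Set ℤ} {p : ℤ → G} (h : MO σ D I p) (hJ : J ⊆ I) : MO σ D J p :=
  fun N s hs t ht => h N s (hJ hs) t (hJ ht)

theorem MO.congr {D : ℕ → ℕ} {I : Set ℤ} (hI : I.OrdConnected) {p p' : ℤ → G} (h : MO σ D I p) (hp : ∀ n ∈ I, p n = p' n) : MO σ D I p' := by
  intro N s hs t ht hst q a b hab hq ha hb n hn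
  obtain ⟨m, hm, h1⟩ := h N s hs t ht hst q a b hab hq (by rw [ha, hp s hs]) (by rw [hb, hp t ht]) n hn
  exact ⟨m, hm, by rw [← hp m (hI.out hs ht hm)]; exact h1⟩

end P12

end MorseLTG

namespace MorseLTG

section P13
variable {S : Type*} {C : Set (Word S)} {G : Type*} [Group G] {σ : S → G}

theorem GW.inf (hP : Pres σ C) {e w : Word S} (h : GW σ w) (he : e <:+: w) : GW σ e := by
  obtain ⟨A, B, rfl⟩ := he
  exact GW.infix (A := A) (B := B) hP (by simpa using h)

theorem suf_cases {α : Type*} {e W x : List α} (h : e <:+ W ++ x) :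
    e <:+ x ∨ ∃ e1, e = e1 ++ x ∧ e1 <:+ W := by
  obtain ⟨A, h⟩ := h
  rcases List.append_eq_append_iff.1 h with ⟨a, h1, h2⟩ | ⟨a, h1, h2⟩
  · right; exact ⟨a, h2, ⟨A, h1.symm⟩⟩
  · left; exact ⟨a, h2.symm⟩

theorem inf_cases {α : Type*} {e W x : List α} (h : e <:+: W ++ x) :
    e <:+: W ∨ e <:+: x ∨ ∃ e1 e2, e = e1 ++ e2 ∧ e1 <:+ W ∧ e2 <+: x := by
  obtain ⟨A, B, h⟩ := h
  rcases List.append_eq_append_iff.1 h with ⟨a, h1, h2⟩ | ⟨a, h1, h2⟩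
  · left; exact ⟨A, a, h1.symm⟩
  · rcases List.append_eq_append_iff.1 h1 with ⟨b, h3, h4⟩ | ⟨b, h3, h4⟩
    · right; right; exact ⟨b, a, h4, ⟨A, h3.symm⟩, ⟨B, h2.symm⟩⟩
    · right; left; exact ⟨b, B, by rw [h2, h4]⟩

theorem ov9 (hC : SC C) {x r : Word S} (hr : r ∈ C) (hx : x <+: r) (hl : 9 * x.length ≤ r.length)
    {e ρ : Word S} (he : e <:+: x) (hρ : ρ ∈ C) (heρ : e <+: ρ) : 9 * e.length ≤ ρ.length := by
  by_cases he0 : e = []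
  · subst he0; simp
  obtain ⟨A, B, rfl⟩ := he
  obtain ⟨y, rfl⟩ := hx
  have hr' : e ++ (B ++ y ++ A) ∈ C := by
    have := hC.rot A (e ++ B ++ y) (by simpa using hr)
    simpa using this
  by_cases hh : ρ = e ++ (B ++ y ++ A)
  · subst hh; simp at hl ⊢; omega
  · have := hC.pc _ hρ _ hr' hh e he0 heρ ⟨_, rfl⟩
    omega

theorem gm_bad (hP : Pres σ C) {K K' : ℕ → ℕ} (hm : Monotone K') (hK : ∀ n, K n ≤ K' n) (hsq : ∀ n, n * n ≤ K' n)
    (H : ∀ L : ℕ, ∃ w, GW σ w ∧ (∀ x, x <:+: w → x.length ≤ L → ∀ r ∈ C, x <+: r → ∀ n, 3 ≤ n →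
      r.length ≤ n * x.length → r.length ≤ K n) ∧ ¬ Tame C K' w) (L : ℕ) :
    ∃ x r ν, GW σ x ∧ r ∈ C ∧ x <+: r ∧ L ≤ ν ∧ 3 ≤ ν ∧ r.length ≤ ν * x.length ∧ K' ν < r.length ∧
      ν * x.length ≤ 2 * r.length ∧ ν ≤ x.length ∧ Tame C (fun n => (n+1) * K' (2*n+1)) x := by
  classical
  obtain ⟨w, hw, hloc, hnt⟩ := H (K' (L+1))
  have hex : ∃ k, ∃ x r n, x <:+: w ∧ r ∈ C ∧ x <+: r ∧ 3 ≤ n ∧ r.length ≤ n * x.length ∧ K' n < r.length ∧ r.length = k := by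
    unfold Tame at hnt
    push Not at hnt
    obtain ⟨x, hx, r, hr, hxr, n, hn, h1, h2⟩ := hnt
    exact ⟨_, x, r, n, hx, hr, hxr, hn, h1, h2, rfl⟩
  obtain ⟨x, r, n, hx, hr, hxr, hn, h1, h2, h3⟩ := Nat.find_spec hex
  have hmin := fun k => Nat.find_min hex (m := k)
  rw [← h3] at hmin
  obtain ⟨ν, hν, hνmax⟩ := nat_max (P := fun m => K' m < r.length) (B := r.length) ⟨n, h2⟩ (by
    intro m hm'
    have := hsq m
    have := Nat.le_mul_self m
    omega)
  have hnν : n ≤ ν := hνmax n h2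
  have hν1 : r.length ≤ K' (ν + 1) := by
    by_contra hc
    have := hνmax (ν + 1) (by omega)
    omega
  have hνx : r.length ≤ ν * x.length := h1.trans (Nat.mul_le_mul_right _ hnν)
  have hνp : 0 < ν := by omega
  have hνr : ν ≤ r.length := by
    have := hsq ν
    have := Nat.le_mul_self ν
    omega
  set l := (r.length + ν - 1) / ν with hl
  have hl1 : r.length ≤ ν * l := by
    have := Nat.div_add_mod (r.length + ν - 1) ν
    have := Nat.mod_lt (r.length + ν - 1) hνp
    rw [hl]; omega
  have hl2 : ν * l ≤ r.length + ν - 1 := Nat.mul_div_le _ _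
  have hlx : l ≤ x.length := by
    by_contra hc
    have : ν * (x.length + 1) ≤ ν * l := Nat.mul_le_mul_left _ (by omega)
    rw [mul_add] at this
    omega
  have hlen : (x.take l).length = l := by simp [hlx]
  have hxi : x.take l <:+: w := (List.take_prefix l x).isInfix.trans hx
  have hlL : K' (L + 1) < l := by
    by_contra hc
    have := hloc (x.take l) hxi (by omega) r hr ((List.take_prefix l x).trans hxr) ν (by omega) (by rw [hlen]; exact hl1)
    have := hK ν
    omega
  have hlr : l ≤ r.length := by
    have := hxr.length_le; omega
  have hνl : ν ≤ l := by
    have h4 := hsq ν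
    by_contra hc
    have : ν * l ≤ ν * ν := Nat.mul_le_mul_left _ (by omega)
    omega
  refine ⟨x.take l, r, ν, hw.inf hP hxi, hr, (List.take_prefix l x).trans hxr, ?_, by omega, by rw [hlen]; exact hl1, hν,
    by rw [hlen]; omega, by rw [hlen]; exact hνl, ?_⟩
  · by_contra hc
    have := hm (show ν + 1 ≤ L + 1 by omega)
    omega
  · intro e he ρ hρ heρ m hm3 hmm
    have hele : e.length ≤ l := hlen ▸ he.length_le
    have hmono := hm (show m ≤ 2 * m + 1 by omega)
    have hbig : K' (2 * m + 1) ≤ (m+1) * K' (2 * m + 1) := Nat.le_mul_of_pos_left _ (by omega)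
    by_cases hlt : ρ.length < r.length
    · by_contra hc
      exact hmin _ hlt ⟨e, ρ, m, he.trans hxi, hρ, heρ, hm3, hmm, by simp at hc; omega, rfl⟩
    · have h5 : ν ≤ 2 * m := by
        by_contra hc
        have a1 : m * e.length ≤ m * l := Nat.mul_le_mul_left _ hele
        have a2 : (2 * m + 1) * l ≤ ν * l := Nat.mul_le_mul_right _ (by omega)
        have a3 : (2 * m + 1) * l = 2 * (m * l) + l := by ring
        omega
      have h6 := hm (show ν + 1 ≤ 2 * m + 1 by omega)
      have a1 : m * e.length ≤ m * K' (2 * m + 1) := Nat.mul_le_mul_left _ (by omega)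
      show ρ.length ≤ (m+1) * K' (2 * m + 1)
      rw [add_mul]; omega

theorem gm_step (hP : Pres σ C) {K K' : ℕ → ℕ} (hm : Monotone K') (hK : ∀ n, K n ≤ K' n) (hsq : ∀ n, n * n ≤ K' n)
    (H : ∀ L : ℕ, ∃ w, GW σ w ∧ (∀ x, x <:+: w → x.length ≤ L → ∀ r ∈ C, x <+: r → ∀ n, 3 ≤ n →
      r.length ≤ n * x.length → r.length ≤ K n) ∧ ¬ Tame C K' w) (W : Word S) (hW : ReducedWord W) (L : ℕ) :
    ∃ x r ν, ReducedWord (W ++ x) ∧ r ∈ C ∧ x <+: r ∧ L ≤ ν ∧ 3 ≤ ν ∧ L ≤ x.length ∧ r.length ≤ (2 * ν) * x.length ∧ K' ν < r.length ∧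
      9 * x.length ≤ r.length ∧ Tame C (fun n => (n+1) * K' (2*n+1)) x := by
  obtain ⟨x, r, ν, hx, hr, hxr, hL, h3, h1, h2, h4, h5, h6⟩ := gm_bad hP hm hK hsq H (2 * L + 18)
  have hC := hP.sc
  have fin : ∀ y r', ReducedWord (W ++ y) → r' ∈ C → y <+: r' → r'.length = r.length → x.length ≤ 2 * y.length →
      y.length ≤ x.length → Tame C (fun n => (n+1) * K' (2*n+1)) y → 
      ∃ x r ν, ReducedWord (W ++ x) ∧ r ∈ C ∧ x <+: r ∧ L ≤ ν ∧ 3 ≤ ν ∧ L ≤ x.length ∧ r.length ≤ (2 * ν) * x.length ∧ K' ν < r.length ∧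
      9 * x.length ≤ r.length ∧ Tame C (fun n => (n+1) * K' (2*n+1)) x := by
    intro y r' g1 g2 g3 g4 g5 g6 g7
    refine ⟨y, r', ν, g1, g2, g3, by omega, h3, by omega, ?_, by omega, ?_, g7⟩
    · have := Nat.mul_le_mul_left ν g5
      have e1 : ν * (2 * y.length) = 2 * ν * y.length := by ring
      omega
    · have := Nat.mul_le_mul_right x.length (show 18 ≤ ν by omega)
      omega
  have hxp : x.length / 2 < x.length := by omega
  have hsp : x = x.take (x.length/2) ++ (x[x.length/2] :: x.drop (x.length/2+1)) := by simp
  obtain ⟨A, a, B, hA, hxe⟩ : ∃ A a B, A.length = x.length / 2 ∧ x = A ++ a :: B :=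
    ⟨_, _, _, by simp; omega, hsp⟩
  have hlen := congrArg List.length hxe
  simp at hlen
  by_cases hg : ReducedWord (W ++ (a :: B))
  · obtain ⟨y, hy⟩ := hxr
    obtain ⟨r', hr', hp, hl⟩ := hC.sub (A := A) (e := a :: B) (B := y) hr (by rw [← hy, hxe]; simp)
    exact fin _ r' hg hr' hp hl (by simp; omega) (by simp; omega) (h6.infix ⟨A, [], by simp [hxe]⟩)
  · obtain ⟨X, b, Y, hX, hab⟩ := red_strip hW (GW.red hP (hx.inf hP (e := a :: B) ⟨A, [], by simp [hxe]⟩)) hg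
    have hab' : a = li b := (List.cons.inj hab).1
    have hinf : A ++ [a] <:+: x := ⟨[], B, by simp [hxe]⟩
    obtain ⟨r', hr', hp, hl⟩ := hC.inv_pre (e := A ++ [a]) hr (List.IsPrefix.trans (l₂ := x) ⟨B, by simp [hxe]⟩ hxr)
    refine fin (wordInv (A ++ [a])) r' ?_ hr' hp hl (by simp; omega) (by simp; omega) ((h6.infix hinf).winv hC)
    by_contra hc
    obtain ⟨X', c, Y', hX', hy⟩ := red_strip hW (GW.red hP ((hx.inf hP hinf).winv hP)) hc
    rw [hX] at hX'
    have hbc : b = c := by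
      have := List.append_inj_right' hX' rfl
      simpa using this
    rw [winv_append, hab', hbc] at hy
    simp at hy
    have := congrArg Prod.snd hy.1
    simp [li] at this

def RI (C : Set (Word S)) (K : ℕ → ℕ) (W : Word S) : Prop :=
  ReducedWord W ∧ (∀ e, e <:+: W → ∀ ρ ∈ C, e <+: ρ → 18 * e.length ≤ 5 * ρ.length) ∧
  (∀ e, e <:+ W → ∀ ρ ∈ C, e <+: ρ → 18 * e.length ≤ 3 * ρ.length) ∧
  Tame C (fun n => K (4 * n)) W ∧
  ∀ e, e <:+ W → ∀ ρ ∈ C, e <+: ρ → ∀ n, 3 ≤ n → ρ.length ≤ n * e.length → ρ.length ≤ K (2 * n)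

theorem RI.step (hC : SC C) {K : ℕ → ℕ} (hm : Monotone K) {W x r : Word S} (h : RI C K W) (hred : ReducedWord (W ++ x))
    (hl : 100 * W.length ≤ x.length) (hr : r ∈ C) (hx : x <+: r) (h9 : 9 * x.length ≤ r.length) (hT : Tame C K x) :
    RI C K (W ++ x) := by
  obtain ⟨h1, h2, h3, h4, h5⟩ := h
  have hov := fun e ρ => ov9 hC hr hx h9 (e := e) (ρ := ρ)
  refine ⟨hred, ?_, ?_, ?_, ?_⟩
  · intro e he ρ hρ hp
    rcases inf_cases he with g | g | ⟨e1, e2, rfl, g1, g2⟩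
    · exact h2 e g ρ hρ hp
    · have := hov e ρ g hρ hp; omega
    · have a1 := h3 e1 g1 ρ hρ ((List.prefix_append _ _).trans hp)
      obtain ⟨y, hy⟩ := hp
      obtain ⟨r', hr', hp', hl'⟩ := hC.sub (A := e1) (e := e2) (B := y) hρ (by rw [← hy]; simp)
      have a2 := hov e2 r' g2.isInfix hr' hp'
      simp; omega
  · intro e he ρ hρ hp
    rcases suf_cases he with g | ⟨e1, rfl, g⟩
    · have := hov e ρ g.isInfix hρ hp; omega
    · obtain ⟨y, hy⟩ := hp
      obtain ⟨r', hr', hp', hl'⟩ := hC.sub (A := e1) (e := x) (B := y) hρ (by rw [← hy]; simp)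
      have a2 := hov x r' (List.infix_refl _) hr' hp'
      have a3 := g.length_le
      simp; omega
  · intro e he ρ hρ hp n hn hle
    show ρ.length ≤ K (4 * n)
    rcases inf_cases he with g | g | ⟨e1, e2, rfl, g1, g2⟩
    · exact h4 e g ρ hρ hp n hn hle
    · exact (hT e g ρ hρ hp n hn hle).trans (hm (by omega))
    · simp only [List.length_append] at hle
      have hp1 := (List.prefix_append e1 e2).trans hp
      obtain ⟨y, hy⟩ := hp
      obtain ⟨r', hr', hp', hl'⟩ := hC.sub (A := e1) (e := e2) (B := y) hρ (by rw [← hy]; simp)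
      rcases le_total e1.length e2.length with hh | hh
      · rw [← hl']
        refine (hT e2 g2.isInfix r' hr' hp' (2 * n) (by omega) ?_).trans (hm (by omega))
        have := Nat.mul_le_mul_left n hh
        rw [mul_add] at hle
        have e : 2 * n * e2.length = 2 * (n * e2.length) := by ring
        omega
      · refine (h5 e1 g1 ρ hρ hp1 (2 * n) (by omega) ?_).trans (hm (by omega))
        have := Nat.mul_le_mul_left n hh
        rw [mul_add] at hle
        have e : 2 * n * e1.length = 2 * (n * e1.length) := by ring
        omega
  · intro e he ρ hρ hp n hn hle
    rcases suf_cases he with g | ⟨e1, rfl, g⟩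
    · exact (hT e g.isInfix ρ hρ hp n hn hle).trans (hm (by omega))
    · obtain ⟨y, hy⟩ := hp
      obtain ⟨r', hr', hp', hl'⟩ := hC.sub (A := e1) (e := x) (B := y) hρ (by rw [← hy]; simp)
      rw [← hl']
      refine hT x (List.infix_refl _) r' hr' hp' (2 * n) (by omega) ?_
      have a3 := g.length_le
      simp only [List.length_append] at hle
      have := Nat.mul_le_mul_left n (show e1.length ≤ x.length by omega)
      rw [mul_add] at hle
      have e : 2 * n * x.length = 2 * (n * x.length) := by ring
      omega

theorem RI.gw (hP : Pres σ C) {K : ℕ → ℕ} {W : Word S} (h : RI C K W) : GW σ W := by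
  have := N1 hP (cc := 1) le_rfl h.1 (by
    intro A e B hw r hr he
    have := h.2.1 e ⟨A, B, by simp [hw]⟩ r hr he
    omega)
  unfold GW; omega

theorem RI.nil (K : ℕ → ℕ) : RI C K ([] : Word S) := by
  refine ⟨List.isChain_nil, ?_, ?_, ?_, ?_⟩
  · intro e he; rw [List.infix_nil.1 he]; simp
  · intro e he; rw [List.suffix_nil.1 he]; simp
  · intro e he; rw [List.infix_nil.1 he]; simp; rintro r _ n _ rfl; simp
  · intro e he; rw [List.suffix_nil.1 he]; simp; rintro r _ n _ rfl; simp

theorem gw_dist (hP : Pres σ C) {w : Word S} (h : GW σ w) {i j : ℕ} (hij : i ≤ j) (hj : j ≤ w.length) (g : G) :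
    wordDist σ (g * evalWord σ (w.take i)) (g * evalWord σ (w.take j)) = j - i := by
  obtain ⟨U, s, V, h1, h2, h3, h4, h5⟩ := split_seg w hij hj
  rw [h4, h5, ev_append, ← mul_assoc, hP.wd_ev]
  have := h.inf hP (e := s) ⟨U, V, by simp [h1]⟩
  unfold GW at this
  have h6 : wordDist σ 1 (evalWord σ s) ≤ s.length := wd_le (by simp)
  omega

theorem limit_ray (hP : Pres σ C) {W : ℕ → Word S} (hpre : ∀ j, W j <+: W (j+1)) (hlen : ∀ j, j ≤ (W j).length)
    (hg : ∀ j, GW σ (W j)) {K : ℕ → ℕ} (hT : ∀ j, Tame C K (W j)) :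
    ∃ p : ℤ → G, DGeodesicRay σ p ∧ MO σ (fun N => dT K (N+1)) (Set.Ici 0) p ∧
      ∀ (j : ℕ) (n : ℤ), 0 ≤ n → n ≤ (W j).length → p n = pathOfWord σ 1 (W j) n := by
  have hpre' : ∀ i j, i ≤ j → W i <+: W j := by
    intro i j hij
    induction j, hij using Nat.le_induction with
    | base => exact List.prefix_refl _
    | succ j _ ih => exact ih.trans (hpre j)
  have htake : ∀ i j n, n ≤ (W i).length → n ≤ (W j).length → (W i).take n = (W j).take n := by
    have : ∀ i j n, i ≤ j → n ≤ (W i).length → (W i).take n = (W j).take n := by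
      intro i j n hij hn
      obtain ⟨y, hy⟩ := hpre' i j hij
      rw [← hy, List.take_append_of_le_length hn]
    intro i j n h1 h2
    rcases le_total i j with h | h
    · exact this i j n h h1
    · exact (this j i n h h2).symm
  let p : ℤ → G := fun n => pathOfWord σ 1 (W n.toNat) n
  have hp : ∀ (j : ℕ) (n : ℤ), 0 ≤ n → n ≤ (W j).length → p n = pathOfWord σ 1 (W j) n := by
    intro j n h0 h1
    simp only [p, pathOfWord]
    rw [htake n.toNat j n.toNat (hlen _) (by omega)]
  refine ⟨p, ⟨by simp [p, pathOfWord], ?_⟩, ?_, hp⟩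
  · have key : ∀ m n : ℤ, 0 ≤ m → m ≤ n → (wordDist σ (p m) (p n) : ℤ) = n - m := by
      intro m n hm hmn
      have := hlen n.toNat
      rw [hp n.toNat m hm (by omega), hp n.toNat n (by omega) (by omega)]
      simp only [pathOfWord]
      rw [gw_dist hP (hg _) (by omega) (by omega)]
      omega
    intro m hm n hn
    simp only [Set.mem_Ici] at hm hn
    rcases le_total m n with h | h
    · rw [key m n hm h, abs_of_nonneg (by omega)]
    · rw [hP.wd_comm, key n m hn h, abs_of_nonpos (by omega)]; ring
  · intro N s hs t ht hst
    simp only [Set.mem_Ici] at hs ht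
    have hl := hlen t.toNat
    have h1 := T2 hP (g := 1) (hg t.toNat) (hT t.toNat)
    have h2 := h1.congr (p' := p) Set.ordConnected_Icc (fun n hn => (hp _ n hn.1 hn.2).symm)
    exact h2 N s ⟨by omega, by omega⟩ t ⟨by omega, by omega⟩ hst

def SigC (σ : S → G) : Prop := ∃ Ds : ℕ → ℕ → ℕ, ∀ p : ℤ → G, DGeodesicRay σ p → ∀ D : ℕ → ℕ,
  MO σ D (Set.Ici 0) p → ∃ n, MO σ (Ds n) (Set.Ici 0) p

theorem sigC_of (hP : Pres σ C) (h : CaySigmaCompact σ) : SigC σ := by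
  obtain ⟨Ms, hMs, h⟩ := h
  refine ⟨fun n N => ⌊Ms n (N+1)⌋₊, fun p hp D hD => ?_⟩
  obtain ⟨M, hM, hM2⟩ := gauge_exists (fun k => D ((k+1)^2))
  obtain ⟨n, hn⟩ := h p hp M hM (hD.toD hM2)
  exact ⟨n, MO.ofD hP (hMs n) hn⟩

theorem gm_main (hP : Pres σ C) (hS : SigC σ) (K : ℕ → ℕ) :
    ∃ L : ℕ, ∃ K' : ℕ → ℕ, ∀ w, GW σ w → (∀ x, x <:+: w → x.length ≤ L → ∀ r ∈ C, x <+: r → ∀ n, 3 ≤ n →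
      r.length ≤ n * x.length → r.length ≤ K n) → Tame C K' w := by
  have hC := hP.sc
  obtain ⟨Ds, hDs⟩ := hS
  let F : ℕ → ℕ := fun n => n * n + K n + ∑ j ∈ Finset.range (n+1), (400 * Ds j (100 * (2 * n)) + 8)
  let K' : ℕ → ℕ := fun n => ∑ k ∈ Finset.range (n+1), F k
  have hm : Monotone K' := by
    intro a b hab
    exact Finset.sum_le_sum_of_subset (Finset.range_mono (by omega))
  have hF : ∀ n, F n ≤ K' n := fun n => Finset.single_le_sum (f := F) (fun _ _ => Nat.zero_le _) (by simp)
  have hK : ∀ n, K n ≤ K' n := fun n => le_trans (by simp only [F]; omega) (hF n)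
  have hsq : ∀ n, n * n ≤ K' n := fun n => le_trans (by simp only [F]; omega) (hF n)
  have hDK : ∀ j n, j ≤ n → 400 * Ds j (100 * (2 * n)) + 8 ≤ K' n := by
    intro j n hj
    refine le_trans ?_ (hF n)
    have := Finset.single_le_sum (f := fun j => 400 * Ds j (100 * (2 * n)) + 8) (s := Finset.range (n+1))
      (fun _ _ => Nat.zero_le _) (a := j) (by simp; omega)
    simp only [F]; omega
  let K2 : ℕ → ℕ := fun n => (n+1) * K' (2*n+1)
  have hm2 : Monotone K2 := fun a b hab => Nat.mul_le_mul (by omega) (hm (by omega))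
  by_contra hcon
  have H : ∀ L : ℕ, ∃ w, GW σ w ∧ (∀ x, x <:+: w → x.length ≤ L → ∀ r ∈ C, x <+: r → ∀ n, 3 ≤ n →
      r.length ≤ n * x.length → r.length ≤ K n) ∧ ¬ Tame C K' w := by
    intro L
    by_contra hc
    refine hcon ⟨L, K', fun w h1 h2 => ?_⟩
    by_contra h3
    exact hc ⟨w, h1, h2, h3⟩
  have hstep : ∀ (W : {W : Word S // RI C K2 W}) (j : ℕ), ∃ x r ν, ReducedWord (W.1 ++ x) ∧ r ∈ C ∧ x <+: r ∧
      100 * W.1.length + 1 + j ≤ ν ∧ 3 ≤ ν ∧ 100 * W.1.length + 1 + j ≤ x.length ∧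
      r.length ≤ (2 * ν) * x.length ∧ K' ν < r.length ∧ 9 * x.length ≤ r.length ∧ Tame C K2 x := fun W j =>
    gm_step hP hm hK hsq H W.1 W.2.1 _
  choose x r ν h1 h2 h3 h4 h5 h6 h7 h8 h9 h10 using hstep
  have hri : ∀ W j, RI C K2 (W.1 ++ x W j) := fun W j =>
    W.2.step hC hm2 (h1 W j) (by have := h6 W j; omega) (h2 W j) (h3 W j) (h9 W j) (h10 W j)
  let T : ℕ → {W : Word S // RI C K2 W} := fun n => Nat.rec ⟨[], RI.nil K2⟩ (fun j W => ⟨W.1 ++ x W j, hri W j⟩) n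
  have hT : ∀ j, (T (j+1)).1 = (T j).1 ++ x (T j) j := fun j => rfl
  have hlen : ∀ j, j ≤ (T j).1.length := by
    intro j
    induction j with
    | zero => omega
    | succ j ih =>
      have := h6 (T j) j
      rw [hT, List.length_append]; omega
  obtain ⟨p, hp1, hp2, hp3⟩ := limit_ray hP (W := fun j => (T j).1) (fun j => ⟨_, (hT j).symm⟩) hlen
    (fun j => (T j).2.gw hP) (fun j => (T j).2.2.2.2.1)
  obtain ⟨j, hj⟩ := hDs p hp1 _ hp2
  have hkey := T3 hP hj (i := ((T j).1.length : ℤ)) (x := x (T j) j) (r := r (T j) j) (fun k _ => by simp; omega)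
    (by
      intro k hk
      have hl : ((T (j+1)).1.length : ℤ) = (T j).1.length + (x (T j) j).length := by
        rw [hT, List.length_append]; simp
      have e1 := hp3 (j+1) ((T j).1.length + k) (by omega) (by simp only [hl]; omega)
      have e2 := hp3 (j+1) ((T j).1.length) (by omega) (by simp only [hl]; omega)
      rw [e1, e2]
      simp only [pathOfWord, hT, one_mul]
      have g1 : ((T j).1.length + k : ℤ).toNat = (T j).1.length + k := by omega
      rw [g1, Int.toNat_natCast, List.take_append, List.take_append, ev_append]
      simp [List.take_of_length_le])
    (h2 _ _) (h3 _ _) (n := 2 * ν (T j) j) (by have := h5 (T j) j; omega) (h7 _ _)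
  have := hDK j (ν (T j) j) (by have := h4 (T j) j; omega)
  have := h8 (T j) j
  omega

theorem GM (hP : Pres σ C) (hS : SigC σ) (D0 : ℕ → ℕ) :
    ∃ L : ℕ, ∃ D1 : ℕ → ℕ, ∀ (g : G) (w : Word S), GW σ w →
      (∀ i j : ℤ, 0 ≤ i → i ≤ j → j ≤ w.length → j - i ≤ L → MO σ D0 (Set.Icc i j) (pathOfWord σ g w)) →
      MO σ D1 (Set.Icc 0 (w.length : ℤ)) (pathOfWord σ g w) := by
  obtain ⟨L, K', h⟩ := gm_main hP hS (fun n => 400 * D0 (100 * n) + 8)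
  refine ⟨L, _, fun g w hw hloc => T2 hP hw (h w hw ?_)⟩
  rintro x ⟨A, B, rfl⟩ hxL r hr hxr n hn hl
  refine T3 hP (hloc A.length (A.length + x.length) (by omega) (by omega) (by simp) (by omega)) (i := A.length) (x := x)
    (fun k hk => ⟨by omega, by omega⟩) ?_ hr hxr hn hl
  intro k hk
  have g1 : (A.length + k : ℤ).toNat = A.length + k := by omega
  simp only [pathOfWord]
  rw [g1, Int.toNat_natCast, List.append_assoc, List.take_append, List.take_append, List.take_append, List.take_append, ev_append]
  have g2 : k - x.length = 0 := by omega
  simp [List.take_of_length_le, mul_assoc, g2]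

end P13

end MorseLTG

namespace MorseLTG

section P14
variable {S : Type*} {C : Set (Word S)} {G : Type*} [Group G] {σ : S → G}

theorem ivt {f : ℤ → ℤ} {a : ℤ} {c x : ℤ} (k : ℕ) (hc : 0 ≤ c)
    (hf : ∀ i, a ≤ i → i < a + k → |f (i+1) - f i| ≤ c) (ha : f a ≤ x) (hb : x ≤ f (a + k)) :
    ∃ i, a ≤ i ∧ i ≤ a + k ∧ |f i - x| ≤ c := by
  induction k with
  | zero => exact ⟨a, le_rfl, by simp, by simp at hb; rw [le_antisymm ha hb]; simpa using hc⟩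
  | succ k ih =>
    by_cases h : x ≤ f (a + k)
    · obtain ⟨i, h1, h2, h3⟩ := ih (fun i h1 h2 => hf i h1 (by push_cast; omega)) h
      exact ⟨i, h1, by push_cast; omega, h3⟩
    · refine ⟨a + k, by omega, by push_cast; omega, ?_⟩
      have := hf (a + k) (by omega) (by push_cast; omega)
      push_cast at hb
      rw [add_assoc] at this
      rw [abs_le] at this ⊢
      constructor <;> omega

theorem ivt' {f : ℤ → ℤ} {a b : ℤ} {c x : ℤ} (hab : a ≤ b) (hc : 0 ≤ c)
    (hf : ∀ i, a ≤ i → i < b → |f (i+1) - f i| ≤ c) (h : f a ≤ x ∧ x ≤ f b ∨ f b ≤ x ∧ x ≤ f a) :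
    ∃ i, a ≤ i ∧ i ≤ b ∧ |f i - x| ≤ c := by
  obtain ⟨k, rfl⟩ : ∃ k : ℕ, b = a + k := ⟨(b - a).toNat, by omega⟩
  rcases h with ⟨h1, h2⟩ | ⟨h1, h2⟩
  · exact ivt k hc hf h1 h2
  · obtain ⟨i, g1, g2, g3⟩ := ivt (f := fun i => - f i) (x := -x) k hc
      (fun i g1 g2 => by have := hf i g1 g2; rw [abs_le] at this ⊢; constructor <;> omega) (by omega) (by omega)
    exact ⟨i, g1, g2, by rw [abs_le] at g3 ⊢; constructor <;> omega⟩

theorem geo_path (hP : Pres σ C) (x y : G) : ∃ f : ℤ → G, f 0 = x ∧ f (wordDist σ x y) = y ∧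
    ∀ i j : ℤ, 0 ≤ i → i ≤ j → j ≤ wordDist σ x y → (wordDist σ (f i) (f j) : ℤ) = j - i := by
  obtain ⟨w, h1, h2, h3⟩ := hP.gw x y
  refine ⟨pathOfWord σ x w, by simp [pathOfWord], by simp [pathOfWord, ← h1, h2], ?_⟩
  intro i j hi hij hj
  simp only [pathOfWord]
  rw [gw_dist hP h3 (by omega) (by omega)]
  omega

theorem path_abs (hP : Pres σ C) {a b : ℤ} {q : ℤ → G} (hq : DIsPath σ (Set.Icc a b) q) {c d : ℤ}
    (hc : a ≤ c ∧ c ≤ b) (hd : a ≤ d ∧ d ≤ b) : (wordDist σ (q c) (q d) : ℤ) ≤ |c - d| := by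
  rcases le_total c d with h | h
  · have := path_le hP hq hc.1 h hd.2
    rw [abs_of_nonpos (by omega)]; omega
  · have := path_le hP hq hd.1 h hc.2
    rw [hP.wd_comm, abs_of_nonneg (by omega)]; omega

theorem QG.abs (hP : Pres σ C) {A B : ℕ} {I : Set ℤ} {q : ℤ → G} (hq : QG σ A B I q) {c d : ℤ} (hc : c ∈ I) (hd : d ∈ I) :
    |c - d| ≤ A * (wordDist σ (q c) (q d) : ℤ) + B := by
  rcases le_total c d with h | h
  · have := hq.2 c hc d hd h
    rw [abs_of_nonpos (by omega)]; omega
  · have := hq.2 d hd c hc h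
    rw [hP.wd_comm, abs_of_nonneg (by omega)]; omega

/-- adding geodesic legs at both ends -/
theorem legs (hP : Pres σ C) {a b : ℤ} (hab : a ≤ b) {q : ℤ → G} (hq : DIsPath σ (Set.Icc a b) q) (x y : G) :
    ∃ Q : ℤ → G, DIsPath σ (Set.Icc (a - wordDist σ (q a) x) (b + wordDist σ (q b) y)) Q ∧
      (∀ n, a ≤ n → n ≤ b → Q n = q n) ∧ Q (a - wordDist σ (q a) x) = x ∧ Q (b + wordDist σ (q b) y) = y ∧
      (∀ m n : ℤ, a - wordDist σ (q a) x ≤ m → m ≤ n → n ≤ a → (wordDist σ (Q m) (Q n) : ℤ) = n - m) ∧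
      (∀ m n : ℤ, b ≤ m → m ≤ n → n ≤ b + wordDist σ (q b) y → (wordDist σ (Q m) (Q n) : ℤ) = n - m) := by
  obtain ⟨f, f0, f1, f2⟩ := geo_path hP (q a) x
  obtain ⟨f', g0, g1, g2⟩ := geo_path hP (q b) y
  let Q : ℤ → G := fun n => if n < a then f (a - n) else if n ≤ b then q n else f' (n - b)
  have Q1 : ∀ n, n ≤ a → Q n = f (a - n) := by
    intro n hn
    by_cases h : n < a
    · simp [Q, h]
    · have : n = a := by omega
      subst this; simp [Q, hab, f0]
  have Q2 : ∀ n, a ≤ n → n ≤ b → Q n = q n := by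
    intro n h1 h2
    simp [Q, h2, not_lt.2 h1]
  have Q3 : ∀ n, b ≤ n → Q n = f' (n - b) := by
    intro n hn
    by_cases h : n ≤ b
    · have : n = b := by omega
      subst this; rw [Q2 n hab le_rfl]; simp [g0]
    · simp [Q, h, not_lt.2 (show a ≤ n by omega)]
  have hL : ∀ m n : ℤ, a - wordDist σ (q a) x ≤ m → m ≤ n → n ≤ a → (wordDist σ (Q m) (Q n) : ℤ) = n - m := by
    intro m n h1 h2 h3
    rw [Q1 m (by omega), Q1 n h3, hP.wd_comm, f2 _ _ (by omega) (by omega) (by omega)]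
    ring
  have hR : ∀ m n : ℤ, b ≤ m → m ≤ n → n ≤ b + wordDist σ (q b) y → (wordDist σ (Q m) (Q n) : ℤ) = n - m := by
    intro m n h1 h2 h3
    rw [Q3 m (by omega), Q3 n (by omega), g2 _ _ (by omega) (by omega) (by omega)]
    ring
  refine ⟨Q, ?_, Q2, ?_, ?_, hL, hR⟩
  · rintro n ⟨h1, h2⟩ ⟨h3, h4⟩
    by_cases c1 : n < a
    · have := hL n (n+1) h1 (by omega) (by omega); omega
    · by_cases c2 : n < b
      · rw [Q2 n (by omega) (by omega), Q2 (n+1) (by omega) (by omega)]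
        exact hq n ⟨by omega, by omega⟩ ⟨by omega, by omega⟩
      · have := hR n (n+1) (by omega) (by omega) (by omega); omega
  · rw [Q1 _ (by omega)]; simpa using f1
  · rw [Q3 _ (by omega)]; simpa using g1

theorem MO.sym (hP : Pres σ C) {D : ℕ → ℕ} {I : Set ℤ} {p : ℤ → G} (h : MO σ D I p) {N : ℕ} {s t : ℤ} (hs : s ∈ I) (ht : t ∈ I)
    {q : ℤ → G} {a b : ℤ} (hab : a ≤ b) (hq : QG σ N N (Set.Icc a b) q) (ha : q a = p s) (hb : q b = p t) {n : ℤ}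
    (hn : n ∈ Set.Icc a b) : ∃ m, (s ≤ m ∧ m ≤ t ∨ t ≤ m ∧ m ≤ s) ∧ wordDist σ (q n) (p m) ≤ D N := by
  rcases le_total s t with hst | hst
  · obtain ⟨m, hm, h1⟩ := h N s hs t ht hst q a b hab hq ha hb n hn
    exact ⟨m, Or.inl hm, h1⟩
  · have hq' : QG σ N N (Set.Icc a b) (fun k => q (a + b - k)) := by
      refine ⟨?_, ?_⟩
      · rintro k ⟨h1, h2⟩ ⟨h3, h4⟩
        have := hq.1 (a + b - (k+1)) ⟨by omega, by omega⟩ ⟨by omega, by omega⟩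
        rw [hP.wd_comm] at this
        convert this using 3; ring
      · rintro m ⟨h1, h2⟩ k ⟨h3, h4⟩ hmk
        have := hq.2 (a + b - k) ⟨by omega, by omega⟩ (a + b - m) ⟨by omega, by omega⟩ (by omega)
        rw [hP.wd_comm] at this
        simp only
        omega
    obtain ⟨m, hm, h1⟩ := h N t ht s hs hst _ a b hab hq' (by simpa using hb) (by simpa using ha) (a + b - n)
      ⟨by have := hn.2; omega, by have := hn.1; omega⟩
    exact ⟨m, Or.inr hm, by simpa using h1⟩

/-- a path near a Morse quasi-geodesic is Morse -/
theorem CC (hP : Pres σ C) {D : ℕ → ℕ} {A B δ : ℕ} {u v i0 i1 : ℤ} {p γ : ℤ → G} (hp : QG σ A B (Set.Icc u v) p)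
    (hM : MO σ D (Set.Icc u v) p) (hγ : DIsPath σ (Set.Icc i0 i1) γ)
    (hn : ∀ i, i0 ≤ i → i ≤ i1 → ∃ m ∈ Set.Icc u v, wordDist σ (γ i) (p m) ≤ δ) :
    MO σ (fun N => D (N + 2 * δ * (N + 1)) + (A * (2 * δ + 1) + B + δ)) (Set.Icc i0 i1) γ := by
  choose! ω hω hωd using hn
  rintro N j0 ⟨h01, h02⟩ j1 ⟨h11, h12⟩ hj q a b hab hq hqa hqb n hn
  set x := p (ω j0) with hx
  set y := p (ω j1) with hy
  obtain ⟨Q, Q1, Q2, Q3, Q4, Q5, Q6⟩ := legs hP hab hq.1 x y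
  have hκ : wordDist σ (q a) x ≤ δ := by rw [hqa]; exact hωd j0 (by omega) (by omega)
  have hκ' : wordDist σ (q b) y ≤ δ := by rw [hqb]; exact hωd j1 (by omega) (by omega)
  set κ := wordDist σ (q a) x
  set κ' := wordDist σ (q b) y
  have hcl : ∀ m, a - κ ≤ m → m ≤ b + κ' → ∃ m', a ≤ m' ∧ m' ≤ b ∧ |m - m'| ≤ δ ∧ wordDist σ (Q m) (q m') ≤ δ := by
    intro m h1 h2
    by_cases c1 : m < a
    · refine ⟨a, le_rfl, hab, by rw [abs_le]; constructor <;> omega, ?_⟩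
      have := Q5 m a h1 (by omega) le_rfl
      rw [← Q2 a le_rfl hab]; omega
    · by_cases c2 : m ≤ b
      · refine ⟨m, by omega, c2, by simp, ?_⟩
        rw [Q2 m (by omega) c2]; simp
      · refine ⟨b, hab, le_rfl, by rw [abs_le]; constructor <;> omega, ?_⟩
        have := Q6 b m le_rfl (by omega) h2
        rw [← Q2 b hab le_rfl, hP.wd_comm]; omega
  have hQG : QG σ (N + 2 * δ * (N + 1)) (N + 2 * δ * (N + 1)) (Set.Icc (a - κ) (b + κ')) Q := by
    have : QG σ N (N + 2 * δ * (N + 1)) (Set.Icc (a - κ) (b + κ')) Q := by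
      refine ⟨Q1, ?_⟩
      rintro m ⟨h1, h2⟩ k ⟨h3, h4⟩ hmk
      obtain ⟨m', g1, g2, g3, g4⟩ := hcl m h1 h2
      obtain ⟨k', g5, g6, g7, g8⟩ := hcl k h3 h4
      have e1 := hq.abs hP (c := m') (d := k') ⟨g1, g2⟩ ⟨g5, g6⟩
      have e2 := hP.wd_tri (q m') (Q m) (q k')
      have e3 := hP.wd_tri (Q m) (Q k) (q k')
      rw [hP.wd_comm] at g4
      have e4 : (wordDist σ (q m') (q k') : ℤ) ≤ wordDist σ (Q m) (Q k) + 2 * δ := by omega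
      have e5 := mul_le_mul_of_nonneg_left e4 (show (0:ℤ) ≤ N by positivity)
      have e6 : ((N + 2 * δ * (N + 1) : ℕ) : ℤ) = N * (2 * δ) + N + 2 * δ := by push_cast; ring
      rw [e6]
      rw [mul_add] at e5
      rw [abs_le] at g3 g7 e1
      omega
    exact this.mono (by omega) le_rfl
  obtain ⟨m, hm, hmd⟩ := hM.sym hP (s := ω j0) (t := ω j1) (hω j0 (by omega) (by omega)) (hω j1 (by omega) (by omega))
    (show a - (κ:ℤ) ≤ b + κ' by omega) hQG Q3 Q4 (n := n) ⟨by have := hn.1; omega, by have := hn.2; omega⟩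
  have hmem : m ∈ Set.Icc u v := by
    have a1 := hω j0 (by omega) (by omega)
    have a2 := hω j1 (by omega) (by omega)
    rcases hm with hm | hm
    · exact ⟨a1.1.trans hm.1, hm.2.trans a2.2⟩
    · exact ⟨a2.1.trans hm.1, hm.2.trans a1.2⟩
  obtain ⟨i, k1, k2, k3⟩ := ivt' (f := ω) (x := m) (c := A * (2 * δ + 1) + B) hj (by positivity) (by
    intro i h1 h2
    have e1 := hp.abs hP (hω (i+1) (by omega) (by omega)) (hω i (by omega) (by omega))
    have e2 := hωd i (by omega) (by omega)
    have e3 := hωd (i+1) (by omega) (by omega)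
    have e4 := hγ i ⟨by omega, by omega⟩ ⟨by omega, by omega⟩
    have e5 := hP.wd_tri (p (ω (i+1))) (γ (i+1)) (p (ω i))
    have e6 := hP.wd_tri (γ (i+1)) (γ i) (p (ω i))
    rw [hP.wd_comm] at e3 e4
    have e7 : (wordDist σ (p (ω (i+1))) (p (ω i)) : ℤ) ≤ 2 * δ + 1 := by omega
    have := mul_le_mul_of_nonneg_left e7 (show (0:ℤ) ≤ A by positivity)
    omega) hm
  refine ⟨i, ⟨k1, k2⟩, ?_⟩
  have e1 := path_abs hP hp.1 (hω i (by omega) (by omega)) hmem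
  have e2 := hωd i (by omega) (by omega)
  have e3 := hP.wd_tri (q n) (p m) (γ i)
  have e4 := hP.wd_tri (p m) (p (ω i)) (γ i)
  rw [hP.wd_comm] at e1 e2
  rw [Q2 n hn.1 hn.2] at hmd
  have : ((wordDist σ (p m) (p (ω i)) : ℕ) : ℤ) ≤ ((A * (2 * δ + 1) + B : ℕ) : ℤ) := by push_cast; omega
  have : wordDist σ (p m) (p (ω i)) ≤ A * (2 * δ + 1) + B := by exact_mod_cast this
  show _ ≤ D (N + 2 * δ * (N + 1)) + (A * (2 * δ + 1) + B + δ)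
  omega

/-- a geodesic weakly close to a Morse path is strongly close in the middle -/
theorem IL (hP : Pres σ C) {D : ℕ → ℕ} {E : ℕ} {u v a b i : ℤ} {p γ : ℤ → G} (huv : u ≤ v)
    (hM : MO σ D (Set.Icc u v) p) (hγ : ∀ m n : ℤ, a ≤ m → m ≤ n → n ≤ b → (wordDist σ (γ m) (γ n) : ℤ) = n - m)
    (hai : a ≤ i) (hib : i ≤ b) (ha : wordDist σ (γ a) (p u) ≤ E) (hb : wordDist σ (γ b) (p v) ≤ E)
    (ha' : γ a = p u ∨ a + 50 * E ≤ i) (hb' : γ b = p v ∨ i + 50 * E ≤ b) :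
    ∃ m ∈ Set.Icc u v, wordDist σ (γ i) (p m) ≤ D 4 := by
  have hω : ∀ c : ℤ, ∃ m ∈ Finset.Icc u v, ∀ m' ∈ Finset.Icc u v, wordDist σ (γ c) (p m) ≤ wordDist σ (γ c) (p m') :=
    fun c => Finset.exists_min_image _ _ ⟨u, by simp [huv]⟩
  choose ω hω hωm using hω
  set g : ℤ → ℤ := fun c => wordDist σ (γ c) (p (ω c)) with hg
  have hgle : ∀ c m, u ≤ m → m ≤ v → g c ≤ wordDist σ (γ c) (p m) := by
    intro c m h1 h2
    have := hωm c m (by simp [h1, h2])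
    simp only [hg]; exact_mod_cast this
  have hg0 : ∀ c, 0 ≤ g c := fun c => by simp [hg]
  have hga : g a ≤ E := (hgle a u le_rfl huv).trans (by exact_mod_cast ha)
  have hgb : g b ≤ E := (hgle b v huv le_rfl).trans (by exact_mod_cast hb)
  have hga' : g a = 0 ∨ a + 50 * E ≤ i := by
    rcases ha' with h | h
    · left; have := hgle a u le_rfl huv; rw [h] at this; simp at this; have := hg0 a; omega
    · right; exact h
  have hgb' : g b = 0 ∨ i + 50 * E ≤ b := by
    rcases hb' with h | h
    · left; have := hgle b v huv le_rfl; rw [h] at this; simp at this; have := hg0 b; omega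
    · right; exact h
  obtain ⟨c, hc, hcm⟩ := Finset.exists_min_image (Finset.Icc a b) (fun c => 10 * g c + (c - a)) ⟨a, by simp; omega⟩
  obtain ⟨d, hd, hdm⟩ := Finset.exists_min_image (Finset.Icc a b) (fun c => 10 * g c + (b - c)) ⟨a, by simp; omega⟩
  have hca := hcm a (by simp; omega)
  have hdb := hdm b (by simp; omega)
  simp only [Finset.mem_Icc] at hc hd
  have := hg0 c
  have := hg0 d
  have hci : c ≤ i := by rcases hga' with h | h <;> omega
  have hid : i ≤ d := by rcases hgb' with h | h <;> omega
  have hcd : 5 * (g c + g d) ≤ 3 * (d - c) := by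
    rcases hga' with h | h <;> rcases hgb' with h' | h' <;> omega
  have hpath : DIsPath σ (Set.Icc c d) γ := by
    rintro n ⟨h1, h2⟩ ⟨h3, h4⟩
    have := hγ n (n+1) (by omega) (by omega) (by omega)
    omega
  obtain ⟨Q, Q1, Q2, Q3, Q4, Q5, Q6⟩ := legs hP (hci.trans hid) hpath (p (ω c)) (p (ω d))
  have e1 : (wordDist σ (γ c) (p (ω c)) : ℤ) = g c := rfl
  have e2 : (wordDist σ (γ d) (p (ω d)) : ℤ) = g d := rfl
  rw [e1] at Q3 Q5
  rw [e2] at Q4 Q6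
  rw [e1, e2] at Q1
  have hωc := Finset.mem_Icc.1 (hω c)
  have hωd := Finset.mem_Icc.1 (hω d)
  have hQG : QG σ 4 4 (Set.Icc (c - g c) (d + g d)) Q := by
    refine ⟨Q1, ?_⟩
    rintro m ⟨h1, h2⟩ n ⟨h3, h4⟩ hmn
    have Qc : Q c = γ c := Q2 c le_rfl (by omega)
    have Qd : Q d = γ d := Q2 d (by omega) le_rfl
    have t1 := hP.wd_tri (Q c) (Q m) (Q n)
    have t2 := hP.wd_tri (Q m) (Q n) (Q d)
    have t1' := hP.wd_comm (Q c) (Q m)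
    have t2' := hP.wd_comm (Q n) (Q d)
    push_cast
    by_cases m1 : m < c
    · have lm := Q5 m c h1 (by omega) le_rfl
      by_cases n1 : n ≤ c
      · have := Q5 m n h1 hmn n1
        omega
      · by_cases n2 : n ≤ d
        · have a1 := hgle n (ω c) hωc.1 hωc.2
          have a2 := hP.wd_tri (Q n) (Q m) (p (ω c))
          have a3 := Q5 (c - g c) m le_rfl h1 (by omega)
          rw [Q3, hP.wd_comm] at a3
          have a4 := hcm n (by simp; omega)
          have a5 := hγ c n (by omega) (by omega) (by omega)
          have a6 := hP.wd_comm (Q n) (Q m)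
          rw [Q2 n (by omega) n2] at *
          rw [Qc] at *
          omega
        · have a5 := hγ c d (by omega) (by omega) (by omega)
          have a6 := Q6 d n le_rfl (by omega) h4
          have a7 := hP.wd_tri (Q c) (Q m) (Q d)
          rw [← Qc, ← Qd] at a5
          omega
    · by_cases m2 : m ≤ d
      · by_cases n2 : n ≤ d
        · have := hγ m n (by omega) (by omega) (by omega)
          rw [Q2 m (by omega) (by omega), Q2 n (by omega) (by omega)]
          omega
        · have ln := Q6 d n le_rfl (by omega) h4
          have a1 := hgle m (ω d) hωd.1 hωd.2
          have a2 := hP.wd_tri (Q m) (Q n) (p (ω d))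
          have a3 := Q6 n (d + g d) (by omega) h4 le_rfl
          rw [Q4] at a3
          have a4 := hdm m (by simp; omega)
          have a5 := hγ m d (by omega) (by omega) (by omega)
          rw [Q2 m (by omega) m2] at *
          rw [Qd] at *
          omega
      · have := Q6 m n (by omega) hmn h4
        omega
  obtain ⟨m, hm, hmd⟩ := hM.sym hP (s := ω c) (t := ω d) hωc hωd (by omega) hQG Q3 Q4 (n := i) ⟨by omega, by omega⟩
  rw [Q2 i hci hid] at hmd
  refine ⟨m, ?_, hmd⟩
  rcases hm with hm | hm
  · exact ⟨hωc.1.trans hm.1, hm.2.trans hωd.2⟩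
  · exact ⟨hωd.1.trans hm.1, hm.2.trans hωc.2⟩

end P14

end MorseLTG

namespace MorseLTG

section P15
variable {S : Type*} {C : Set (Word S)} {G : Type*} [Group G] {σ : S → G}

theorem F4 (hP : Pres σ C) {A B E T L : ℕ} (hT : T = A * (4 * E + 2) + B + 1) (hTL : T ≤ L) {s t : ℤ} {p : ℤ → G} {ρ : ℤ → ℤ}
    (hpath : DIsPath σ (Set.Icc s t) p)
    (hloc : ∀ u v, s ≤ u → u ≤ v → v ≤ t → v - u ≤ L → v - u ≤ A * (wordDist σ (p u) (p v) : ℤ) + B)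
    (hρ : ∀ u v, s ≤ u → u ≤ t → s ≤ v → v ≤ t → |ρ u - ρ v| ≤ wordDist σ (p u) (p v) + 2 * E ∧
      wordDist σ (p u) (p v) ≤ |ρ u - ρ v| + 2 * E)
    (hs : ρ s = 0) (h0 : ∀ u, 0 ≤ ρ u) :
    ∀ u v, s ≤ u → u ≤ v → v ≤ t → v - u ≤ T * (ρ v - ρ u + (T + 2 * E + 1)) := by
  have hj : ∀ u, s ≤ u → u + 1 ≤ t → |ρ u - ρ (u+1)| ≤ 2 * E + 1 := by
    intro u h1 h2
    have e1 := (hρ u (u+1) h1 (by omega) (by omega) h2).1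
    have e2 := path_le hP hpath h1 (show u ≤ u + 1 by omega) h2
    omega
  have hbig : ∀ u, s ≤ u → u + T ≤ t → 2 * E + 3 ≤ |ρ u - ρ (u + T)| := by
    intro u h1 h2
    have e1 := hloc u (u+T) h1 (by omega) h2 (by omega)
    have e2 := (hρ u (u+T) h1 (by omega) (by omega) h2).2
    have e3 : 4 * E + 3 ≤ wordDist σ (p u) (p (u+T)) := by
      by_contra hc
      have := Nat.mul_le_mul_left A (show wordDist σ (p u) (p (u+T)) ≤ 4 * E + 2 by omega)
      have e4 : (A * wordDist σ (p u) (p (u+T)) : ℤ) ≤ A * (4 * E + 2) := by exact_mod_cast this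
      have e5 : (T : ℤ) = A * (4 * E + 2) + B + 1 := by rw [hT]; push_cast; ring
      omega
    omega
  have hpos : ∀ k : ℕ, s + k + T ≤ t → 2 * E + 3 ≤ ρ (s + k + T) - ρ (s + k) := by
    intro k
    induction k with
    | zero =>
      intro h
      have h1 := hbig (s + (0:ℕ)) (by omega) h
      have h2 := h0 (s + (0:ℕ) + T)
      have h3 : ρ (s + (0:ℕ)) = 0 := by simpa using hs
      rw [h3] at h1 ⊢
      rw [le_abs] at h1
      omega
    | succ k ih =>
      intro h
      push_cast at h
      have h1 := hbig (s + (k+1:ℕ)) (by omega) (by push_cast; omega)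
      have h2 := ih (by omega)
      have h3 := hj (s + k) (by omega) (by omega)
      have h4 := hj (s + k + T) (by omega) (by omega)
      have e1 : s + (k:ℤ) + T + 1 = s + (k+1:ℕ) + T := by push_cast; ring
      have e2 : s + (k:ℤ) + 1 = s + (k+1:ℕ) := by push_cast; ring
      rw [e1] at h4
      rw [e2] at h3
      rw [abs_le] at h3 h4
      rw [le_abs] at h1
      omega
  have key : ∀ n : ℕ, ∀ u v, (v - u).toNat ≤ n → s ≤ u → u ≤ v → v ≤ t → v - u ≤ T * (ρ v - ρ u + (T + 2 * E + 1)) := by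
    intro n
    induction n using Nat.strong_induction_on with
    | _ n ih =>
    intro u v hn h1 h2 h3
    by_cases hlt : v - u < T
    · have e1 := (hρ u v h1 (by omega) (by omega) h3).1
      have e2 := path_le hP hpath h1 h2 h3
      rw [abs_le] at e1
      have : (T:ℤ) * 1 ≤ T * (ρ v - ρ u + (T + 2 * E + 1)) := mul_le_mul_of_nonneg_left (by omega) (by omega)
      omega
    · have e1 := ih (v - (u + T)).toNat (by omega) (u + T) v le_rfl (by omega) (by omega) h3
      have e2 := hpos (u - s).toNat (by omega)
      have e3 : s + ((u - s).toNat : ℤ) = u := by omega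
      rw [e3] at e2
      have e4 : (T:ℤ) * (ρ v - ρ (u + T) + (T + 2 * E + 1) + 1) ≤ T * (ρ v - ρ u + (T + 2 * E + 1)) :=
        mul_le_mul_of_nonneg_left (by omega) (by omega)
      rw [mul_add, mul_one] at e4
      omega
  intro u v h1 h2 h3
  exact key _ u v le_rfl h1 h2 h3

theorem core (hP : Pres σ C) {A B E T L L0 H : ℕ} {D D1 : ℕ → ℕ} (hT : T = A * (4 * E + 2) + B + 1)
    (hH : H = T + 60 * E + 60)
    (hL : T * (L0 + 2 * (H + 4 * E + 2) + (T + 2 * E + 1) + 2 * D 4 + 1 + 2 * E) ≤ L)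
    (hGM : ∀ (g : G) (w : Word S), GW σ w →
      (∀ i j : ℤ, 0 ≤ i → i ≤ j → j ≤ w.length → j - i ≤ L0 →
        MO σ (fun N => D (N + 2 * D 4 * (N + 1)) + (A * (2 * D 4 + 1) + B + D 4)) (Set.Icc i j) (pathOfWord σ g w)) →
      MO σ D1 (Set.Icc 0 (w.length : ℤ)) (pathOfWord σ g w))
    {s t : ℤ} (hst : s ≤ t) {p : ℤ → G}
    (hloc : ∀ u v, s ≤ u → u ≤ v → v ≤ t → v - u ≤ L → QG σ A B (Set.Icc u v) p ∧ MO σ D (Set.Icc u v) p)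
    {w : Word S} (hw : GW σ w) (hwe : p s * evalWord σ w = p t)
    (hweak : ∀ u, s ≤ u → u ≤ t → ∃ i : ℤ, 0 ≤ i ∧ i ≤ w.length ∧ wordDist σ (p u) (pathOfWord σ (p s) w i) ≤ E) :
    MO σ D1 (Set.Icc 0 (w.length : ℤ)) (pathOfWord σ (p s) w) ∧
    (∀ i : ℤ, 0 ≤ i → i ≤ w.length → ∃ m, s ≤ m ∧ m ≤ t ∧ wordDist σ (pathOfWord σ (p s) w i) (p m) ≤ D 4) ∧
    (∀ u, s ≤ u → u ≤ t → ∃ i : ℤ, 0 ≤ i ∧ i ≤ w.length ∧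
      wordDist σ (p u) (pathOfWord σ (p s) w i) ≤ A * (2 * D 4 + 1) + B + D 4) ∧
    t - s ≤ T * (w.length + (T + 2 * E + 1)) := by
  set γ := pathOfWord σ (p s) w with hγd
  have hγ0 : γ 0 = p s := by simp [hγd, pathOfWord]
  have hγ1 : γ w.length = p t := by simp [hγd, pathOfWord, hwe]
  have hγ : ∀ m n : ℤ, 0 ≤ m → m ≤ n → n ≤ w.length → (wordDist σ (γ m) (γ n) : ℤ) = n - m := by
    intro m n h1 h2 h3
    simp only [hγd, pathOfWord]
    rw [gw_dist hP hw (by omega) (by omega)]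
    omega
  have hγabs : ∀ m n : ℤ, 0 ≤ m → m ≤ w.length → 0 ≤ n → n ≤ w.length → (wordDist σ (γ m) (γ n) : ℤ) = |m - n| := by
    intro m n h1 h2 h3 h4
    rcases le_total m n with h | h
    · rw [hγ m n h1 h h4, abs_of_nonpos (by omega)]; ring
    · rw [hP.wd_comm, hγ n m h3 h h2, abs_of_nonneg (by omega)]
  have hdeg : s = t → w.length = 0 := by
    intro h
    have := hγ 0 w.length le_rfl (by omega) le_rfl
    rw [hγ0, hγ1, h] at this
    rw [wd_self] at this
    push_cast at this; omega
  have hTp : 1 ≤ T := by omega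
  have hTL : T ≤ L := le_trans (by
    have := Nat.mul_le_mul_left T (show 1 ≤ (L0 + 2 * (H + 4 * E + 2) + (T + 2 * E + 1) + 2 * D 4 + 1 + 2 * E) by omega)
    omega) hL
  have hL' : ∀ X : ℤ, X ≤ L0 + 2 * (H + 4 * E + 2) + (T + 2 * E + 1) + 2 * D 4 + 1 + 2 * E → T * X ≤ L := by
    intro X hX
    have h1 : (T : ℤ) * X ≤ T * (L0 + 2 * (H + 4 * E + 2) + (T + 2 * E + 1) + 2 * D 4 + 1 + 2 * E) :=
      mul_le_mul_of_nonneg_left hX (by omega)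
    have h2 : (T : ℤ) * (L0 + 2 * (H + 4 * E + 2) + (T + 2 * E + 1) + 2 * D 4 + 1 + 2 * E) ≤ L := by exact_mod_cast hL
    omega
  have hpath : DIsPath σ (Set.Icc s t) p := by
    rintro n ⟨h1, h2⟩ ⟨h3, h4⟩
    exact (hloc n (n+1) h1 (by omega) h4 (by omega)).1.1 n ⟨le_rfl, by omega⟩ ⟨by omega, le_rfl⟩
  -- the projection
  have hex : ∀ u : ℤ, ∃ i : ℤ, 0 ≤ i ∧ i ≤ w.length ∧ (u = s → i = 0) ∧ (u = t → i = w.length) ∧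
      (s ≤ u → u ≤ t → wordDist σ (p u) (γ i) ≤ E) := by
    intro u
    by_cases h1 : u = s
    · refine ⟨0, le_rfl, by omega, fun _ => rfl, fun h2 => ?_, fun _ _ => by rw [h1, hγ0]; simp⟩
      rw [hdeg (by omega)]; simp
    · by_cases h2 : u = t
      · exact ⟨w.length, by omega, le_rfl, fun h => absurd h h1, fun _ => rfl, fun _ _ => by rw [h2, hγ1]; simp⟩
      · by_cases h3 : s ≤ u ∧ u ≤ t
        · obtain ⟨i, g1, g2, g3⟩ := hweak u h3.1 h3.2
          exact ⟨i, g1, g2, fun h => absurd h h1, fun h => absurd h h2, fun _ _ => g3⟩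
        · exact ⟨0, le_rfl, by omega, fun h => absurd h h1, fun h => absurd h h2, fun a b => absurd ⟨a, b⟩ h3⟩
  choose ρ ρ0 ρ1 ρs ρt ρd using hex
  have hρs := ρs s rfl
  have hρt := ρt t rfl
  have hρ : ∀ u v, s ≤ u → u ≤ t → s ≤ v → v ≤ t → |ρ u - ρ v| ≤ wordDist σ (p u) (p v) + 2 * E ∧
      wordDist σ (p u) (p v) ≤ |ρ u - ρ v| + 2 * E := by
    intro u v h1 h2 h3 h4
    have a1 := ρd u h1 h2
    have a2 := ρd v h3 h4
    have a3 := hγabs (ρ u) (ρ v) (ρ0 u) (ρ1 u) (ρ0 v) (ρ1 v)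
    have a4 := hP.wd_tri (γ (ρ u)) (p u) (γ (ρ v))
    have a5 := hP.wd_tri (p u) (p v) (γ (ρ v))
    have a6 := hP.wd_tri (p u) (γ (ρ u)) (p v)
    have a7 := hP.wd_tri (γ (ρ u)) (γ (ρ v)) (p v)
    have a8 := hP.wd_comm (p u) (γ (ρ u))
    have a9 := hP.wd_comm (p v) (γ (ρ v))
    constructor <;> omega
  have hmono := F4 hP hT hTL hpath (fun u v h1 h2 h3 h4 => (hloc u v h1 h2 h3 h4).1.2 u ⟨le_rfl, h2⟩ v ⟨h2, le_rfl⟩ h2) hρ hρs ρ0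
  have hjump : ∀ i, s ≤ i → i < t → |ρ (i+1) - ρ i| ≤ 2 * E + 1 := by
    intro u h1 h2
    have e1 := (hρ (u+1) u (by omega) (by omega) (by omega) (by omega)).1
    have e2 := path_le hP hpath h1 (show u ≤ u + 1 by omega) h2
    rw [hP.wd_comm] at e2
    omega
  have hkey : ∀ i0 i1 : ℤ, 0 ≤ i0 → i0 ≤ i1 → i1 ≤ w.length → i1 - i0 ≤ L0 → ∃ u v, s ≤ u ∧ u ≤ v ∧ v ≤ t ∧ v - u ≤ L ∧
      ∀ i, i0 ≤ i → i ≤ i1 → ∃ m ∈ Set.Icc u v, wordDist σ (γ i) (p m) ≤ D 4 := by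
    intro i0 i1 h1 h2 h3 h4
    obtain ⟨u, u1, u2, u3, u4, u5⟩ : ∃ u, s ≤ u ∧ u ≤ t ∧ (u = s ∨ ρ u ≤ i0 - H) ∧ i0 - (H + 4 * E + 2) ≤ ρ u ∧ ρ u ≤ i0 := by
      by_cases h : i0 ≤ H + 2 * E + 1
      · exact ⟨s, le_rfl, hst, Or.inl rfl, by omega, by omega⟩
      · obtain ⟨u, g1, g2, g3⟩ := ivt' (x := i0 - (H + 2 * E + 1)) hst (by omega) hjump (Or.inl ⟨by omega, by omega⟩)
        rw [abs_le] at g3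
        exact ⟨u, g1, g2, Or.inr (by omega), by omega, by omega⟩
    obtain ⟨v, v1, v2, v3, v4, v5⟩ : ∃ u, s ≤ u ∧ u ≤ t ∧ (u = t ∨ i1 + H ≤ ρ u) ∧ i1 ≤ ρ u ∧ ρ u ≤ i1 + (H + 4 * E + 2) := by
      by_cases h : w.length ≤ i1 + (H + 2 * E + 1)
      · exact ⟨t, hst, le_rfl, Or.inl rfl, by omega, by omega⟩
      · obtain ⟨u, g1, g2, g3⟩ := ivt' (x := i1 + (H + 2 * E + 1)) hst (by omega) hjump (Or.inl ⟨by omega, by omega⟩)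
        rw [abs_le] at g3
        exact ⟨u, g1, g2, Or.inr (by omega), by omega, by omega⟩
    have huv : u ≤ v := by
      by_contra hc
      have e1 := hmono v u v1 (by omega) u2
      have e2 : (T:ℤ) * (ρ u - ρ v + (T + 2 * E + 1)) ≤ T * 0 :=
        mul_le_mul_of_nonneg_left (by rcases u3 with h | h <;> omega) (by omega)
      omega
    have hvuL : v - u ≤ L := (hmono u v u1 huv v2).trans (hL' _ (by omega))
    refine ⟨u, v, u1, huv, v2, hvuL, fun i g1 g2 => ?_⟩
    have a1 := ρd u u1 u2
    have a2 := ρd v v1 v2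
    rw [hP.wd_comm] at a1 a2
    refine IL hP huv (hloc u v u1 huv v2 hvuL).2 (a := ρ u) (b := ρ v) (i := i) (E := E) (γ := γ)
      (fun m n b1 b2 b3 => hγ m n (by have := ρ0 u; omega) b2 (by have := ρ1 v; omega)) (by omega) (by omega) a1 a2 ?_ ?_
    · rcases u3 with h | h
      · left; rw [h, hρs, hγ0]
      · right; omega
    · rcases v3 with h | h
      · left; rw [h, hρt, hγ1]
      · right; omega
  have hnear : ∀ i : ℤ, 0 ≤ i → i ≤ w.length → ∃ m, s ≤ m ∧ m ≤ t ∧ wordDist σ (γ i) (p m) ≤ D 4 := by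
    intro i h1 h2
    obtain ⟨u, v, g1, g2, g3, _, g4⟩ := hkey i i h1 le_rfl h2 (by omega)
    obtain ⟨m, hm, hmd⟩ := g4 i le_rfl le_rfl
    exact ⟨m, g1.trans hm.1, hm.2.trans g3, hmd⟩
  have hMO : MO σ D1 (Set.Icc 0 (w.length : ℤ)) γ := by
    apply hGM _ _ hw
    intro i j h1 h2 h3 h4
    obtain ⟨u, v, g1, g2, g3, g4, g5⟩ := hkey i j h1 h2 h3 h4
    have := hloc u v g1 g2 g3 g4
    refine CC hP this.1 this.2 ?_ g5
    rintro n ⟨a1, a2⟩ ⟨a3, a4⟩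
    have := hγ n (n+1) (by omega) (by omega) (by omega)
    show wordDist σ (γ n) (γ (n+1)) ≤ 1
    omega
  refine ⟨hMO, hnear, ?_, ?_⟩
  · have hcl : ∀ m n, s ≤ m → m ≤ n → n ≤ t → wordDist σ (p m) (p n) ≤ 2 * D 4 + 1 → n - m ≤ A * (2 * D 4 + 1) + B := by
      intro m n h1 h2 h3 h4
      have e1 := hmono m n h1 h2 h3
      have e2 := (hρ m n h1 (by omega) (by omega) h3).1
      rw [abs_le] at e2
      have e3 := hL' (ρ n - ρ m + (T + 2 * E + 1)) (by omega)
      have e4 := (hloc m n h1 h2 h3 (by omega)).1.2 m ⟨le_rfl, h2⟩ n ⟨h2, le_rfl⟩ h2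
      have e5 : (A : ℤ) * wordDist σ (p m) (p n) ≤ A * (2 * D 4 + 1) :=
        mul_le_mul_of_nonneg_left (by exact_mod_cast h4) (by omega)
      omega
    have hex : ∀ i : ℤ, ∃ m, s ≤ m ∧ m ≤ t ∧ (i < 0 → m = s) ∧ (w.length < i → m = t) ∧
        wordDist σ (γ (max 0 (min i w.length))) (p m) ≤ D 4 := by
      intro i
      by_cases h1 : i < 0
      · refine ⟨s, le_rfl, hst, fun _ => rfl, fun h2 => by omega, ?_⟩
        rw [max_eq_left (by omega), hγ0]; simp
      · by_cases h2 : w.length < i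
        · refine ⟨t, hst, le_rfl, fun h => absurd h h1, fun _ => rfl, ?_⟩
          rw [min_eq_right (by omega), max_eq_right (by omega), hγ1]; simp
        · obtain ⟨m, g1, g2, g3⟩ := hnear i (by omega) (by omega)
          refine ⟨m, g1, g2, fun h => absurd h h1, fun h => absurd h h2, ?_⟩
          rw [min_eq_left (by omega), max_eq_right (by omega)]; exact g3
    choose f f1 f2 f3 f4 f5 using hex
    intro u hu1 hu2
    obtain ⟨i, i1, i2, i3⟩ := ivt' (f := f) (a := -1) (b := w.length + 1) (c := A * (2 * D 4 + 1) + B) (x := u) (by omega)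
      (by positivity) (by
        intro i h1 h2
        have e1 := f5 i
        have e2 := f5 (i+1)
        have e3 := hγabs (max 0 (min i w.length)) (max 0 (min (i+1) w.length)) (by omega) (by omega) (by omega) (by omega)
        have e4 : |max 0 (min i (w.length:ℤ)) - max 0 (min (i+1) w.length)| ≤ 1 := by rw [abs_le]; constructor <;> omega
        have e5 := hP.wd_tri (p (f i)) (γ (max 0 (min i w.length))) (p (f (i+1)))
        have e6 := hP.wd_tri (γ (max 0 (min i w.length))) (γ (max 0 (min (i+1) w.length))) (p (f (i+1)))
        rw [hP.wd_comm] at e1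
        have e7 : wordDist σ (p (f i)) (p (f (i+1))) ≤ 2 * D 4 + 1 := by omega
        rcases le_total (f i) (f (i+1)) with h | h
        · rw [abs_of_nonneg (by omega)]
          exact hcl _ _ (f1 _) h (f2 _) e7
        · rw [abs_of_nonpos (by omega)]
          rw [hP.wd_comm] at e7
          have := hcl _ _ (f1 _) h (f2 _) e7
          omega)
      (Or.inl ⟨by rw [f3 (-1) (by omega)]; exact hu1, by rw [f4 (w.length + 1) (by omega)]; exact hu2⟩)
    refine ⟨max 0 (min i w.length), by omega, by omega, ?_⟩
    have e1 := path_abs hP hpath ⟨hu1, hu2⟩ ⟨f1 i, f2 i⟩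
    have e2 := f5 i
    rw [hP.wd_comm] at e2
    have e3 := hP.wd_tri (p u) (p (f i)) (γ (max 0 (min i w.length)))
    rw [abs_sub_comm] at i3
    have e4 : wordDist σ (p u) (p (f i)) ≤ A * (2 * D 4 + 1) + B := by
      have := e1.trans i3
      exact_mod_cast this
    omega
  · have := hmono s t le_rfl hst le_rfl
    rw [hρs, hρt, sub_zero] at this
    exact this

end P15

end MorseLTG

namespace MorseLTG

section P16
variable {S : Type*} {C : Set (Word S)} {G : Type*} [Group G] {σ : S → G}

theorem gstep (hP : Pres σ C) {D1 : ℕ → ℕ} {n n' : ℕ} {γ γ' : ℤ → G}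
    (hγ : ∀ i j : ℤ, 0 ≤ i → i ≤ j → j ≤ n → (wordDist σ (γ i) (γ j) : ℤ) = j - i)
    (hγ' : ∀ i j : ℤ, 0 ≤ i → i ≤ j → j ≤ n' → (wordDist σ (γ' i) (γ' j) : ℤ) = j - i)
    (h0 : γ 0 = γ' 0) (h1 : wordDist σ (γ n) (γ' n') ≤ 1) (hM : MO σ D1 (Set.Icc 0 (n' : ℤ)) γ') (j : ℤ) (hj0 : 0 ≤ j)
    (hj1 : j ≤ n') : ∃ i : ℤ, 0 ≤ i ∧ i ≤ n ∧ wordDist σ (γ' j) (γ i) ≤ 2 * D1 2 + 1 := by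
  have hnn : (n' : ℤ) ≤ n + 1 := by
    have e1 := hγ 0 n le_rfl (by omega) le_rfl
    have e2 := hγ' 0 n' le_rfl (by omega) le_rfl
    have e3 := hP.wd_tri (γ' 0) (γ n) (γ' n')
    rw [h0] at e1
    omega
  let q : ℤ → G := fun k => if k ≤ n then γ k else γ' n'
  have q1 : ∀ k : ℤ, k ≤ n → q k = γ k := fun k hk => by simp [q, hk]
  have q2 : q (n + 1) = γ' n' := by simp [q]
  have hq : QG σ 2 2 (Set.Icc (0:ℤ) (n + 1)) q := by
    refine ⟨?_, ?_⟩
    · rintro k ⟨a1, a2⟩ ⟨a3, a4⟩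
      by_cases h : k + 1 ≤ n
      · rw [q1 k (by omega), q1 (k+1) h]
        have := hγ k (k+1) a1 (by omega) h
        omega
      · have : k = n := by omega
        subst this
        rw [q1 n le_rfl, q2]; exact h1
    · rintro m ⟨a1, a2⟩ k ⟨a3, a4⟩ hmk
      by_cases h : k ≤ n
      · rw [q1 k h, q1 m (by omega)]
        have := hγ m k a1 hmk h
        push_cast; omega
      · have hk : k = n + 1 := by omega
        subst hk
        by_cases h' : m ≤ n
        · rw [q2, q1 m h']
          have e1 := hγ m n a1 h' le_rfl
          have e2 := hP.wd_tri (γ m) (γ' n') (γ n)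
          rw [hP.wd_comm (γ' n')] at e2
          push_cast; omega
        · have : m = n + 1 := by omega
          subst this
          push_cast; omega
  obtain ⟨m, ⟨m0, m1⟩, hm⟩ := hM 2 0 ⟨le_rfl, by omega⟩ n' ⟨by omega, le_rfl⟩ (by omega) q 0 (n+1) (by omega) hq
    (by rw [q1 0 (by omega), h0]) q2 (min j n) ⟨by omega, by omega⟩
  rw [q1 _ (by omega)] at hm
  refine ⟨min j n, by omega, by omega, ?_⟩
  have e1 := hγ 0 (min j n) le_rfl (by omega) (by omega)
  have e2 := hγ' 0 m le_rfl m0 m1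
  have e3 := hP.wd_tri (γ' 0) (γ (min j n)) (γ' m)
  have e4 := hP.wd_tri (γ' 0) (γ' m) (γ (min j n))
  rw [hP.wd_comm (γ' m)] at e4
  rw [h0] at e1
  have e5 := hP.wd_tri (γ' j) (γ' m) (γ (min j n))
  rw [hP.wd_comm (γ' m)] at e5
  have e6 : (wordDist σ (γ' j) (γ' m) : ℤ) ≤ D1 2 + 1 := by
    rcases le_total j m with h | h
    · rw [hγ' j m hj0 h m1]; omega
    · rw [hP.wd_comm, hγ' m j m0 h hj1]; omega
  omega

theorem strong (hP : Pres σ C) {A B E T L L0 H : ℕ} {D D1 : ℕ → ℕ} (hE : E = A * (2 * D 4 + 1) + B + D 4 + 2 * D1 2 + 1)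
    (hT : T = A * (4 * E + 2) + B + 1)
    (hH : H = T + 60 * E + 60)
    (hL : T * (L0 + 2 * (H + 4 * E + 2) + (T + 2 * E + 1) + 2 * D 4 + 1 + 2 * E) ≤ L)
    (hGM : ∀ (g : G) (w : Word S), GW σ w →
      (∀ i j : ℤ, 0 ≤ i → i ≤ j → j ≤ w.length → j - i ≤ L0 →
        MO σ (fun N => D (N + 2 * D 4 * (N + 1)) + (A * (2 * D 4 + 1) + B + D 4)) (Set.Icc i j) (pathOfWord σ g w)) →
      MO σ D1 (Set.Icc 0 (w.length : ℤ)) (pathOfWord σ g w))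
    {p : ℤ → G} {s : ℤ} (k : ℕ)
    (hloc : ∀ u v, s ≤ u → u ≤ v → v ≤ s + k → v - u ≤ L → QG σ A B (Set.Icc u v) p ∧ MO σ D (Set.Icc u v) p) :
    ∃ w : Word S, GW σ w ∧ w.length = wordDist σ (p s) (p (s + k)) ∧ p s * evalWord σ w = p (s + k) ∧
    MO σ D1 (Set.Icc 0 (w.length : ℤ)) (pathOfWord σ (p s) w) ∧
    (∀ i : ℤ, 0 ≤ i → i ≤ w.length → ∃ m, s ≤ m ∧ m ≤ s + k ∧ wordDist σ (pathOfWord σ (p s) w i) (p m) ≤ D 4) ∧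
    (∀ u, s ≤ u → u ≤ s + k → ∃ i : ℤ, 0 ≤ i ∧ i ≤ w.length ∧
      wordDist σ (p u) (pathOfWord σ (p s) w i) ≤ A * (2 * D 4 + 1) + B + D 4) ∧
    s + k - s ≤ T * (w.length + (T + 2 * E + 1)) := by
  have hgeo : ∀ (g : G) (w : Word S), GW σ w → ∀ i j : ℤ, 0 ≤ i → i ≤ j → j ≤ w.length →
      (wordDist σ (pathOfWord σ g w i) (pathOfWord σ g w j) : ℤ) = j - i := by
    intro g w hw m n h1 h2 h3
    simp only [pathOfWord]
    rw [gw_dist hP hw (by omega) (by omega)]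
    omega
  induction k with
  | zero =>
    obtain ⟨w, h1, h2, h3⟩ := hP.gw (p s) (p (s + (0:ℕ)))
    refine ⟨w, h3, h1, h2, core hP hT hH hL hGM (by simp) hloc h3 h2 ?_⟩
    intro u hu1 hu2
    have : u = s := by push_cast at hu2; omega
    subst this
    exact ⟨0, le_rfl, by omega, by simp [pathOfWord]⟩
  | succ k ih =>
    obtain ⟨w', a1, a2, a3, a4, a5, a6, a7⟩ := ih (fun u v h1 h2 h3 h4 => hloc u v h1 h2 (by push_cast; omega) h4)
    obtain ⟨w, h1, h2, h3⟩ := hP.gw (p s) (p (s + (k+1:ℕ)))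
    have hTp : 1 ≤ T := by omega
    have hTL : T ≤ L := le_trans (by
      have := Nat.mul_le_mul_left T (show 1 ≤ (L0 + 2 * (H + 4 * E + 2) + (T + 2 * E + 1) + 2 * D 4 + 1 + 2 * E) by omega)
      omega) hL
    refine ⟨w, h3, h1, h2, core hP hT hH hL hGM (by push_cast; omega) hloc h3 h2 ?_⟩
    have hend : pathOfWord σ (p s) w w.length = p (s + (k+1:ℕ)) := by simpa [pathOfWord] using h2
    have hend' : pathOfWord σ (p s) w' w'.length = p (s + k) := by simpa [pathOfWord] using a3
    intro u hu1 hu2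
    by_cases hu : u ≤ s + k
    · obtain ⟨j, b1, b2, b3⟩ := a6 u hu1 hu
      obtain ⟨i, c1, c2, c3⟩ := gstep hP (hgeo (p s) w h3) (hgeo (p s) w' a1) (by simp [pathOfWord]) (by
        rw [hend, hend', hP.wd_comm]
        have := (hloc (s+k) (s+k+1) (by omega) (by omega) (by push_cast; omega) (by omega)).1.1 (s+k)
          ⟨le_rfl, by omega⟩ ⟨by omega, le_rfl⟩
        push_cast; rw [← add_assoc]; exact this) a4 j b1 b2
      refine ⟨i, c1, c2, ?_⟩
      have := hP.wd_tri (p u) (pathOfWord σ (p s) w' j) (pathOfWord σ (p s) w i)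
      omega
    · have : u = s + (k+1:ℕ) := by push_cast at hu2 ⊢; omega
      exact ⟨w.length, by omega, le_rfl, by rw [this, hend]; simp⟩

theorem RL (hP : Pres σ C) (hS : SigC σ) (D : ℕ → ℕ) (A B : ℕ) : ∃ L A' B' : ℕ, ∃ D' : ℕ → ℕ, ∀ I : Set ℤ, I.OrdConnected →
    ∀ p : ℤ → G, (∀ s ∈ I, ∀ t ∈ I, s ≤ t → t - s ≤ L → QG σ A B (Set.Icc s t) p ∧ MO σ D (Set.Icc s t) p) →
    QG σ A' B' I p ∧ MO σ D' I p := by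
  obtain ⟨L0, D1, hGM⟩ := GM hP hS (fun N => D (N + 2 * D 4 * (N + 1)) + (A * (2 * D 4 + 1) + B + D 4))
  obtain ⟨E, hE⟩ : ∃ E, E = A * (2 * D 4 + 1) + B + D 4 + 2 * D1 2 + 1 := ⟨_, rfl⟩
  obtain ⟨T, hT⟩ : ∃ T, T = A * (4 * E + 2) + B + 1 := ⟨_, rfl⟩
  obtain ⟨H, hH⟩ : ∃ H, H = T + 60 * E + 60 := ⟨_, rfl⟩
  obtain ⟨L, hL⟩ : ∃ L, T * (L0 + 2 * (H + 4 * E + 2) + (T + 2 * E + 1) + 2 * D 4 + 1 + 2 * E) ≤ L := ⟨_, le_rfl⟩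
  refine ⟨L + 1, T, T * (T + 2 * E + 1), fun N => D1 N + D 4, fun I hI p hloc => ?_⟩
  have hst := fun s (hs : s ∈ I) t (ht : t ∈ I) (h : s ≤ t) => strong hP hE hT hH hL hGM (p := p) (s := s) (t - s).toNat
    (fun u v h1 h2 h3 h4 => hloc u (hI.out hs ht ⟨h1, by omega⟩) v (hI.out hs ht ⟨by omega, by omega⟩) h2 (by push_cast; omega))
  have hst' : ∀ s t : ℤ, s ≤ t → s + ((t - s).toNat : ℤ) = t := fun s t h => by omega
  refine ⟨⟨?_, ?_⟩, ?_⟩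
  · intro n hn hn1
    exact (hloc n hn (n+1) hn1 (by omega) (by push_cast; omega)).1.1 n ⟨le_rfl, by omega⟩ ⟨by omega, le_rfl⟩
  · intro m hm n hn hmn
    obtain ⟨w, h1, h2, h3, h4, h5, h6, h7⟩ := hst m hm n hn hmn
    rw [hst' m n hmn] at h2 h7
    rw [h2, mul_add] at h7
    push_cast
    exact h7
  · intro N s hs t ht hle q a b hab hq hqa hqb n hn
    obtain ⟨w, h1, h2, h3, h4, h5, h6, h7⟩ := hst s hs t ht hle
    rw [hst' s t hle] at h3 h5
    obtain ⟨i, ⟨i1, i2⟩, hi⟩ := h4 N 0 ⟨le_rfl, by omega⟩ w.length ⟨by omega, le_rfl⟩ (by omega) q a b hab hq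
      (by rw [hqa]; simp [pathOfWord]) (by rw [hqb, ← h3]; simp [pathOfWord]) n hn
    obtain ⟨m, m1, m2, hm⟩ := h5 i i1 i2
    refine ⟨m, ⟨m1, m2⟩, ?_⟩
    have := hP.wd_tri (q n) (pathOfWord σ (p s) w i) (p m)
    simp only
    omega

end P16

end MorseLTG

open MorseLTG in
/-- a `C'(1/9)` group with σ-compact Morse boundary satisfies the
Morse local-to-global property. -/
theorem stmt2 {S : Type*} [Fintype S] (R : Set (Word S))
    (hsc : SmallCancellation R (1 / 9))
    (hσc : CaySigmaCompact (presGen R)) :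
    ∀ M : ℝ → ℝ, IsMorseGauge M → ∀ Q : ℝ, 1 ≤ Q →
      ∃ (L Q' : ℝ) (M'' : ℝ → ℝ), 0 < L ∧ 1 ≤ Q' ∧ IsMorseGauge M'' ∧
        ∀ I : Set ℤ, I.OrdConnected → ∀ p : ℤ → PresentedGroup (FreeGroup.mk '' R),
          DLocMorseQGeoOn (presGen R) Q M L I p →
            DQGeoOn (presGen R) Q' I p ∧ DMorseOn (presGen R) M'' I p := by
  have hP := pres_main hsc
  intro M hM Q hQ
  obtain ⟨L, A', B', D', h⟩ := RL hP (sigC_of hP hσc) (fun N => ⌊M (N+1)⌋₊) ((⌊Q⌋₊+1)^2) ((⌊Q⌋₊+1)^2)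
  obtain ⟨M'', hM1, hM2⟩ := gauge_exists (fun k => D' ((k+1)^2))
  refine ⟨(L + 1 : ℕ), (A' + B' + 1 : ℕ), M'', by positivity, by exact_mod_cast (by omega), hM1, fun I hI p hp => ?_⟩
  obtain ⟨h1, h2⟩ := h I hI p (fun s hs t ht hst hL => by
    obtain ⟨g1, g2⟩ := hp s hs t ht hst (by
      have : t - s ≤ ((L + 1 : ℕ) : ℤ) := by push_cast; omega
      exact_mod_cast this)
    exact ⟨QG.ofD hQ g1, MO.ofD hP hM g2⟩)
  exact ⟨QG.toD hP (by omega) hI (h1.mono (by omega) (by omega)), MO.toD hM2 h2⟩
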